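/- arXiv:2010.12524 — 2 statements merged into one kernel-verified Lean document; each statement's English description precedes it below -/
import Mathlib

section
/- Assume additionally that each a_{ij} is continuously differentiable on B₁ × ℝ with |∇_x a_{ij}| + |∂_z a_{ij}| ≤ Λ₁ for some constant Λ₁ > 0. Then there exists a constant C > 0, depending only on n, Λ and Λ₁, such that every solution φ satisfies the interior gradient Hölder estimate: sup_{B_{1/2}} (|φ| + |∇φ|) ≤ (C e^{κ})^{C e^{4Λκ}} and |∇φ(x) − ∇φ(y)| ≤ (C e^{κ})^{C e^{4Λκ}} |x − y|^{1/3} for all x, y ∈ B_{1/2}. -/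
open MeasureTheory Metric Real Set

/-- A (weak) solution of the quasilinear elliptic equation
`-∂ⱼ(aᵢⱼ(x,φ)∂ᵢφ) = ρ(x,φ)[1 - (1/2) f e^φ + F(x,φ,∇φ)]` on the unit ball `B₁ ⊆ ℝⁿ`,
which is continuously differentiable and satisfies `0 ≤ φ ≤ κ`. -/
def IsSolution (n : ℕ) (κ : ℝ)
    (a : Fin n → Fin n → EuclideanSpace ℝ (Fin n) → ℝ → ℝ)
    (ρ : EuclideanSpace ℝ (Fin n) → ℝ → ℝ)
    (f : EuclideanSpace ℝ (Fin n) → ℝ)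
    (F : EuclideanSpace ℝ (Fin n) → ℝ → EuclideanSpace ℝ (Fin n) → ℝ)
    (φ : EuclideanSpace ℝ (Fin n) → ℝ) : Prop :=
  ContDiffOn ℝ 1 φ (ball (0 : EuclideanSpace ℝ (Fin n)) 1) ∧
  (∀ x ∈ ball (0 : EuclideanSpace ℝ (Fin n)) 1, 0 ≤ φ x ∧ φ x ≤ κ) ∧
  ∀ ψ : EuclideanSpace ℝ (Fin n) → ℝ,
    ContDiff ℝ (⊤ : ℕ∞) ψ → HasCompactSupport ψ →
    tsupport ψ ⊆ ball (0 : EuclideanSpace ℝ (Fin n)) 1 →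
    (∫ x in ball (0 : EuclideanSpace ℝ (Fin n)) 1,
        ∑ i : Fin n, ∑ j : Fin n,
          a i j x (φ x) * fderiv ℝ φ x (EuclideanSpace.single i 1) *
            fderiv ℝ ψ x (EuclideanSpace.single j 1))
      = ∫ x in ball (0 : EuclideanSpace ℝ (Fin n)) 1,
          ρ x (φ x) * (1 - (1/2) * f x * Real.exp (φ x) + F x (φ x) (gradient φ x)) * ψ x

/-- Structural assumptions on the coefficients: symmetry and `Λ`-ellipticity of `aᵢⱼ`,
`1/2 ≤ ρ ≤ 2`, `0 ≤ f ≤ 1`, the natural growth bound `|F(x,z,p)| ≤ |p|² + 1`,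
and continuity of all coefficients. -/
def GoodCoeffs (n : ℕ) (Λ : ℝ)
    (a : Fin n → Fin n → EuclideanSpace ℝ (Fin n) → ℝ → ℝ)
    (ρ : EuclideanSpace ℝ (Fin n) → ℝ → ℝ)
    (f : EuclideanSpace ℝ (Fin n) → ℝ)
    (F : EuclideanSpace ℝ (Fin n) → ℝ → EuclideanSpace ℝ (Fin n) → ℝ) : Prop :=
  (∀ i j, ContinuousOn (fun p : EuclideanSpace ℝ (Fin n) × ℝ => a i j p.1 p.2)
      ((ball (0 : EuclideanSpace ℝ (Fin n)) 1) ×ˢ (Set.univ : Set ℝ))) ∧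
  (∀ i j x z, a i j x z = a j i x z) ∧
  (∀ x ∈ ball (0 : EuclideanSpace ℝ (Fin n)) 1, ∀ z : ℝ, ∀ ξ : EuclideanSpace ℝ (Fin n),
      Λ⁻¹ * ‖ξ‖ ^ 2 ≤ ∑ i : Fin n, ∑ j : Fin n, a i j x z * ξ i * ξ j ∧
      ∑ i : Fin n, ∑ j : Fin n, a i j x z * ξ i * ξ j ≤ Λ * ‖ξ‖ ^ 2) ∧
  ContinuousOn (fun p : EuclideanSpace ℝ (Fin n) × ℝ => ρ p.1 p.2)
      ((ball (0 : EuclideanSpace ℝ (Fin n)) 1) ×ˢ (Set.univ : Set ℝ)) ∧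
  (∀ x ∈ ball (0 : EuclideanSpace ℝ (Fin n)) 1, ∀ z : ℝ, 1/2 ≤ ρ x z ∧ ρ x z ≤ 2) ∧
  ContinuousOn f (ball (0 : EuclideanSpace ℝ (Fin n)) 1) ∧
  (∀ x ∈ ball (0 : EuclideanSpace ℝ (Fin n)) 1, 0 ≤ f x ∧ f x ≤ 1) ∧
  ContinuousOn (fun p : EuclideanSpace ℝ (Fin n) × ℝ × EuclideanSpace ℝ (Fin n) =>
      F p.1 p.2.1 p.2.2)
      ((ball (0 : EuclideanSpace ℝ (Fin n)) 1) ×ˢ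
        (Set.univ : Set (ℝ × EuclideanSpace ℝ (Fin n)))) ∧
  (∀ x ∈ ball (0 : EuclideanSpace ℝ (Fin n)) 1, ∀ (z : ℝ) (p : EuclideanSpace ℝ (Fin n)),
      |F x z p| ≤ ‖p‖ ^ 2 + 1)

/-- The coefficients `aᵢⱼ` are continuously differentiable on `B₁ × ℝ` with
`|∇ₓ aᵢⱼ| + |∂_z aᵢⱼ| ≤ Λ₁`. -/
def C1Bound (n : ℕ) (Λ₁ : ℝ)
    (a : Fin n → Fin n → EuclideanSpace ℝ (Fin n) → ℝ → ℝ) : Prop :=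
  (∀ i j, ContDiffOn ℝ 1 (fun p : EuclideanSpace ℝ (Fin n) × ℝ => a i j p.1 p.2)
      ((ball (0 : EuclideanSpace ℝ (Fin n)) 1) ×ˢ (Set.univ : Set ℝ))) ∧
  (∀ i j, ∀ x ∈ ball (0 : EuclideanSpace ℝ (Fin n)) 1, ∀ z : ℝ,
      ‖fderiv ℝ (fun y => a i j y z) x‖ + |deriv (fun w => a i j x w) z| ≤ Λ₁)

set_option linter.all false


lemma hasDerivAt_maxpow (m : ℕ) (hm : 1 ≤ m) (t : ℝ) :
    HasDerivAt (fun t : ℝ => max t 0 ^ (m+1)) ((m+1) * max t 0 ^ m) t := by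
  rcases lt_trichotomy t 0 with h | h | h
  · have : (fun t : ℝ => max t 0 ^ (m+1)) =ᶠ[nhds t] fun _ => 0 := by
      filter_upwards [Iio_mem_nhds h] with s hs
      simp only [Set.mem_Iio] at hs
      rw [max_eq_right hs.le]; simp
    rw [max_eq_right h.le]
    have h0 : ((m:ℝ)+1) * 0 ^ m = 0 := by
      rw [zero_pow (by omega)]; ring
    rw [h0]
    exact (hasDerivAt_const t (0:ℝ)).congr_of_eventuallyEq this
  · subst h
    have h0 : ((m:ℝ)+1) * max (0:ℝ) 0 ^ m = 0 := by
      rw [max_self, zero_pow (by omega)]; ring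
    rw [h0]
    rw [hasDerivAt_iff_isLittleO_nhds_zero]
    simp only [zero_add, max_self, smul_zero, sub_zero]
    have : (fun h : ℝ => max h 0 ^ (m+1) - 0 ^ (m+1)) =O[nhds 0] fun h : ℝ => h ^ (m+1) := by
      refine Asymptotics.IsBigO.of_bound 1 ?_
      filter_upwards with s
      rw [zero_pow (by omega), sub_zero, one_mul, norm_pow, norm_pow]
      gcongr
      rw [Real.norm_eq_abs, Real.norm_eq_abs, abs_of_nonneg (le_max_right _ _)]
      exact max_le (le_abs_self _) (abs_nonneg _)
    refine this.trans_isLittleO ?_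
    have := Asymptotics.isLittleO_pow_id (𝕜 := ℝ) (n := m+1) (by omega)
    simpa using this
  · have : (fun t : ℝ => max t 0 ^ (m+1)) =ᶠ[nhds t] fun t => t ^ (m+1) := by
      filter_upwards [Ioi_mem_nhds h] with s hs
      simp only [Set.mem_Ioi] at hs
      rw [max_eq_left hs.le]
    rw [max_eq_left h.le]
    have h2 := (hasDerivAt_pow (m+1) t).congr_of_eventuallyEq this
    simpa using h2

section Kernel
variable {E : Type*} [NormedAddCommGroup E] [InnerProductSpace ℝ E]

/-- quadratic form of `B`. -/
noncomputable def qf (B : E →L[ℝ] E) (z : E) : ℝ := inner ℝ (B z) z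
/-- positive part of `1 - q`. -/
noncomputable def kp (B : E →L[ℝ] E) (z : E) : ℝ := max (1 - qf B z) 0
/-- averaging kernel. -/
noncomputable def keta (B : E →L[ℝ] E) (z : E) : ℝ := kp B z ^ 2
/-- potential kernel. -/
noncomputable def kkap (B : E →L[ℝ] E) (z : E) : ℝ := kp B z ^ 3 / 6

/-- `A0` elliptic with inverse `B`. -/
structure Ker (L : ℝ) (A0 B : E →L[ℝ] E) : Prop where
  one_le : 1 ≤ L
  symA : ∀ p q, inner ℝ (A0 p) q = inner ℝ p (A0 q)
  symB : ∀ p q, inner ℝ (B p) q = inner ℝ p (B q)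
  inv : ∀ z, A0 (B z) = z
  inv' : ∀ z, B (A0 z) = z
  nA : ‖A0‖ ≤ L
  nB : ‖B‖ ≤ L
  low : ∀ z, ‖z‖ ^ 2 ≤ L ^ 3 * qf B z

lemma exists_ker [FiniteDimensional ℝ E] (L : ℝ) (hL : 1 ≤ L) (A0 : E →L[ℝ] E)
    (sym : ∀ p q, inner ℝ (A0 p) q = inner ℝ p (A0 q))
    (coer : ∀ p, L⁻¹ * ‖p‖ ^ 2 ≤ inner ℝ (A0 p) p) (nA : ‖A0‖ ≤ L) :
    ∃ B, Ker L A0 B := by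
  have L0 : 0 < L := by linarith
  have coer' : ∀ p, ‖p‖ ^ 2 ≤ L * inner ℝ (A0 p) p := by
    intro p
    have := coer p
    rw [inv_mul_le_iff₀ L0] at this
    exact this
  have inj : Function.Injective (A0 : E →ₗ[ℝ] E) := by
    rw [injective_iff_map_eq_zero]
    intro p hp
    have hp' : A0 p = 0 := hp
    have := coer' p
    rw [hp', inner_zero_left, mul_zero] at this
    have : ‖p‖ = 0 := by nlinarith [norm_nonneg p]
    exact norm_eq_zero.1 this
  let e := (LinearEquiv.ofInjectiveEndo (A0 : E →ₗ[ℝ] E) inj).toContinuousLinearEquiv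
  have he : ∀ z, e z = A0 z := fun z => rfl
  let B : E →L[ℝ] E := e.symm
  have inv : ∀ z, A0 (B z) = z := fun z => by rw [← he]; exact e.apply_symm_apply z
  have inv' : ∀ z, B (A0 z) = z := fun z => by rw [← he]; exact e.symm_apply_apply z
  have hB : ∀ z, ‖B z‖ ≤ L * ‖z‖ := by
    intro z
    have h1 := coer' (B z)
    rw [inv] at h1
    have h2 : inner ℝ z (B z) ≤ ‖z‖ * ‖B z‖ := real_inner_le_norm _ _
    by_contra h
    push Not at h
    have h3 : 0 < ‖B z‖ := lt_of_le_of_lt (by positivity) h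
    nlinarith
  refine ⟨B, hL, sym, ?_, inv, inv', nA, ?_, ?_⟩
  · intro p q
    conv_lhs => rw [← inv q]
    rw [← sym, inv]
  · exact ContinuousLinearMap.opNorm_le_bound _ L0.le hB
  · intro z
    have h1 := coer' (B z)
    rw [inv] at h1
    have h2 : ‖z‖ ≤ L * ‖B z‖ := by
      conv_lhs => rw [← inv z]
      exact (A0.le_opNorm _).trans (by gcongr)
    have h3 : ‖z‖^2 ≤ L^2 * ‖B z‖^2 := by
      rw [← mul_pow]; gcongr
    calc ‖z‖^2 ≤ L^2 * ‖B z‖^2 := h3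
      _ ≤ L^2 * (L * inner ℝ z (B z)) := by gcongr
      _ = L^3 * qf B z := by rw [qf, real_inner_comm]; ring

variable {L : ℝ} {A0 B : E →L[ℝ] E}

lemma Ker.qf_le (h : Ker L A0 B) (z : E) : qf B z ≤ L * ‖z‖ ^ 2 := by
  have h1 : qf B z ≤ ‖B z‖ * ‖z‖ := real_inner_le_norm _ _
  have h2 : ‖B z‖ ≤ L * ‖z‖ := (B.le_opNorm z).trans (by gcongr; exact h.nB)
  nlinarith [norm_nonneg z]

lemma Ker.nBz (h : Ker L A0 B) (z : E) : ‖B z‖ ≤ L * ‖z‖ :=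
  (B.le_opNorm z).trans (by gcongr; exact h.nB)

lemma kp_nonneg (B : E →L[ℝ] E) (z : E) : 0 ≤ kp B z := le_max_right _ _

lemma Ker.qf_nonneg (h : Ker L A0 B) (z : E) : 0 ≤ qf B z := by
  have h1 := h.low z
  have h2 : 0 < L ^ 3 := by have := h.one_le; positivity
  by_contra hh
  push Not at hh
  nlinarith [sq_nonneg ‖z‖]

lemma Ker.kp_le (h : Ker L A0 B) (z : E) : kp B z ≤ 1 :=
  max_le (by linarith [h.qf_nonneg z]) zero_le_one

lemma Ker.kp_zero (h : Ker L A0 B) {z : E} (hz : L ^ 2 ≤ ‖z‖) : kp B z = 0 := by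
  have h1 := h.low z
  have hL := h.one_le
  have h2 : L ^ 3 ≤ ‖z‖ ^ 2 := by
    calc L ^ 3 ≤ L ^ 4 := pow_le_pow_right₀ hL (by norm_num)
      _ = (L^2)^2 := by ring
      _ ≤ ‖z‖^2 := by gcongr
  have h3 : 0 < L ^ 3 := by positivity
  apply max_eq_right
  nlinarith

lemma Ker.kp_low (h : Ker L A0 B) {z : E} (hz : ‖z‖ ≤ 1 / (2 * L)) : 3/4 ≤ kp B z := by
  have h1 := h.qf_le z
  have hL := h.one_le
  have h2 : ‖z‖ ^ 2 ≤ (1 / (2 * L)) ^ 2 := by gcongr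
  have h3 : L * (1 / (2 * L)) ^ 2 ≤ 1/4 := by
    have : L * (1 / (2 * L)) ^ 2 = 1 / (4 * L) := by field_simp; ring
    rw [this, div_le_div_iff₀ (by positivity) (by norm_num)]
    linarith
  have : L * ‖z‖^2 ≤ L * (1 / (2 * L)) ^ 2 := by gcongr
  exact le_max_of_le_left (by linarith)

lemma continuous_qf (B : E →L[ℝ] E) : Continuous (qf B) := by
  unfold qf; fun_prop

lemma continuous_kp (B : E →L[ℝ] E) : Continuous (kp B) := by
  have := continuous_qf B
  unfold kp; fun_prop

lemma continuous_keta (B : E →L[ℝ] E) : Continuous (keta B) := by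
  have := continuous_kp B
  unfold keta; fun_prop

lemma continuous_kkap (B : E →L[ℝ] E) : Continuous (kkap B) := by
  have := continuous_kp B
  unfold kkap; fun_prop

lemma Ker.hasFDerivAt_qf (h : Ker L A0 B) (z : E) :
    HasFDerivAt (qf B) ((2:ℝ) • innerSL ℝ (B z)) z := by
  have h1 : HasFDerivAt (fun z => B z) B z := B.hasFDerivAt
  have h2 := h1.inner ℝ (hasFDerivAt_id z)
  refine h2.congr_fderiv ?_
  ext v
  simp only [ContinuousLinearMap.comp_apply, fderivInnerCLM_apply, ContinuousLinearMap.prod_apply, id,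
    ContinuousLinearMap.smul_apply, innerSL_apply_apply, smul_eq_mul, ContinuousLinearMap.id_apply]
  rw [h.symB v z, real_inner_comm v]
  ring

lemma Ker.hasFDerivAt_kp_pow (h : Ker L A0 B) (m : ℕ) (hm : 1 ≤ m) (z : E) :
    HasFDerivAt (fun z => kp B z ^ (m+1)) ((-2 * (m+1) * kp B z ^ m : ℝ) • innerSL ℝ (B z)) z := by
  have h1 := (hasDerivAt_maxpow m hm (1 - qf B z)).hasFDerivAt.comp z ((h.hasFDerivAt_qf z).const_sub 1)
  refine h1.congr_fderiv ?_
  ext v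
  simp [kp]
  ring

lemma Ker.hasFDerivAt_keta (h : Ker L A0 B) (z : E) :
    HasFDerivAt (keta B) ((-4 * kp B z : ℝ) • innerSL ℝ (B z)) z := by
  refine (h.hasFDerivAt_kp_pow 1 le_rfl z).congr_fderiv ?_
  norm_num

lemma Ker.hasFDerivAt_kkap (h : Ker L A0 B) (z : E) :
    HasFDerivAt (kkap B) ((-keta B z : ℝ) • innerSL ℝ (B z)) z := by
  have := (h.hasFDerivAt_kp_pow 2 (by norm_num) z).const_mul (1/6)
  refine (this.congr_fderiv ?_).congr_of_eventuallyEq ?_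
  · ext v; simp [keta]; ring
  · filter_upwards with y; simp [kkap]; ring

/-- the directional derivative of `kkap`. -/
noncomputable def kpsi (B : E →L[ℝ] E) (e z : E) : ℝ := -(keta B z * inner ℝ (B z) e)

/-- its gradient -/
noncomputable def gpsi (B : E →L[ℝ] E) (e z : E) : E :=
  (4 * kp B z * inner ℝ (B z) e) • B z - keta B z • B e

lemma Ker.hasFDerivAt_kpsi (h : Ker L A0 B) (e z : E) :
    HasFDerivAt (kpsi B e) (innerSL ℝ (gpsi B e z)) z := by
  have h1 : HasFDerivAt (fun z => inner ℝ (B z) e) (innerSL ℝ (B e)) z := by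
    have : (fun z => inner ℝ (B z) e) = fun z => innerSL ℝ (B e) z := by
      ext z; simp [h.symB z e, real_inner_comm]
    rw [this]
    exact (innerSL ℝ (B e)).hasFDerivAt
  have h2 := ((h.hasFDerivAt_keta z).mul h1).neg
  refine h2.congr_fderiv ?_
  ext v
  simp [gpsi, inner_sub_left, inner_smul_left]
  ring

variable [CompleteSpace E]

lemma grad_of_hasFDerivAt {f : E → ℝ} {z p : E} (h : HasFDerivAt f (innerSL ℝ p) z) :
    gradient f z = p := by
  have : HasGradientAt f p z := by
    rw [hasGradientAt_iff_hasFDerivAt]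
    exact h
  exact this.gradient

lemma Ker.grad_kkap (h : Ker L A0 B) (z : E) : gradient (kkap B) z = -(keta B z) • B z := by
  apply grad_of_hasFDerivAt
  refine (h.hasFDerivAt_kkap z).congr_fderiv ?_
  ext v; simp [inner_smul_left]

lemma Ker.grad_keta (h : Ker L A0 B) (z : E) : gradient (keta B) z = (-4 * kp B z) • B z := by
  apply grad_of_hasFDerivAt
  refine (h.hasFDerivAt_keta z).congr_fderiv ?_
  ext v; simp [inner_smul_left]

lemma Ker.grad_kpsi (h : Ker L A0 B) (e z : E) : gradient (kpsi B e) z = gpsi B e z :=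
  grad_of_hasFDerivAt (h.hasFDerivAt_kpsi e z)

lemma contDiff_one_of_hasFDerivAt {f : E → ℝ} {p : E → E} (h : ∀ z, HasFDerivAt f (innerSL ℝ (p z)) z)
    (hp : Continuous p) : ContDiff ℝ 1 f := by
  rw [contDiff_one_iff_fderiv]
  refine ⟨fun z => (h z).differentiableAt, ?_⟩
  have : fderiv ℝ f = fun z => innerSL ℝ (p z) := by
    ext1 z; exact (h z).fderiv
  rw [this]
  fun_prop

lemma Ker.contDiff_kkap (h : Ker L A0 B) : ContDiff ℝ 1 (kkap B) := by
  apply contDiff_one_of_hasFDerivAt (p := fun z => -(keta B z) • B z)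
  · intro z
    refine (h.hasFDerivAt_kkap z).congr_fderiv ?_
    ext v; simp [inner_smul_left]
  · have := continuous_keta B; fun_prop

lemma Ker.contDiff_keta (h : Ker L A0 B) : ContDiff ℝ 1 (keta B) := by
  apply contDiff_one_of_hasFDerivAt (p := fun z => (-4 * kp B z) • B z)
  · intro z
    refine (h.hasFDerivAt_keta z).congr_fderiv ?_
    ext v; simp [inner_smul_left]
  · have := continuous_kp B; fun_prop

lemma Ker.contDiff_kpsi (h : Ker L A0 B) (e : E) : ContDiff ℝ 1 (kpsi B e) := by
  apply contDiff_one_of_hasFDerivAt (p := gpsi B e) (h.hasFDerivAt_kpsi e)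
  have := continuous_kp B
  have := continuous_keta B
  unfold gpsi
  fun_prop

end Kernel


section SolSec
variable {E : Type*} [NormedAddCommGroup E] [InnerProductSpace ℝ E] [FiniteDimensional ℝ E]
  [MeasurableSpace E] [BorelSpace E]

lemma inner_grad (f : E → ℝ) (x v : E) : inner ℝ (gradient f x) v = fderiv ℝ f x v := by
  simp [gradient]

lemma innerSL_grad (f : E → ℝ) (x : E) : innerSL ℝ (gradient f x) = fderiv ℝ f x := by
  ext v; simp [inner_grad]

lemma norm_grad (f : E → ℝ) (x : E) : ‖gradient f x‖ = ‖fderiv ℝ f x‖ := by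
  simp [gradient]

lemma cont_grad {f : E → ℝ} (hf : ContDiff ℝ 1 f) : Continuous (gradient f) := by
  have := hf.continuous_fderiv one_ne_zero
  unfold gradient
  exact (InnerProductSpace.toDual ℝ E).symm.continuous.comp this

lemma grad_hasFDerivAt {f : E → ℝ} {x : E} (hf : DifferentiableAt ℝ f x) :
    HasFDerivAt f (innerSL ℝ (gradient f x)) x := by
  rw [innerSL_grad]; exact hf.hasFDerivAt

lemma grad_zero_of_notMem {f : E → ℝ} {x : E} (hx : x ∉ tsupport f) : gradient f x = 0 := by
  have : fderiv ℝ f x = 0 := by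
    have := fderiv_of_notMem_tsupport (𝕜 := ℝ) hx
    exact this
  rw [gradient, this]; simp

lemma integrable_of_tsupport {f : E → ℝ} {K : Set E} (hK : IsCompact K) (hf : ContinuousOn f K)
    (h0 : ∀ x ∉ K, f x = 0) : Integrable f := by
  have h1 : IntegrableOn f K := hf.integrableOn_compact hK
  rw [← integrableOn_univ]
  have : IntegrableOn f (K ∪ Kᶜ) := by
    refine h1.union ?_
    refine (integrableOn_zero (s := Kᶜ) (μ := volume)).congr_fun ?_ hK.measurableSet.compl
    intro x hx
    exact (h0 x hx).symm
  simpa using this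

/-- abstract weak solution. -/
structure Sol (Ω : Set E) (L S : ℝ) (A : E → E →L[ℝ] E) (u G : E → ℝ) : Prop where
  oL : 1 ≤ L
  S0 : 0 ≤ S
  cd : ContDiff ℝ 1 u
  cA : ContinuousOn A Ω
  sym : ∀ x ∈ Ω, ∀ p q, inner ℝ (A x p) q = inner ℝ p (A x q)
  coer : ∀ x ∈ Ω, ∀ p, L⁻¹ * ‖p‖ ^ 2 ≤ inner ℝ (A x p) p
  nA : ∀ x ∈ Ω, ‖A x‖ ≤ L
  cG : ContinuousOn G Ω
  G_le : ∀ x ∈ Ω, |G x| ≤ 2 * ‖gradient u x‖ ^ 2 + S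
  weak : ∀ ψ : E → ℝ, ContDiff ℝ 1 ψ → HasCompactSupport ψ → tsupport ψ ⊆ Ω →
    ∫ x, inner ℝ (A x (gradient u x)) (gradient ψ x) = ∫ x, G x * ψ x

lemma grad_neg (u : E → ℝ) (x : E) : gradient (fun x => - u x) x = - gradient u x := by
  simp [gradient]

lemma Sol.mono {Ω Ω' : Set E} {L S : ℝ} {A : E → E →L[ℝ] E} {u G : E → ℝ} (h : Sol Ω L S A u G)
    (hs : Ω' ⊆ Ω) : Sol Ω' L S A u G where
  oL := h.oL
  S0 := h.S0
  cd := h.cd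
  cA := h.cA.mono hs
  sym := fun x hx => h.sym x (hs hx)
  coer := fun x hx => h.coer x (hs hx)
  nA := fun x hx => h.nA x (hs hx)
  cG := h.cG.mono hs
  G_le := fun x hx => h.G_le x (hs hx)
  weak := fun ψ h1 h2 h3 => h.weak ψ h1 h2 (h3.trans hs)

lemma Sol.neg {Ω : Set E} {L S : ℝ} {A : E → E →L[ℝ] E} {u G : E → ℝ} (h : Sol Ω L S A u G) :
    Sol Ω L S A (fun x => - u x) (fun x => - G x) where
  oL := h.oL
  S0 := h.S0
  cd := h.cd.neg
  cA := h.cA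
  sym := h.sym
  coer := h.coer
  nA := h.nA
  cG := h.cG.neg
  G_le := fun x hx => by rw [grad_neg, norm_neg, abs_neg]; exact h.G_le x hx
  weak := fun ψ h1 h2 h3 => by
    have := h.weak ψ h1 h2 h3
    simp only [grad_neg, map_neg, inner_neg_left, neg_mul, integral_neg, this]

lemma grad_scale {u : E → ℝ} (hu : ContDiff ℝ 1 u) (x0 : E) (σ : ℝ) (z : E) :
    gradient (fun z => u (x0 + σ • z)) z = σ • gradient u (x0 + σ • z) := by
  apply grad_of_hasFDerivAt
  have h1 : HasFDerivAt (fun z : E => x0 + σ • z) (σ • ContinuousLinearMap.id ℝ E) z :=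
    ((hasFDerivAt_id z).const_smul σ).const_add x0
  have h2 := (grad_hasFDerivAt (hu.differentiable one_ne_zero (x0 + σ • z))).comp z h1
  refine h2.congr_fderiv ?_
  ext v
  simp [inner_smul_left, inner_smul_right]

lemma integral_scale (f : E → ℝ) (x0 : E) {σ : ℝ} (hσ : 0 < σ) :
    ∫ z, f (x0 + σ • z) = (σ ^ Module.finrank ℝ E)⁻¹ * ∫ x, f x := by
  have h1 := Measure.integral_comp_smul (volume : Measure E) (fun y => f (x0 + y)) σ
  rw [h1, integral_add_left_eq_self, abs_of_pos (by positivity), smul_eq_mul]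

lemma Sol.scale {Ω : Set E} {L S : ℝ} {A : E → E →L[ℝ] E} {u G : E → ℝ} (h : Sol Ω L S A u G)
    (x0 : E) {σ : ℝ} (hσ : 0 < σ) {Ω' : Set E} (hΩ : ∀ z ∈ Ω', x0 + σ • z ∈ Ω) :
    Sol Ω' L (σ ^ 2 * S) (fun z => A (x0 + σ • z)) (fun z => u (x0 + σ • z))
      (fun z => σ ^ 2 * G (x0 + σ • z)) where
  oL := h.oL
  S0 := by have := h.S0; positivity
  cd := h.cd.comp (by fun_prop)
  cA := h.cA.comp (by fun_prop) hΩ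
  sym := fun z hz => h.sym _ (hΩ z hz)
  coer := fun z hz => h.coer _ (hΩ z hz)
  nA := fun z hz => h.nA _ (hΩ z hz)
  cG := continuousOn_const.mul (h.cG.comp (by fun_prop) hΩ)
  G_le := fun z hz => by
    rw [grad_scale h.cd, norm_smul, abs_mul, mul_pow, Real.norm_eq_abs, sq_abs, abs_of_nonneg (sq_nonneg σ)]
    have := h.G_le _ (hΩ z hz)
    nlinarith [sq_nonneg σ]
  weak := fun ψ h1 h2 h3 => by
    let ψ' : E → ℝ := fun x => ψ (σ⁻¹ • (x - x0))
    have e1 : ∀ x, ψ' x = ψ ((-(σ⁻¹ • x0)) + σ⁻¹ • x) := by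
      intro x; simp only [ψ']; congr 1; rw [smul_sub]; abel
    have e1' : ψ' = fun x => ψ ((-(σ⁻¹ • x0)) + σ⁻¹ • x) := funext e1
    have c1 : ContDiff ℝ 1 ψ' := by
      rw [e1']; exact h1.comp (by fun_prop)
    let hom : E ≃ₜ E := (Homeomorph.addLeft (-x0)).trans (Homeomorph.smulOfNeZero σ⁻¹ (by positivity))
    have e2 : ψ' = ψ ∘ hom := by
      ext x; simp only [ψ', hom, Function.comp, Homeomorph.trans_apply]
      congr 1
      simp [sub_eq_neg_add]
    have c2 : HasCompactSupport ψ' := by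
      rw [e2]; exact h2.comp_homeomorph hom
    have c3 : tsupport ψ' ⊆ Ω := by
      rw [e2, tsupport_comp_eq_preimage]
      intro x hx
      have := hΩ _ (h3 hx)
      have e : x0 + σ • hom x = x := by
        simp [hom, smul_smul, hσ.ne']
      rwa [e] at this
    have key := h.weak ψ' c1 c2 c3
    have e3 : ∀ z, ψ' (x0 + σ • z) = ψ z := by
      intro z; simp [ψ', smul_smul, hσ.ne']
    have e4 : ∀ z, gradient ψ' (x0 + σ • z) = σ⁻¹ • gradient ψ z := by
      intro z
      rw [e1', grad_scale h1, smul_add, smul_smul, inv_mul_cancel₀ hσ.ne']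
      simp
    have i1 := integral_scale (fun x => inner ℝ (A x (gradient u x)) (gradient ψ' x)) x0 hσ
    have i2 := integral_scale (fun x => G x * ψ' x) x0 hσ
    rw [key, ← i2] at i1
    simp only [e3, e4] at i1
    simp only [grad_scale h.cd, map_smul, inner_smul_left, inner_smul_right] at i1 ⊢
    simp only [RCLike.conj_to_real, integral_const_mul, mul_assoc] at i1 ⊢
    rw [← i1]
    field_simp

end SolSec


section CacSec
variable {E : Type*} [NormedAddCommGroup E] [InnerProductSpace ℝ E] [FiniteDimensional ℝ E]
  [MeasurableSpace E] [BorelSpace E]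

/-- logarithmic transform -/
noncomputable def lw (c b : ℝ) (u : E → ℝ) (x : E) : ℝ := Real.log c - Real.log (b - u x)

lemma lw_hasFDerivAt {c b : ℝ} {u : E → ℝ} {x : E} (hu : DifferentiableAt ℝ u x) (hx : u x < b) :
    HasFDerivAt (lw c b u) (innerSL ℝ ((b - u x)⁻¹ • gradient u x)) x := by
  have h1 := ((grad_hasFDerivAt hu).const_sub b).log (by linarith)
  have h2 := h1.const_sub (Real.log c)
  refine h2.congr_fderiv ?_
  ext v; simp [inner_smul_left]

lemma lw_contDiffAt {c b : ℝ} {u : E → ℝ} {x : E} (hu : ContDiff ℝ 1 u) (hx : u x < b) :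
    ContDiffAt ℝ 1 (lw c b u) x := by
  unfold lw
  exact contDiffAt_const.sub ((contDiffAt_const.sub hu.contDiffAt).log (by linarith))

lemma mul_contDiff_of_tsupport {χ V : E → ℝ} (hχ : ContDiff ℝ 1 χ)
    (hV : ∀ x ∈ tsupport χ, ContDiffAt ℝ 1 V x) : ContDiff ℝ 1 (fun x => χ x ^ 2 * V x) := by
  rw [contDiff_iff_contDiffAt]
  intro x
  by_cases hx : x ∈ tsupport χ
  · exact (hχ.contDiffAt.pow 2).mul (hV x hx)
  · have : (fun x => χ x ^ 2 * V x) =ᶠ[nhds x] fun _ => 0 := by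
      rw [notMem_tsupport_iff_eventuallyEq] at hx
      filter_upwards [hx] with y hy
      simp [hy]
    exact contDiffAt_const.congr_of_eventuallyEq this

lemma tsupport_mul_sq {χ V : E → ℝ} : tsupport (fun x => χ x ^ 2 * V x) ⊆ tsupport χ := by
  apply closure_mono
  intro x hx hh
  apply hx
  simp [hh]

lemma cac_alg {χ th th' P X L S y δ q r g : ℝ} (hL : 1 ≤ L) (hδ : 0 < δ) (hy : δ ≤ y) (hS : 0 ≤ S)
    (hth : 0 ≤ th) (hth' : 0 ≤ th') (hP : 0 ≤ P) (hX : 0 ≤ X)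
    (hq : |q| ≤ L * P * X) (hr : L⁻¹ * P ^ 2 ≤ r) (hg : |g| ≤ 2 * P ^ 2 + S)
    (hyL : th ≠ 0 → y ≤ 1 / (4 * L)) :
    (1 / (4 * L)) * (χ ^ 2 * th * (y⁻¹ ^ 2 * P ^ 2)) - (4 * L ^ 3 * X ^ 2 + S / δ * χ ^ 2) * th
      ≤ 2 * χ * (th * y⁻¹) * q + χ ^ 2 * ((th' + th) * y⁻¹ ^ 2) * r - g * (χ ^ 2 * (th * y⁻¹)) := by
  have y0 : 0 < y := by linarith
  have L0 : 0 < L := by linarith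
  have hr0 : 0 ≤ r := le_trans (by positivity) hr
  have hthr : 0 ≤ χ ^ 2 * (th' * y⁻¹ ^ 2) * r := by positivity
  by_cases h0 : th = 0
  · subst h0; simp only [inv_pow] at hthr; simp; linarith
  have hyL := hyL h0
  set t := y⁻¹ with ht
  have t0 : 0 < t := by positivity
  have ty : t * y = 1 := by rw [ht]; field_simp
  have tδ : t ≤ δ⁻¹ := by rw [ht]; exact inv_anti₀ hδ hy
  have a1 : -(|χ| * (L * P * X)) ≤ χ * q := by
    have : |χ * q| ≤ |χ| * (L * P * X) := by rw [abs_mul]; gcongr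
    linarith [neg_abs_le (χ * q)]
  have a2 : L⁻¹ * (t * P) ^ 2 ≤ t ^ 2 * r := by
    calc L⁻¹ * (t * P) ^ 2 = t ^ 2 * (L⁻¹ * P ^ 2) := by ring
      _ ≤ _ := by gcongr
  have a3 : g * t ≤ (1 / (2 * L)) * (t * P) ^ 2 + S / δ := by
    have b1 : g * t ≤ (2 * P ^ 2 + S) * t := by gcongr; exact (le_abs_self g).trans hg
    have b2 : S * t ≤ S / δ := by rw [div_eq_mul_inv]; gcongr
    have b3 : 2 * P ^ 2 * t ≤ (1 / (2 * L)) * (t * P) ^ 2 := by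
      calc 2 * P ^ 2 * t = 2 * y * (t * P) ^ 2 := by
            calc 2 * P ^ 2 * t = 2 * P^2 * t * (t * y) := by rw [ty, mul_one]
              _ = _ := by ring
        _ ≤ 2 * (1 / (4 * L)) * (t * P) ^ 2 := by gcongr
        _ = _ := by field_simp; ring
    linarith
  have a4 : 2 * (|χ| * (L * (t * P) * X)) ≤ (1 / (4 * L)) * (χ ^ 2 * (t * P) ^ 2) + 4 * L ^ 3 * X ^ 2 := by
    have : 0 ≤ (1 / (4 * L)) * (|χ| * (t * P) - 4 * L ^ 2 * X) ^ 2 := by positivity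
    have e : (1 / (4 * L)) * (|χ| * (t * P) - 4 * L ^ 2 * X) ^ 2 =
      (1 / (4 * L)) * (|χ| ^ 2 * (t * P) ^ 2) + 4 * L ^ 3 * X ^ 2 - 2 * (|χ| * (L * (t * P) * X)) := by
      field_simp; ring
    rw [sq_abs] at e
    linarith
  have main : (1 / (4 * L)) * (χ ^ 2 * (t * P) ^ 2) - (4 * L ^ 3 * X ^ 2 + S / δ * χ ^ 2)
      ≤ 2 * t * (χ * q) + χ ^ 2 * (t ^ 2 * r) - χ ^ 2 * (g * t) := by
    have c1 : χ ^ 2 * (L⁻¹ * (t * P) ^ 2) ≤ χ ^ 2 * (t ^ 2 * r) := by gcongr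
    have c2 : χ ^ 2 * (g * t) ≤ χ ^ 2 * ((1 / (2 * L)) * (t * P) ^ 2 + S / δ) := by gcongr
    have c3 : 2 * t * (-(|χ| * (L * P * X))) ≤ 2 * t * (χ * q) := by gcongr
    have e : χ ^ 2 * (L⁻¹ * (t * P) ^ 2) = 4 * ((1 / (4 * L)) * (χ ^ 2 * (t * P) ^ 2)) := by
      field_simp
    have e2 : χ ^ 2 * ((1 / (2 * L)) * (t * P) ^ 2 + S / δ) = 2 * ((1 / (4 * L)) * (χ ^ 2 * (t * P) ^ 2))
      + S / δ * χ ^ 2 := by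
      field_simp; ring
    nlinarith
  have := mul_le_mul_of_nonneg_left main hth
  nlinarith

lemma Sol.cac {Ω : Set E} {L S : ℝ} {A : E → E →L[ℝ] E} {u G : E → ℝ} (h : Sol Ω L S A u G)
    {χ : E → ℝ} (hχ : ContDiff ℝ 1 χ) (hc : HasCompactSupport χ) (hs : tsupport χ ⊆ Ω)
    {c b δ : ℝ} (hδ : 0 < δ) (hu : ∀ x ∈ tsupport χ, δ ≤ b - u x)
    {θ : ℝ → ℝ} (hθ : ContDiff ℝ 1 θ) (th0 : ∀ t, 0 ≤ θ t) (th' : ∀ t, 0 ≤ deriv θ t)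
    (hsm : ∀ x ∈ tsupport χ, θ (lw c b u x) ≠ 0 → b - u x ≤ 1 / (4 * L)) :
    ∫ x, χ x ^ 2 * θ (lw c b u x) * ((b - u x)⁻¹ ^ 2 * ‖gradient u x‖ ^ 2) ≤
      ∫ x, (16 * L ^ 4 * ‖gradient χ x‖ ^ 2 + 4 * L * S / δ * χ x ^ 2) * θ (lw c b u x) := by
  have hub : ∀ x ∈ tsupport χ, u x < b := fun x hx => by linarith [hu x hx]
  set V : E → ℝ := fun x => θ (lw c b u x) * (b - u x)⁻¹ with hV
  have cV : ∀ x ∈ tsupport χ, ContDiffAt ℝ 1 V x := by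
    intro x hx
    have h1 := lw_contDiffAt (c := c) h.cd (hub x hx)
    refine (hθ.contDiffAt.comp x h1).mul (ContDiffAt.inv (contDiffAt_const.sub h.cd.contDiffAt) ?_)
    linarith [hub x hx]
  have gV : ∀ x ∈ tsupport χ, HasFDerivAt V (innerSL ℝ
      (((deriv θ (lw c b u x) + θ (lw c b u x)) * (b - u x)⁻¹ ^ 2) • gradient u x)) x := by
    intro x hx
    have hd := h.cd.differentiable one_ne_zero x
    have h1 := lw_hasFDerivAt (c := c) hd (hub x hx)
    have h2 := (hθ.differentiable one_ne_zero (lw c b u x)).hasDerivAt.hasFDerivAt.comp x h1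
    have hne : b - u x ≠ 0 := by linarith [hub x hx]
    have h3 := (hasDerivAt_inv hne).hasFDerivAt.comp x ((grad_hasFDerivAt hd).const_sub b)
    refine (h2.mul h3).congr_fderiv ?_
    ext v
    simp [inner_smul_left]
    field_simp
    ring
  set ψ : E → ℝ := fun x => χ x ^ 2 * V x with hψ
  have p1 : ContDiff ℝ 1 ψ := mul_contDiff_of_tsupport hχ cV
  have p2 : HasCompactSupport ψ := hc.mono' (subset_closure.trans tsupport_mul_sq)
  have p3 : tsupport ψ ⊆ Ω := tsupport_mul_sq.trans hs
  have key := h.weak ψ p1 p2 p3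
  have gψ : ∀ x ∈ tsupport χ, gradient ψ x = (2 * χ x * V x) • gradient χ x +
      (χ x ^ 2 * ((deriv θ (lw c b u x) + θ (lw c b u x)) * (b - u x)⁻¹ ^ 2)) • gradient u x := by
    intro x hx
    apply grad_of_hasFDerivAt
    have h1 := ((grad_hasFDerivAt (hχ.differentiable one_ne_zero x)).pow 2).mul (gV x hx)
    refine h1.congr_fderiv ?_
    ext v
    simp [inner_smul_left]
    ring
  have K : IsCompact (tsupport χ) := hc
  have off : ∀ x ∉ tsupport χ, χ x = 0 := fun x hx => image_eq_zero_of_notMem_tsupport hx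
  have cw : ContinuousOn (lw c b u) (tsupport χ) := fun x hx =>
    (lw_contDiffAt (c := c) h.cd (hub x hx)).continuousAt.continuousWithinAt
  have ct : ContinuousOn (fun x => θ (lw c b u x)) (tsupport χ) := hθ.continuous.comp_continuousOn cw
  have ci : ContinuousOn (fun x => (b - u x)⁻¹) (tsupport χ) := by
    refine ContinuousOn.inv₀ (continuousOn_const.sub h.cd.continuous.continuousOn) ?_
    intro x hx; linarith [hub x hx]
  have cgu := (cont_grad h.cd)
  have cgχ := (cont_grad hχ)
  have cχ := hχ.continuous
  have cu := h.cd.continuous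
  have I1 : Integrable (fun x => inner ℝ (A x (gradient u x)) (gradient ψ x)) := by
    refine integrable_of_tsupport K ?_ ?_
    · have := h.cA.mono hs
      have := cont_grad p1
      exact ContinuousOn.inner (ContinuousOn.clm_apply (h.cA.mono hs) cgu.continuousOn) (cont_grad p1).continuousOn
    · intro x hx
      rw [grad_zero_of_notMem (fun hh => hx (tsupport_mul_sq hh)), inner_zero_right]
  have I2 : Integrable (fun x => G x * ψ x) := by
    refine integrable_of_tsupport K ((h.cG.mono hs).mul p1.continuous.continuousOn) ?_
    intro x hx; simp [hψ, off x hx]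
  have I3 : Integrable (fun x => χ x ^ 2 * θ (lw c b u x) * ((b - u x)⁻¹ ^ 2 * ‖gradient u x‖ ^ 2)) := by
    refine integrable_of_tsupport K ?_ ?_
    · exact ((cχ.pow 2).continuousOn.mul ct).mul ((ci.pow 2).mul (cgu.norm.pow 2).continuousOn)
    · intro x hx; simp [off x hx]
  have I4 : Integrable (fun x => (4 * L ^ 3 * ‖gradient χ x‖ ^ 2 + S / δ * χ x ^ 2) * θ (lw c b u x)) := by
    refine integrable_of_tsupport K ?_ ?_
    · exact (((cgχ.norm.pow 2).const_mul _).add ((cχ.pow 2).const_mul _)).continuousOn.mul ct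
    · intro x hx; simp [off x hx, grad_zero_of_notMem hx]
  have L0 : 0 < L := by linarith [h.oL]
  have pw : ∀ x, (1 / (4 * L)) * (χ x ^ 2 * θ (lw c b u x) * ((b - u x)⁻¹ ^ 2 * ‖gradient u x‖ ^ 2)) -
      (4 * L ^ 3 * ‖gradient χ x‖ ^ 2 + S / δ * χ x ^ 2) * θ (lw c b u x) ≤
      inner ℝ (A x (gradient u x)) (gradient ψ x) - G x * ψ x := by
    intro x
    by_cases hx : x ∈ tsupport χ
    · have hxΩ := hs hx
      rw [gψ x hx, inner_add_right, inner_smul_right, inner_smul_right]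
      refine cac_alg h.oL hδ (hu x hx) h.S0 (th0 _) (th' _) (norm_nonneg _) (norm_nonneg _) ?_
        (h.coer x hxΩ _) (h.G_le x hxΩ) (hsm x hx)
      refine (abs_real_inner_le_norm _ _).trans ?_
      gcongr
      exact (ContinuousLinearMap.le_opNorm _ _).trans (by gcongr; exact h.nA x hxΩ)
    · rw [grad_zero_of_notMem (fun hh => hx (tsupport_mul_sq hh)), inner_zero_right]
      simp [off x hx, grad_zero_of_notMem hx, hψ]
  have := integral_mono ((I3.const_mul _).sub I4) (I1.sub I2) pw
  simp only [Pi.sub_apply] at this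
  rw [integral_sub (I3.const_mul _) I4, integral_sub I1 I2, integral_const_mul, key, sub_self] at this
  have e : ∫ x, (16 * L ^ 4 * ‖gradient χ x‖ ^ 2 + 4 * L * S / δ * χ x ^ 2) * θ (lw c b u x) =
      (4 * L) * ∫ x, (4 * L ^ 3 * ‖gradient χ x‖ ^ 2 + S / δ * χ x ^ 2) * θ (lw c b u x) := by
    rw [← integral_const_mul]
    congr 1; ext x; ring
  rw [e]
  have := mul_le_mul_of_nonneg_left this (show 0 ≤ 4 * L by positivity)
  have e2 : (4 * L) * ((1 / (4 * L)) * ∫ x, χ x ^ 2 * θ (lw c b u x) * ((b - u x)⁻¹ ^ 2 * ‖gradient u x‖ ^ 2)) =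
    ∫ x, χ x ^ 2 * θ (lw c b u x) * ((b - u x)⁻¹ ^ 2 * ‖gradient u x‖ ^ 2) := by
    field_simp
  rw [mul_sub, e2] at this
  linarith

end CacSec


section CutSec
variable {E : Type*} [NormedAddCommGroup E] [InnerProductSpace ℝ E] [FiniteDimensional ℝ E]
  [MeasurableSpace E] [BorelSpace E]

/-- one dimensional cutoff profile -/
noncomputable def prof (t : ℝ) : ℝ := 1 - max (1 - max t 0 ^ 2) 0 ^ 2

lemma prof_hasDerivAt (t : ℝ) : HasDerivAt prof (4 * max (1 - max t 0 ^ 2) 0 * max t 0) t := by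
  have h1 := (hasDerivAt_maxpow 1 le_rfl t).const_sub 1
  have h2 := ((hasDerivAt_maxpow 1 le_rfl (1 - max t 0 ^ 2)).comp t h1).const_sub 1
  refine h2.congr_deriv ?_
  norm_num; ring

lemma prof_deriv_le (t : ℝ) : |4 * max (1 - max t 0 ^ 2) 0 * max t 0| ≤ 4 := by
  have a := le_max_right t 0
  have b := le_max_right (1 - max t 0 ^ 2) 0
  rw [abs_of_nonneg (by positivity)]
  rcases le_total (max t 0) 1 with h | h
  · have : max (1 - max t 0 ^ 2) 0 ≤ 1 := max_le (by nlinarith) zero_le_one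
    nlinarith
  · rw [max_eq_right (a := 1 - max t 0 ^ 2) (by nlinarith)]; norm_num

lemma prof_zero {t : ℝ} (h : t ≤ 0) : prof t = 0 := by
  simp [prof, max_eq_right h]

lemma prof_one {t : ℝ} (h : 1 ≤ t) : prof t = 1 := by
  have : max t 0 = t := max_eq_left (by linarith)
  rw [prof, this, max_eq_right (by nlinarith)]; norm_num

lemma prof_nonneg (t : ℝ) : 0 ≤ prof t := by
  have b := le_max_right (1 - max t 0 ^ 2) 0
  have : max (1 - max t 0 ^ 2) 0 ≤ 1 := max_le (by nlinarith [sq_nonneg (max t 0)]) zero_le_one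
  unfold prof; nlinarith

lemma prof_le_one (t : ℝ) : prof t ≤ 1 := by
  unfold prof; nlinarith [sq_nonneg (max (1 - max t 0 ^ 2) 0)]

lemma exists_cutoff {r ρ : ℝ} (hr : 0 < r) (h : r < ρ) :
    ∃ χ : E → ℝ, ContDiff ℝ 1 χ ∧ HasCompactSupport χ ∧ tsupport χ ⊆ closedBall 0 ρ ∧
      (∀ x, 0 ≤ χ x) ∧ (∀ x, χ x ≤ 1) ∧ (∀ x ∈ closedBall (0:E) r, χ x = 1) ∧
      ∀ x, ‖gradient χ x‖ ≤ 8 / (ρ - r) := by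
  have hd : 0 < ρ ^ 2 - r ^ 2 := by nlinarith
  let t : E → ℝ := fun x => (ρ ^ 2 - ‖x‖ ^ 2) / (ρ ^ 2 - r ^ 2)
  let d : E → ℝ := fun x => 4 * max (1 - max (t x) 0 ^ 2) 0 * max (t x) 0
  have ht : ∀ x, HasFDerivAt t (innerSL ℝ ((-2 / (ρ ^ 2 - r ^ 2)) • x)) x := by
    intro x
    have h1 := (((hasStrictFDerivAt_norm_sq x).hasFDerivAt).const_sub (ρ ^ 2)).mul_const ((ρ ^ 2 - r ^ 2)⁻¹)
    refine (h1.congr_fderiv ?_)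
    ext v
    simp [inner_smul_left]
    ring
  have hχ : ∀ x, HasFDerivAt (fun x => prof (t x)) (innerSL ℝ ((d x * (-2 / (ρ ^ 2 - r ^ 2))) • x)) x := by
    intro x
    refine ((prof_hasDerivAt (t x)).hasFDerivAt.comp x (ht x)).congr_fderiv ?_
    ext v
    simp [inner_smul_left, d]
    ring
  have ct : Continuous t := by unfold t; fun_prop
  have cd : Continuous d := by unfold d; fun_prop
  have zero : ∀ x, x ∉ closedBall (0:E) ρ → prof (t x) = 0 := by
    intro x hx
    apply prof_zero
    simp only [mem_closedBall, dist_zero_right, not_le] at hx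
    apply div_nonpos_of_nonpos_of_nonneg _ hd.le
    nlinarith
  have hts : tsupport (fun x => prof (t x)) ⊆ closedBall 0 ρ := by
    apply closure_minimal _ isClosed_closedBall
    intro x hx
    by_contra hh
    exact hx (zero x hh)
  refine ⟨fun x => prof (t x), ?_, ?_, hts, fun x => prof_nonneg _, fun x => prof_le_one _, ?_, ?_⟩
  · exact contDiff_one_of_hasFDerivAt hχ (by fun_prop)
  · exact HasCompactSupport.intro (isCompact_closedBall 0 ρ) zero
  · intro x hx
    apply prof_one
    simp only [mem_closedBall, dist_zero_right] at hx
    simp only [t]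
    rw [one_le_div hd]
    have : ‖x‖ ^ 2 ≤ r ^ 2 := by gcongr
    linarith
  · intro x
    by_cases hx : x ∈ closedBall (0:E) ρ
    · rw [grad_of_hasFDerivAt (hχ x), norm_smul, norm_mul]
      simp only [mem_closedBall, dist_zero_right] at hx
      have h1 : ‖d x‖ ≤ 4 := prof_deriv_le (t x)
      have h2 : ‖-2 / (ρ ^ 2 - r ^ 2)‖ = 2 / (ρ ^ 2 - r ^ 2) := by
        rw [norm_div, Real.norm_eq_abs, Real.norm_eq_abs, abs_of_pos hd]; norm_num
      rw [h2]
      calc ‖d x‖ * (2 / (ρ ^ 2 - r ^ 2)) * ‖x‖ ≤ 4 * (2 / (ρ ^ 2 - r ^ 2)) * ρ := by gcongr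
        _ = 8 * ρ / ((ρ - r) * (ρ + r)) := by
            have : ρ ^ 2 - r ^ 2 = (ρ - r) * (ρ + r) := by ring
            rw [this]; ring
        _ ≤ 8 / (ρ - r) := by
            have : 0 < ρ - r := by linarith
            have : 0 < ρ + r := by linarith
            rw [div_le_div_iff₀ (by positivity) (by positivity)]
            nlinarith [mul_pos hr ‹0 < ρ - r›]
    · rw [grad_zero_of_notMem (fun hh => hx (hts hh)), norm_zero]
      have : 0 < ρ - r := by linarith
      positivity

end CutSec


section SobSec
variable {E : Type*} [NormedAddCommGroup E] [InnerProductSpace ℝ E] [FiniteDimensional ℝ E]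
  [MeasurableSpace E] [BorelSpace E]

lemma integrable_grad {f : E → ℝ} (hf : ContDiff ℝ 1 f) (hc : HasCompactSupport f) :
    Integrable (fun x => ‖gradient f x‖) :=
  integrable_of_tsupport hc (cont_grad hf).norm.continuousOn
    (fun x hx => by rw [grad_zero_of_notMem hx, norm_zero])

variable (E) in
lemma sob (hn : 2 ≤ Module.finrank ℝ E) : ∃ C : ℝ, 1 ≤ C ∧ ∀ f : E → ℝ, ContDiff ℝ 1 f →
    HasCompactSupport f → (∀ x, 0 ≤ f x) → ∀ T : Set E, MeasurableSet T → volume T ≠ ⊤ →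
    (∀ x ∉ T, f x = 0) →
    ∫ x, f x ≤ C * (volume.real T) ^ ((1:ℝ) / Module.finrank ℝ E) * ∫ x, ‖gradient f x‖ := by
  set n := Module.finrank ℝ E with hnn
  have hn1 : (1:ℝ) < n := by exact_mod_cast (by omega : 1 < n)
  obtain ⟨p, hp⟩ : ∃ p : ℝ, Real.HolderConjugate n p := ⟨_, Real.HolderConjugate.conjExponent hn1⟩
  set C0 : ENNReal := (lintegralPowLePowLIntegralFDerivConst (volume : Measure E) p : ENNReal) ^ (1 / p) with hC0
  have p0 : 0 < p := hp.symm.pos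
  have hC0t : C0 ≠ ⊤ := by
    rw [hC0]; exact ENNReal.rpow_ne_top_of_nonneg (by positivity) ENNReal.coe_ne_top
  refine ⟨C0.toReal + 1, by have := ENNReal.toReal_nonneg (a := C0); linarith, ?_⟩
  intro f hf hc f0 T hT hTt hz
  have S := lintegral_pow_le_pow_lintegral_fderiv (volume : Measure E) hf hc hp
  have cf := hf.continuous
  have H := ENNReal.lintegral_mul_le_Lp_mul_Lq (volume : Measure E) hp.symm
    (f := fun x => ‖f x‖ₑ) (g := T.indicator 1) (by fun_prop) ((measurable_one.indicator hT).aemeasurable)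
  have e1 : ∫⁻ a, ((fun x => ‖f x‖ₑ) * (T.indicator 1 : E → ENNReal)) a = ∫⁻ a, ‖f a‖ₑ := by
    congr 1; ext a
    by_cases ha : a ∈ T
    · simp [ha]
    · simp [ha, hz a ha]
  have n0 : (0:ℝ) < n := by linarith
  have e2 : ∫⁻ a, T.indicator (1 : E → ENNReal) a ^ (n:ℝ) = volume T := by
    rw [← lintegral_indicator_one hT]
    congr 1; ext a
    by_cases ha : a ∈ T <;> simp [ha] <;> omega
  rw [e1, e2] at H
  have S2 : (∫⁻ a, ‖f a‖ₑ ^ p) ^ (1 / p) ≤ C0 * ∫⁻ x, ‖fderiv ℝ f x‖ₑ := by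
    calc (∫⁻ a, ‖f a‖ₑ ^ p) ^ (1 / p) ≤ _ := ENNReal.rpow_le_rpow S (by positivity)
      _ = _ := by
        rw [ENNReal.mul_rpow_of_nonneg _ _ (by positivity), ← ENNReal.rpow_mul, mul_one_div_cancel p0.ne', ENNReal.rpow_one]
  have H2 : ∫⁻ a, ‖f a‖ₑ ≤ C0 * (∫⁻ x, ‖fderiv ℝ f x‖ₑ) * volume T ^ (1 / (n:ℝ)) :=
    H.trans (by gcongr)
  have ig := integrable_grad hf hc
  have i1 : ∫⁻ x, ‖fderiv ℝ f x‖ₑ = ENNReal.ofReal (∫ x, ‖gradient f x‖) := by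
    rw [ofReal_integral_eq_lintegral_ofReal ig (Filter.Eventually.of_forall fun x => norm_nonneg _)]
    congr 1; ext x
    rw [norm_grad, ofReal_norm]
  have i2 : ∫ x, f x = (∫⁻ a, ‖f a‖ₑ).toReal := by
    rw [integral_eq_lintegral_of_nonneg_ae (Filter.Eventually.of_forall f0) cf.aestronglyMeasurable]
    congr 2; ext x
    rw [Real.enorm_eq_ofReal (f0 x)]
  rw [i2]
  have hig : 0 ≤ ∫ x, ‖gradient f x‖ := integral_nonneg fun x => norm_nonneg _
  have fin : volume T ^ (1 / (n:ℝ)) ≠ ⊤ := ENNReal.rpow_ne_top_of_nonneg (by positivity) hTt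
  have := ENNReal.toReal_mono (by
    rw [i1]; exact ENNReal.mul_ne_top (ENNReal.mul_ne_top hC0t ENNReal.ofReal_ne_top) fin) H2
  refine this.trans ?_
  rw [ENNReal.toReal_mul, ENNReal.toReal_mul, i1, ENNReal.toReal_ofReal hig, ← ENNReal.toReal_rpow (volume T)]
  change _ * _ * (volume.real T) ^ (1 / (n:ℝ)) ≤ _
  have hT0 : 0 ≤ (volume.real T) ^ (1 / (n:ℝ)) := by positivity
  have := mul_nonneg hT0 hig
  nlinarith

lemma lintegral_affine {g : E → ENNReal} (hg : Measurable g) (y : E) {a : ℝ} (ha : 0 < a) :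
    ∫⁻ x, g (a • x + y) = ENNReal.ofReal ((a ^ Module.finrank ℝ E)⁻¹) * ∫⁻ x, g x := by
  have h1 : ∫⁻ x, g (a • x + y) = ∫⁻ x, g (x + y) ∂(Measure.map (a • ·) volume) := by
    rw [lintegral_map (by fun_prop) (by fun_prop)]
  rw [h1, Measure.map_addHaar_smul _ ha.ne', lintegral_smul_measure, lintegral_add_right_eq_self g,
    abs_of_pos (by positivity), smul_eq_mul]

lemma poin_aux {g : E → ENNReal} (hg : Measurable g) {s : ℝ} (hs : 1/2 ≤ s) (hs1 : s ≤ 1) (y : E)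
    (hy : y ∈ ball (0:E) 1) :
    ∫⁻ x in ball (0:E) 1, g (s • x + (1 - s) • y) ≤
      ENNReal.ofReal (2 ^ Module.finrank ℝ E) * ∫⁻ x in ball (0:E) 1, g x := by
  have hB : MeasurableSet (ball (0:E) 1) := measurableSet_ball
  rw [← lintegral_indicator hB, ← lintegral_indicator hB]
  calc ∫⁻ x, (ball (0:E) 1).indicator (fun x => g (s • x + (1 - s) • y)) x
      ≤ ∫⁻ x, ((ball (0:E) 1).indicator g) (s • x + (1 - s) • y) := by
        apply lintegral_mono
        intro x
        by_cases hx : x ∈ ball (0:E) 1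
        · have : s • x + (1 - s) • y ∈ ball (0:E) 1 :=
            (convex_ball (0:E) 1) hx hy (by linarith) (by linarith) (by ring)
          simp only [hx, this, indicator_of_mem]; exact le_rfl
        · simp only [hx, indicator_of_notMem, not_false_eq_true]; exact zero_le
    _ = ENNReal.ofReal ((s ^ Module.finrank ℝ E)⁻¹) * ∫⁻ x, ((ball (0:E) 1).indicator g) x :=
        lintegral_affine (hg.indicator hB) _ (by linarith)
    _ ≤ _ := by
        gcongr
        rw [← inv_pow]
        gcongr
        rw [inv_le_comm₀ (by linarith) (by norm_num)]
        linarith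

lemma poin_pt {f : E → ℝ} (hf : ContDiff ℝ 1 f) {x z : E} (hx : x ∈ ball (0:E) 1) (hz : z ∈ ball (0:E) 1)
    (h0 : f z = 0) :
    ‖f x‖ₑ ≤ 2 * ∫⁻ t in Icc (0:ℝ) 1, ‖gradient f (x + t • (z - x))‖ₑ := by
  have hd : ∀ t : ℝ, HasDerivAt (fun t : ℝ => f (x + t • (z - x)))
      (inner ℝ (gradient f (x + t • (z - x))) (z - x)) t := by
    intro t
    have h1 : HasDerivAt (fun t : ℝ => x + t • (z - x)) (z - x) t := by
      simpa using ((hasDerivAt_id t).smul_const (z - x)).const_add x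
    have := (grad_hasFDerivAt (hf.differentiable one_ne_zero (x + t • (z - x)))).comp_hasDerivAt t h1
    exact this
  have cg := cont_grad hf
  have hc : Continuous (fun t : ℝ => inner ℝ (gradient f (x + t • (z - x))) (z - x)) := by fun_prop
  have ftc := intervalIntegral.integral_eq_sub_of_hasDerivAt (a := 0) (b := 1) (fun t _ => hd t)
    (hc.intervalIntegrable _ _)
  simp only [one_smul, add_sub_cancel, zero_smul, add_zero, h0, zero_sub] at ftc
  have e : ‖f x‖ₑ = ‖∫ t in (0:ℝ)..1, inner ℝ (gradient f (x + t • (z - x))) (z - x)‖ₑ := by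
    rw [ftc, enorm_neg]
  rw [e, intervalIntegral.integral_of_le zero_le_one, ← integral_Icc_eq_integral_Ioc]
  refine (enorm_integral_le_lintegral_enorm _).trans ?_
  have hmm : Continuous fun t : ℝ => ‖gradient f (x + t • (z - x))‖ₑ := by fun_prop
  rw [← lintegral_const_mul _ hmm.measurable]
  apply lintegral_mono
  intro t
  have h2 : ‖z - x‖ ≤ 2 := by
    have := norm_sub_le z x
    simp only [mem_ball, dist_zero_right] at hx hz
    linarith
  have h3 : ‖(inner ℝ (gradient f (x + t • (z - x))) (z - x) : ℝ)‖ ≤ 2 * ‖gradient f (x + t • (z - x))‖ := by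
    refine (norm_inner_le_norm _ _).trans ?_
    rw [mul_comm]; gcongr
  calc ‖(inner ℝ (gradient f (x + t • (z - x))) (z - x) : ℝ)‖ₑ
      = ENNReal.ofReal ‖(inner ℝ (gradient f (x + t • (z - x))) (z - x) : ℝ)‖ := (ofReal_norm _).symm
    _ ≤ ENNReal.ofReal (2 * ‖gradient f (x + t • (z - x))‖) := ENNReal.ofReal_le_ofReal h3
    _ = _ := by rw [ENNReal.ofReal_mul (by norm_num), ofReal_norm]; simp

lemma poincare {f : E → ℝ} (hf : ContDiff ℝ 1 f) (f0 : ∀ x, 0 ≤ f x)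
    (hz : volume.real (ball (0:E) 1) / 2 ≤ volume.real {x ∈ ball (0:E) 1 | f x = 0}) :
    ∫ x in ball (0:E) 1, f x ≤ 4 * 2 ^ Module.finrank ℝ E * ∫ x in ball (0:E) 1, ‖gradient f x‖ := by
  set B := ball (0:E) 1 with hBdef
  set Z := {x ∈ B | f x = 0} with hZdef
  have cf := hf.continuous
  have cg := cont_grad hf
  have mB : MeasurableSet B := measurableSet_ball
  have mZ : MeasurableSet Z := mB.inter (measurableSet_eq_fun cf.measurable measurable_const)
  set N : ENNReal := ENNReal.ofReal (2 ^ Module.finrank ℝ E) with hN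
  set I := ∫⁻ x in B, ‖gradient f x‖ₑ with hI
  have mg : Measurable fun x => ‖gradient f x‖ₑ := by fun_prop
  have ft : ∀ t ∈ Icc (0:ℝ) 1, ∫⁻ z in B, ∫⁻ x in B, ‖gradient f (x + t • (z - x))‖ₑ ≤ N * volume B * I := by
    intro t ht
    rcases le_total t (1/2) with h | h
    · calc ∫⁻ z in B, ∫⁻ x in B, ‖gradient f (x + t • (z - x))‖ₑ ≤ ∫⁻ z in B, N * I := by
            apply setLIntegral_mono' mB
            intro z hz
            have := poin_aux mg (s := 1 - t) (by linarith) (by linarith [ht.1]) z hz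
            refine le_trans (le_of_eq ?_) this
            congr 1; ext x; congr 2; module
        _ = N * volume B * I := by rw [lintegral_const, Measure.restrict_apply_univ]; ring
    · rw [lintegral_lintegral_swap (by fun_prop)]
      calc ∫⁻ x in B, ∫⁻ z in B, ‖gradient f (x + t • (z - x))‖ₑ ≤ ∫⁻ z in B, N * I := by
            apply setLIntegral_mono' mB
            intro z hz
            have := poin_aux mg (s := t) (by linarith) (by linarith [ht.2]) z hz
            refine le_trans (le_of_eq ?_) this
            congr 1; ext x; congr 2; module
        _ = N * volume B * I := by rw [lintegral_const, Measure.restrict_apply_univ]; ring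
  have main : volume Z * ∫⁻ x in B, ‖f x‖ₑ ≤ 2 * (N * volume B * I) := by
    calc volume Z * ∫⁻ x in B, ‖f x‖ₑ = ∫⁻ z in Z, ∫⁻ x in B, ‖f x‖ₑ := by
          rw [lintegral_const, Measure.restrict_apply_univ, mul_comm]
      _ ≤ ∫⁻ z in Z, ∫⁻ x in B, 2 * ∫⁻ t in Icc (0:ℝ) 1, ‖gradient f (x + t • (z - x))‖ₑ := by
          apply setLIntegral_mono' mZ
          intro z hz
          apply setLIntegral_mono' mB
          intro x hx
          exact poin_pt hf hx hz.1 hz.2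
      _ ≤ ∫⁻ z in B, ∫⁻ x in B, 2 * ∫⁻ t in Icc (0:ℝ) 1, ‖gradient f (x + t • (z - x))‖ₑ :=
          lintegral_mono_set (fun z hz => hz.1)
      _ = 2 * ∫⁻ z in B, ∫⁻ x in B, ∫⁻ t in Icc (0:ℝ) 1, ‖gradient f (x + t • (z - x))‖ₑ := by
          rw [← lintegral_const_mul' _ _ (by norm_num)]
          congr 1; ext z
          rw [← lintegral_const_mul' _ _ (by norm_num)]
      _ = 2 * ∫⁻ z in B, ∫⁻ t in Icc (0:ℝ) 1, ∫⁻ x in B, ‖gradient f (x + t • (z - x))‖ₑ := by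
          congr 2; ext z
          rw [lintegral_lintegral_swap (by fun_prop)]
      _ = 2 * ∫⁻ t in Icc (0:ℝ) 1, ∫⁻ z in B, ∫⁻ x in B, ‖gradient f (x + t • (z - x))‖ₑ := by
          rw [lintegral_lintegral_swap]
          apply Measurable.aemeasurable
          apply Measurable.lintegral_prod_right'
            (f := fun p : (E × ℝ) × E => ‖gradient f (p.2 + p.1.2 • (p.1.1 - p.2))‖ₑ)
          have hmm : Continuous fun p : (E × ℝ) × E => ‖gradient f (p.2 + p.1.2 • (p.1.1 - p.2))‖ₑ := by
            fun_prop
          exact hmm.measurable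
      _ ≤ 2 * ∫⁻ t in Icc (0:ℝ) 1, N * volume B * I := by
          gcongr 2 * ?_
          exact setLIntegral_mono' measurableSet_Icc ft
      _ = 2 * (N * volume B * I) := by
          rw [lintegral_const, Measure.restrict_apply_univ]; simp
  have vB : volume B ≠ ⊤ := measure_ball_lt_top.ne
  have vB0 : 0 < volume.real B := by
    rw [measureReal_def]; exact ENNReal.toReal_pos (measure_ball_pos _ _ one_pos).ne' vB
  have vZ : volume Z ≠ ⊤ := ne_top_of_le_ne_top vB (measure_mono fun x hx => hx.1)
  have iI : IntegrableOn (fun x => ‖gradient f x‖) B :=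
    (cg.norm.continuousOn.integrableOn_compact (isCompact_closedBall (0:E) 1)).mono_set ball_subset_closedBall
  have iF : IntegrableOn f B :=
    (cf.continuousOn.integrableOn_compact (isCompact_closedBall (0:E) 1)).mono_set ball_subset_closedBall
  have eI : I = ENNReal.ofReal (∫ x in B, ‖gradient f x‖) := by
    rw [ofReal_integral_eq_lintegral_ofReal iI (Filter.Eventually.of_forall fun x => norm_nonneg _), hI]
    congr 1; ext x
    rw [ofReal_norm]
  have eF : ∫⁻ x in B, ‖f x‖ₑ = ENNReal.ofReal (∫ x in B, f x) := by
    rw [ofReal_integral_eq_lintegral_ofReal iF (Filter.Eventually.of_forall fun x => f0 x)]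
    congr 1; ext x
    rw [Real.enorm_eq_ofReal (f0 x)]
  rw [eI, eF] at main
  have i0 : 0 ≤ ∫ x in B, ‖gradient f x‖ := integral_nonneg fun x => norm_nonneg _
  have f00 : 0 ≤ ∫ x in B, f x := integral_nonneg fun x => f0 x
  have := ENNReal.toReal_mono (by
    refine ENNReal.mul_ne_top (by norm_num) (ENNReal.mul_ne_top (ENNReal.mul_ne_top ENNReal.ofReal_ne_top vB) ENNReal.ofReal_ne_top)) main
  simp only [ENNReal.toReal_mul, ENNReal.toReal_ofReal i0, ENNReal.toReal_ofReal f00, hN,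
    ENNReal.toReal_ofReal (show (0:ℝ) ≤ 2 ^ Module.finrank ℝ E by positivity), ENNReal.toReal_ofNat] at this
  change volume.real Z * _ ≤ 2 * (_ * volume.real B * _) at this
  have h3 : volume.real B / 2 * ∫ x in B, f x ≤ volume.real Z * ∫ x in B, f x := by gcongr
  have h4 : volume.real B * (∫ x in B, f x) ≤ volume.real B * (4 * 2 ^ Module.finrank ℝ E * ∫ x in B, ‖gradient f x‖) := by
    nlinarith
  exact le_of_mul_le_mul_left h4 vB0

end SobSec


section DGSec
variable {E : Type*} [NormedAddCommGroup E] [InnerProductSpace ℝ E] [FiniteDimensional ℝ E]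
  [MeasurableSpace E] [BorelSpace E]

/-- a log-subsolution on the ball of radius two. -/
structure LogSub (K : ℝ) (w : E → ℝ) : Prop where
  oK : 1 ≤ K
  mw : Measurable w
  cd : ∀ x ∈ closedBall (0:E) 2, ContDiffAt ℝ 1 w x
  cac : ∀ χ : E → ℝ, ContDiff ℝ 1 χ → HasCompactSupport χ → tsupport χ ⊆ closedBall 0 2 →
    ∀ θ : ℝ → ℝ, ContDiff ℝ 1 θ → (∀ t, 0 ≤ θ t) → (∀ t, 0 ≤ deriv θ t) → (∀ t ≤ -1, θ t = 0) →
    ∫ x, χ x ^ 2 * θ (w x) * ‖gradient w x‖ ^ 2 ≤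
      K * ∫ x, (‖gradient χ x‖ ^ 2 + χ x ^ 2) * θ (w x)

lemma Sol.logSub {Ω : Set E} {L S : ℝ} {A : E → E →L[ℝ] E} {u G : E → ℝ} (h : Sol Ω L S A u G)
    (hΩ : closedBall 0 2 ⊆ Ω) {M δ c : ℝ} (hδ : 0 < δ) (hc0 : 0 < c) (hS : S ≤ δ) (hc : 3 * c ≤ 1 / (4 * L))
    (hu : ∀ x ∈ closedBall (0:E) 2, u x ≤ M) : LogSub (16 * L ^ 4) (lw c (M + δ) u) where
  oK := by
    have := one_le_pow₀ (n := 4) h.oL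
    linarith
  mw := by
    have := h.cd.continuous.measurable
    unfold lw; fun_prop
  cd := fun x hx => lw_contDiffAt h.cd (by linarith [hu x hx])
  cac := by
    intro χ h1 h2 h3 θ t1 t2 t3 t4
    have L0 : 1 ≤ L := h.oL
    have key := h.cac h1 h2 (h3.trans hΩ) (c := c) (b := M + δ) hδ (fun x hx => by linarith [hu x (h3 hx)])
      t1 t2 t3 (by
        intro x hx hne
        have : ¬ (lw c (M + δ) u x ≤ -1) := fun hh => hne (t4 _ hh)
        push Not at this
        unfold lw at this
        have y0 : 0 < M + δ - u x := by linarith [hu x (h3 hx)]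
        have l1 : Real.log (M + δ - u x) < Real.log (c * Real.exp 1) := by
          rw [Real.log_mul hc0.ne' (Real.exp_pos 1).ne', Real.log_exp]; linarith
        have l2 := (Real.log_lt_log_iff y0 (by positivity)).1 l1
        have := Real.exp_one_lt_d9
        nlinarith)
    have e1 : ∫ x, χ x ^ 2 * θ (lw c (M + δ) u x) * ‖gradient (lw c (M + δ) u) x‖ ^ 2 =
        ∫ x, χ x ^ 2 * θ (lw c (M + δ) u x) * ((M + δ - u x)⁻¹ ^ 2 * ‖gradient u x‖ ^ 2) := by
      congr 1; ext x
      by_cases hx : x ∈ tsupport χ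
      · rw [grad_of_hasFDerivAt (lw_hasFDerivAt (h.cd.differentiable one_ne_zero x) (by linarith [hu x (h3 hx)])),
          norm_smul, mul_pow, Real.norm_eq_abs, sq_abs]
      · rw [image_eq_zero_of_notMem_tsupport hx]; ring
    rw [e1, ← integral_const_mul]
    refine key.trans ?_
    have cw : ContinuousOn (lw c (M + δ) u) (tsupport χ) := fun x hx =>
      (lw_contDiffAt (c := c) h.cd (by linarith [hu x (h3 hx)])).continuousAt.continuousWithinAt
    have ct := t1.continuous.comp_continuousOn cw
    have K : IsCompact (tsupport χ) := h2
    apply integral_mono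
    · refine integrable_of_tsupport K ?_ ?_
      · exact ((((cont_grad h1).norm.pow 2).const_mul _).add ((h1.continuous.pow 2).const_mul _)).continuousOn.mul ct
      · intro x hx; simp [image_eq_zero_of_notMem_tsupport hx, grad_zero_of_notMem hx]
    · refine integrable_of_tsupport K ?_ ?_
      · exact continuousOn_const.mul (((((cont_grad h1).norm.pow 2)).add ((h1.continuous.pow 2))).continuousOn.mul ct)
      · intro x hx; simp [image_eq_zero_of_notMem_tsupport hx, grad_zero_of_notMem hx]
    · intro x
      simp only
      have : 4 * L * S / δ ≤ 16 * L ^ 4 := by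
        rw [div_le_iff₀ hδ]
        have : L ≤ L ^ 4 := by
          calc L = L ^ 1 := (pow_one L).symm
            _ ≤ L ^ 4 := pow_le_pow_right₀ L0 (by norm_num)
        have h0 := h.S0
        calc 4 * L * S ≤ 4 * L * δ := by gcongr
          _ ≤ 16 * L ^ 4 * δ := by gcongr; linarith
      rw [← mul_assoc]
      apply mul_le_mul_of_nonneg_right _ (t2 _)
      have : 4 * L * S / δ * χ x ^ 2 ≤ 16 * L ^ 4 * χ x ^ 2 := by gcongr
      nlinarith

variable {K : ℝ} {w : E → ℝ}

lemma LogSub.cw (h : LogSub K w) : ContinuousOn w (closedBall (0:E) 2) := fun x hx =>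
  (h.cd x hx).continuousAt.continuousWithinAt

lemma maxsq_contDiff (s : ℝ) : ContDiff ℝ 1 (fun t : ℝ => max (t - s) 0 ^ 2) := by
  have h : ∀ t, HasDerivAt (fun t : ℝ => max (t - s) 0 ^ 2) (2 * max (t - s) 0) t := by
    intro t
    have h1 := (hasDerivAt_maxpow 1 le_rfl (t - s)).comp t ((hasDerivAt_id t).sub_const s)
    refine h1.congr_deriv ?_
    norm_num
  rw [contDiff_one_iff_deriv]
  refine ⟨fun t => (h t).differentiableAt, ?_⟩
  rw [show deriv (fun t : ℝ => max (t - s) 0 ^ 2) = fun t => 2 * max (t - s) 0 from funext fun t => (h t).deriv]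
  fun_prop

lemma maxsq_deriv (s t : ℝ) : deriv (fun t : ℝ => max (t - s) 0 ^ 2) t = 2 * max (t - s) 0 := by
  have h1 := (hasDerivAt_maxpow 1 le_rfl (t - s)).comp t ((hasDerivAt_id t).sub_const s)
  have := h1.deriv
  simp only [Function.comp_def, id] at this
  rw [this]; norm_num

/-- the localized test function and its gradient -/
lemma LogSub.grad_f (h : LogSub K w) {χ : E → ℝ} (hχ : ContDiff ℝ 1 χ) (hs : tsupport χ ⊆ closedBall 0 2)
    (s : ℝ) {x : E} (hx : x ∈ tsupport χ) :
    gradient (fun x => χ x ^ 2 * max (w x - s) 0 ^ 2) x =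
      (2 * χ x * max (w x - s) 0 ^ 2) • gradient χ x + (2 * χ x ^ 2 * max (w x - s) 0) • gradient w x := by
  apply grad_of_hasFDerivAt
  have d1 := grad_hasFDerivAt ((h.cd x (hs hx)).differentiableAt one_ne_zero)
  have d2 := (((maxsq_contDiff s).differentiable one_ne_zero (w x)).hasDerivAt.hasFDerivAt).comp x d1
  have h1 := ((grad_hasFDerivAt (hχ.differentiable one_ne_zero x)).pow 2).mul d2
  rw [maxsq_deriv] at h1
  refine h1.congr_fderiv ?_
  ext v
  simp [inner_smul_left]
  ring

lemma LogSub.cd_f (h : LogSub K w) {χ : E → ℝ} (hχ : ContDiff ℝ 1 χ) (hs : tsupport χ ⊆ closedBall 0 2)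
    (s : ℝ) : ContDiff ℝ 1 (fun x => χ x ^ 2 * max (w x - s) 0 ^ 2) :=
  mul_contDiff_of_tsupport (V := fun x => max (w x - s) 0 ^ 2) hχ
    (fun x hx => (maxsq_contDiff s).contDiffAt.comp x (h.cd x (hs hx)))

end DGSec


section DG2Sec
variable {E : Type*} [NormedAddCommGroup E] [InnerProductSpace ℝ E] [FiniteDimensional ℝ E]
  [MeasurableSpace E] [BorelSpace E] {K : ℝ} {w : E → ℝ}

lemma LogSub.intOn (h : LogSub K w) (s : ℝ) {ρ : ℝ} (hρ : ρ ≤ 2) :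
    IntegrableOn (fun x => max (w x - s) 0 ^ 2) (closedBall (0:E) ρ) := by
  have : ContinuousOn (fun x => max (w x - s) 0 ^ 2) (closedBall (0:E) ρ) :=
    (maxsq_contDiff s).continuous.comp_continuousOn (h.cw.mono (closedBall_subset_closedBall hρ))
  exact this.integrableOn_compact (isCompact_closedBall _ _)

/-- truncated energy -/
noncomputable def YY (w : E → ℝ) (s ρ : ℝ) : ℝ := ∫ x in closedBall (0:E) ρ, max (w x - s) 0 ^ 2

lemma YY_nonneg (w : E → ℝ) (s ρ : ℝ) : 0 ≤ YY w s ρ := integral_nonneg fun x => sq_nonneg _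

lemma LogSub.YY_mono (h : LogSub K w) {s s' ρ ρ' : ℝ} (hs : s' ≤ s) (hρ : ρ ≤ ρ') (h2 : ρ' ≤ 2) :
    YY w s ρ ≤ YY w s' ρ' := by
  calc YY w s ρ ≤ YY w s ρ' :=
        setIntegral_mono_set (h.intOn s h2) (Filter.Eventually.of_forall fun x => sq_nonneg _)
          (closedBall_subset_closedBall hρ).eventuallyLE
    _ ≤ YY w s' ρ' := by
        refine integral_mono (h.intOn s h2) (h.intOn s' h2) ?_
        intro x
        have : 0 ≤ max (w x - s) 0 := le_max_right _ _
        simp only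
        gcongr

lemma LogSub.cheb (h : LogSub K w) {s s' ρ : ℝ} (hs : s' < s) (h2 : ρ ≤ 2) :
    volume.real {x ∈ closedBall (0:E) ρ | s < w x} ≤ YY w s' ρ / (s - s') ^ 2 := by
  set T := {x ∈ closedBall (0:E) ρ | s < w x} with hT
  have mT : MeasurableSet T := measurableSet_closedBall.inter (measurableSet_lt measurable_const h.mw)
  have sub : T ⊆ closedBall 0 ρ := fun x hx => hx.1
  have fT : volume T ≠ ⊤ := ne_top_of_le_ne_top measure_closedBall_lt_top.ne (measure_mono sub)
  have hd : 0 < s - s' := by linarith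
  rw [le_div_iff₀ (by positivity)]
  calc volume.real T * (s - s') ^ 2 = ∫ x in T, (s - s') ^ 2 := by
        rw [setIntegral_const, smul_eq_mul]
    _ ≤ ∫ x in T, max (w x - s') 0 ^ 2 := by
        refine setIntegral_mono_on (integrableOn_const fT) ((h.intOn s' h2).mono_set sub) mT ?_
        intro x hx
        gcongr
        exact le_max_of_le_left (by linarith [hx.2])
    _ ≤ YY w s' ρ :=
        setIntegral_mono_set (h.intOn s' h2) (Filter.Eventually.of_forall fun x => sq_nonneg _) sub.eventuallyLE

lemma LogSub.step (h : LogSub K w) {C : ℝ} (hC : 1 ≤ C)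
    (sob : ∀ f : E → ℝ, ContDiff ℝ 1 f →
    HasCompactSupport f → (∀ x, 0 ≤ f x) → ∀ T : Set E, MeasurableSet T → volume T ≠ ⊤ →
    (∀ x ∉ T, f x = 0) →
    ∫ x, f x ≤ C * (volume.real T) ^ ((1:ℝ) / Module.finrank ℝ E) * ∫ x, ‖gradient f x‖)
    {s s' r ρ : ℝ} (hs0 : 0 ≤ s) (hs : s' < s) (hr : 0 < r) (hrρ : r < ρ) (hρ : ρ ≤ 1) :
    YY w s r ≤ C * (YY w s' ρ / (s - s') ^ 2) ^ ((1:ℝ) / Module.finrank ℝ E) *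
      (81 * K / (ρ - r) ^ 2 * YY w s' ρ + YY w s' ρ / (s - s') ^ 2) := by
  obtain ⟨χ, c1, c2, c3, c4, c5, c6, c7⟩ := exists_cutoff (E := E) hr hrρ
  set θ : E → ℝ := fun x => max (w x - s) 0 ^ 2 with hθ
  set f : E → ℝ := fun x => χ x ^ 2 * θ x with hf
  set T := {x ∈ closedBall (0:E) ρ | s < w x} with hT
  have mT : MeasurableSet T := measurableSet_closedBall.inter (measurableSet_lt measurable_const h.mw)
  have subT : T ⊆ closedBall 0 ρ := fun x hx => hx.1
  have fT : volume T ≠ ⊤ := ne_top_of_le_ne_top measure_closedBall_lt_top.ne (measure_mono subT)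
  have s2 : tsupport χ ⊆ closedBall 0 2 := c3.trans (closedBall_subset_closedBall (by linarith))
  have f1 : ContDiff ℝ 1 f := h.cd_f c1 s2 s
  have f2 : HasCompactSupport f := c2.mono' (subset_closure.trans tsupport_mul_sq)
  have th0 : ∀ x, 0 ≤ θ x := fun x => sq_nonneg _
  have f0 : ∀ x, 0 ≤ f x := fun x => mul_nonneg (sq_nonneg _) (th0 x)
  have offT : ∀ x ∉ T, f x = 0 := by
    intro x hx
    by_cases hx2 : x ∈ closedBall (0:E) ρ
    · have : w x ≤ s := by
        by_contra hh; push Not at hh; exact hx ⟨hx2, hh⟩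
      simp [hf, hθ, max_eq_right (sub_nonpos.2 this)]
    · have : χ x = 0 := image_eq_zero_of_notMem_tsupport (fun hh => hx2 (c3 hh))
      simp [hf, this]
  have S1 := sob f f1 f2 f0 T mT fT offT
  have d0 : 0 < ρ - r := by linarith
  have oK := h.oK
  -- caccioppoli
  have cac := h.cac χ c1 c2 s2 (fun t => max (t - s) 0 ^ 2) (maxsq_contDiff s) (fun t => sq_nonneg _)
    (fun t => by rw [maxsq_deriv]; positivity)
    (fun t ht => by rw [max_eq_right (by linarith)]; norm_num)
  have iθ := h.intOn s (show ρ ≤ 2 by linarith)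
  have iind : Integrable ((closedBall (0:E) ρ).indicator θ) := iθ.integrable_indicator measurableSet_closedBall
  have eY : ∫ x, (closedBall (0:E) ρ).indicator θ x = YY w s ρ := integral_indicator measurableSet_closedBall
  have indle : ∀ x, (‖gradient χ x‖ ^ 2 + χ x ^ 2) * θ x ≤ (65 / (ρ - r) ^ 2) * (closedBall (0:E) ρ).indicator θ x := by
    intro x
    by_cases hx : x ∈ closedBall (0:E) ρ
    · rw [indicator_of_mem hx]
      apply mul_le_mul_of_nonneg_right _ (th0 x)
      have a1 : ‖gradient χ x‖ ^ 2 ≤ (8 / (ρ - r)) ^ 2 := by gcongr; exact c7 x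
      have a2 : χ x ^ 2 ≤ 1 := pow_le_one₀ (c4 x) (c5 x)
      have a3 : 1 ≤ 1 / (ρ - r) ^ 2 := by
        rw [le_div_iff₀ (by positivity)]; nlinarith
      calc ‖gradient χ x‖ ^ 2 + χ x ^ 2 ≤ (8 / (ρ - r)) ^ 2 + 1 / (ρ - r) ^ 2 := by linarith
        _ = _ := by rw [div_pow, ← add_div]; norm_num
    · rw [indicator_of_notMem hx, mul_zero, grad_zero_of_notMem (fun hh => hx (c3 hh)),
        image_eq_zero_of_notMem_tsupport (fun hh => hx (c3 hh))]
      simp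
  have ctθ : ContinuousOn θ (tsupport χ) := (maxsq_contDiff s).continuous.comp_continuousOn (h.cw.mono s2)
  have Icac : Integrable (fun x => (‖gradient χ x‖ ^ 2 + χ x ^ 2) * θ x) := by
    refine integrable_of_tsupport c2 ?_ ?_
    · exact (((((cont_grad c1).norm.pow 2)).add ((c1.continuous.pow 2))).continuousOn.mul ctθ)
    · intro x hx; simp [image_eq_zero_of_notMem_tsupport hx, grad_zero_of_notMem hx]
  have cac2 : ∫ x, χ x ^ 2 * θ x * ‖gradient w x‖ ^ 2 ≤ K * (65 / (ρ - r) ^ 2 * YY w s ρ) := by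
    refine cac.trans ?_
    gcongr
    rw [← eY, ← integral_const_mul]
    exact integral_mono Icac (iind.const_mul _) indle
  have cgw : ContinuousOn (gradient w) (tsupport χ) := by
    intro x hx
    have h1 := (h.cd x (s2 hx)).continuousAt_fderiv one_ne_zero
    exact ((InnerProductSpace.toDual ℝ E).symm.continuous.continuousAt.comp h1).continuousWithinAt
  have Iw : Integrable (fun x => χ x ^ 2 * θ x * ‖gradient w x‖ ^ 2) := by
    refine integrable_of_tsupport c2 ?_ ?_
    · exact ((c1.continuous.pow 2).continuousOn.mul ctθ).mul (cgw.norm.pow 2)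
    · intro x hx; simp [image_eq_zero_of_notMem_tsupport hx]
  have IT : Integrable (T.indicator (fun _ => (1:ℝ))) := (integrable_indicator_iff mT).2 (integrableOn_const fT)
  have eT : ∫ x, T.indicator (fun _ => (1:ℝ)) x = volume.real T := by
    rw [integral_indicator mT, setIntegral_const, smul_eq_mul, mul_one]
  have pw : ∀ x, ‖gradient f x‖ ≤ (16 / (ρ - r)) * (closedBall (0:E) ρ).indicator θ x +
      χ x ^ 2 * θ x * ‖gradient w x‖ ^ 2 + T.indicator (fun _ => (1:ℝ)) x := by
    intro x
    by_cases hx : x ∈ tsupport χ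
    · rw [h.grad_f c1 s2 s hx, indicator_of_mem (c3 hx)]
      refine (norm_add_le _ _).trans ?_
      rw [norm_smul, norm_smul, Real.norm_eq_abs, Real.norm_eq_abs]
      have q0 : 0 ≤ max (w x - s) 0 := le_max_right _ _
      have χ0 := c4 x
      have χ1 := c5 x
      rw [abs_of_nonneg (by positivity), abs_of_nonneg (by positivity)]
      have a1 : 2 * χ x * max (w x - s) 0 ^ 2 * ‖gradient χ x‖ ≤ (16 / (ρ - r)) * θ x := by
        calc 2 * χ x * max (w x - s) 0 ^ 2 * ‖gradient χ x‖ ≤ 2 * 1 * max (w x - s) 0 ^ 2 * (8 / (ρ - r)) := by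
              gcongr; exact c7 x
          _ = _ := by simp only [hθ]; ring
      have a2 : 2 * χ x ^ 2 * max (w x - s) 0 * ‖gradient w x‖ ≤ χ x ^ 2 * θ x * ‖gradient w x‖ ^ 2 +
          T.indicator (fun _ => (1:ℝ)) x := by
        by_cases hxT : x ∈ T
        · rw [indicator_of_mem hxT]
          have : 0 ≤ χ x ^ 2 * (max (w x - s) 0 * ‖gradient w x‖ - 1) ^ 2 := by positivity
          have b2 : χ x ^ 2 ≤ 1 := pow_le_one₀ χ0 χ1
          simp only [hθ]
          nlinarith
        · have : w x ≤ s := by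
            by_contra hh; push Not at hh; exact hxT ⟨c3 hx, hh⟩
          rw [indicator_of_notMem hxT, max_eq_right (sub_nonpos.2 this)]
          simp [hθ, max_eq_right (sub_nonpos.2 this)]
      linarith
    · rw [grad_zero_of_notMem (fun hh => hx (tsupport_mul_sq hh)), norm_zero]
      have b1 : 0 ≤ (closedBall (0:E) ρ).indicator θ x := indicator_nonneg (fun x _ => th0 x) x
      have b2 : 0 ≤ T.indicator (fun _ => (1:ℝ)) x := indicator_nonneg (fun x _ => zero_le_one) x
      have := th0 x
      positivity
  have gradle : ∫ x, ‖gradient f x‖ ≤ (16 / (ρ - r)) * YY w s ρ + K * (65 / (ρ - r) ^ 2 * YY w s ρ) + volume.real T := by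
    have I1 := (iind.const_mul (16 / (ρ - r))).add Iw
    have := integral_mono (integrable_grad f1 f2) (I1.add IT) pw
    refine this.trans ?_
    have e : ∫ x, (((fun x => 16 / (ρ - r) * (closedBall (0:E) ρ).indicator θ x) + fun x => χ x ^ 2 * θ x * ‖gradient w x‖ ^ 2) +
      T.indicator (fun _ => (1:ℝ))) x = (16 / (ρ - r)) * YY w s ρ + (∫ x, χ x ^ 2 * θ x * ‖gradient w x‖ ^ 2) + volume.real T := by
      rw [integral_add' I1 IT, integral_add' (iind.const_mul _) Iw, integral_const_mul, eY, eT]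
    have e2 := le_of_eq e
    refine le_trans e2 ?_
    linarith
  have Ymono : YY w s ρ ≤ YY w s' ρ := h.YY_mono hs.le le_rfl (by linarith)
  have Y0 := YY_nonneg w s ρ
  have Y0' := YY_nonneg w s' ρ
  have cheb := h.cheb hs (show ρ ≤ 2 by linarith)
  have g2 : ∫ x, ‖gradient f x‖ ≤ 81 * K / (ρ - r) ^ 2 * YY w s' ρ + YY w s' ρ / (s - s') ^ 2 := by
    refine gradle.trans ?_
    have a1 : 16 / (ρ - r) ≤ 16 * K / (ρ - r) ^ 2 := by
      rw [div_le_div_iff₀ d0 (by positivity)]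
      have : ρ - r ≤ 1 := by linarith
      have : (ρ - r) ≤ K := by linarith
      nlinarith [mul_nonneg d0.le (sub_nonneg.2 this)]
    have a2 : (16 / (ρ - r)) * YY w s ρ ≤ 16 * K / (ρ - r) ^ 2 * YY w s' ρ := by gcongr
    have a3 : K * (65 / (ρ - r) ^ 2 * YY w s ρ) ≤ K * (65 / (ρ - r) ^ 2 * YY w s' ρ) := by gcongr
    have e : 16 * K / (ρ - r) ^ 2 * YY w s' ρ + K * (65 / (ρ - r) ^ 2 * YY w s' ρ) = 81 * K / (ρ - r) ^ 2 * YY w s' ρ := by ring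
    linarith
  have low : YY w s r ≤ ∫ x, f x := by
    have : YY w s r = ∫ x, (closedBall (0:E) r).indicator θ x := (integral_indicator measurableSet_closedBall).symm
    rw [this]
    have i1 := (h.intOn s (show r ≤ 2 by linarith)).integrable_indicator measurableSet_closedBall
    refine integral_mono i1 (f1.continuous.integrable_of_hasCompactSupport f2) ?_
    intro x
    by_cases hx : x ∈ closedBall (0:E) r
    · rw [indicator_of_mem hx]; simp [hf, c6 x hx]
    · rw [indicator_of_notMem hx]; exact f0 x
  have g0 : 0 ≤ ∫ x, ‖gradient f x‖ := integral_nonneg fun x => norm_nonneg _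
  calc YY w s r ≤ _ := low
    _ ≤ _ := S1
    _ ≤ _ := by gcongr

end DG2Sec


section DG3Sec
variable {E : Type*} [NormedAddCommGroup E] [InnerProductSpace ℝ E] [FiniteDimensional ℝ E]
  [MeasurableSpace E] [BorelSpace E] {K : ℝ} {w : E → ℝ}

lemma LogSub.iter (h : LogSub K w) {C : ℝ} (hC : 1 ≤ C) (hn : 1 ≤ Module.finrank ℝ E)
    (sob : ∀ f : E → ℝ, ContDiff ℝ 1 f →
    HasCompactSupport f → (∀ x, 0 ≤ f x) → ∀ T : Set E, MeasurableSet T → volume T ≠ ⊤ →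
    (∀ x ∉ T, f x = 0) →
    ∫ x, f x ≤ C * (volume.real T) ^ ((1:ℝ) / Module.finrank ℝ E) * ∫ x, ‖gradient f x‖)
    {H : ℝ} (hH : 1 ≤ H) (hY : YY w 0 (3/4) ≤
      H ^ 2 * ((20752 * C * K * 16 ^ Module.finrank ℝ E)⁻¹) ^ Module.finrank ℝ E) :
    ∀ x ∈ ball (0:E) (1/2), w x ≤ H := by
  set n := Module.finrank ℝ E with hnn
  set q : ℝ := (20752 * C * K * 16 ^ n)⁻¹ with hq
  have oK := h.oK
  have q0 : 0 < q := by positivity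
  set Ys : ℝ := H ^ 2 * q ^ n with hYs
  have n0 : n ≠ 0 := by omega
  set Y : ℕ → ℝ := fun k => YY w (H * (1 - (1/2:ℝ) ^ k)) (1/2 + (1/2:ℝ) ^ (k + 2)) with hYd
  have main : ∀ k, Y k ≤ Ys * ((16 ^ n : ℝ)⁻¹) ^ k := by
    intro k
    induction k with
    | zero =>
      simp only [hYd, pow_zero, mul_one, sub_self, mul_zero, zero_add]
      have : (1/2 + (1/2:ℝ) ^ 2) = 3/4 := by norm_num
      rw [this]; exact hY
    | succ k ih =>
      set p : ℝ := (1/2:ℝ) ^ k with hp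
      have p0 : 0 < p := by positivity
      have p1 : p ≤ 1 := pow_le_one₀ (by norm_num) (by norm_num)
      have e1 : (1/2:ℝ) ^ (k+1) = p / 2 := by rw [pow_succ]; ring
      have e2 : (1/2:ℝ) ^ (k+2) = p / 4 := by rw [pow_add]; ring
      have e3 : (1/2:ℝ) ^ (k+1+2) = p / 8 := by rw [pow_add, pow_add]; ring
      have S := h.step hC sob (s := H * (1 - p/2)) (s' := H * (1 - p)) (r := 1/2 + p/8) (ρ := 1/2 + p/4)
        (by nlinarith) (by nlinarith) (by linarith) (by linarith) (by linarith)
      have Yk : YY w (H * (1 - p)) (1/2 + p/4) = Y k := by simp only [hYd, e2]; rfl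
      have Yk1 : YY w (H * (1 - p/2)) (1/2 + p/8) = Y (k+1) := by simp only [hYd, e3, e1]
      rw [Yk, Yk1] at S
      have Y0 : 0 ≤ Y k := YY_nonneg _ _ _
      have d1 : H * (1 - p/2) - H * (1 - p) = H * p / 2 := by ring
      have d2 : (1/2 + p/4) - (1/2 + p/8) = p / 8 := by ring
      rw [d1, d2] at S
      -- bracket
      have b1 : 81 * K / (p/8)^2 * Y k + Y k / (H * p / 2) ^ 2 ≤ 5188 * K / p ^ 2 * Y k := by
        have : Y k / (H * p / 2) ^ 2 ≤ 4 * K / p ^ 2 * Y k := by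
          have : Y k / (H * p / 2) ^ 2 = 4 / (H^2 * p ^ 2) * Y k := by field_simp; try ring
          rw [this]
          have : 4 / (H^2 * p ^ 2) ≤ 4 * K / p ^ 2 := by
            apply div_le_div₀ (by positivity) (by linarith) (by positivity)
            have : 1 ≤ H^2 := by nlinarith
            nlinarith [sq_nonneg p]
          gcongr
        have e : 81 * K / (p/8)^2 * Y k = 5184 * K / p ^ 2 * Y k := by field_simp; try ring
        rw [e]
        have : 5188 * K / p ^ 2 * Y k = 5184 * K / p ^ 2 * Y k + 4 * K / p ^ 2 * Y k := by ring
        linarith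
      have b2 : (Y k / (H * p / 2) ^ 2) ^ ((1:ℝ)/n) ≤ 4 / p ^ 2 * (q * p ^ 4) := by
        have x1 : Y k / (H * p / 2) ^ 2 ≤ (4 / p ^ 2 * (q * p ^ 4)) ^ n := by
          have : Y k / (H * p / 2) ^ 2 = 4 / p^2 * (Y k / H ^ 2) := by field_simp; try ring
          rw [this, mul_pow]
          have o4 : 1 ≤ 4 / p ^ 2 := by rw [le_div_iff₀ (by positivity)]; nlinarith
          have : Y k / H ^ 2 ≤ (q * p ^ 4) ^ n := by
            rw [div_le_iff₀ (by positivity)]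
            refine ih.trans (le_of_eq ?_)
            have : ((16 ^ n : ℝ)⁻¹) ^ k = (p ^ 4) ^ n := by
              rw [hp, ← inv_pow, ← pow_mul, ← pow_mul, ← pow_mul, show (16:ℝ)⁻¹ = (1/2)^4 by norm_num, ← pow_mul]
              ring_nf
            rw [this, hYs, mul_pow]; ring
          have b0 : 0 ≤ Y k / H ^ 2 := by positivity
          apply mul_le_mul (le_self_pow₀ o4 n0) this b0 (by positivity)
        calc (Y k / (H * p / 2) ^ 2) ^ ((1:ℝ)/n) ≤ ((4 / p ^ 2 * (q * p ^ 4)) ^ n) ^ ((1:ℝ)/n) := by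
              apply Real.rpow_le_rpow (by positivity) x1 (by positivity)
          _ = _ := by rw [one_div, Real.pow_rpow_inv_natCast (by positivity) n0]
      calc Y (k+1) ≤ _ := S
        _ ≤ C * (4 / p ^ 2 * (q * p ^ 4)) * (5188 * K / p ^ 2 * Y k) := by gcongr
        _ = (20752 * C * K) * q * Y k := by field_simp; try ring
        _ ≤ (20752 * C * K) * q * (Ys * ((16 ^ n : ℝ)⁻¹) ^ k) := by gcongr
        _ = Ys * ((16 ^ n : ℝ)⁻¹) ^ (k+1) := by
          have : (20752 * C * K) * q = (16 ^ n : ℝ)⁻¹ := by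
            rw [hq, mul_inv]; field_simp
          rw [this, pow_succ]; ring
  have lim : YY w H (1/2) ≤ 0 := by
    have t : Filter.Tendsto (fun k : ℕ => Ys * ((16 ^ n : ℝ)⁻¹) ^ k) Filter.atTop (nhds (Ys * 0)) := by
      apply Filter.Tendsto.const_mul
      apply tendsto_pow_atTop_nhds_zero_of_lt_one (by positivity)
      apply inv_lt_one_of_one_lt₀
      exact one_lt_pow₀ (by norm_num) n0
    rw [mul_zero] at t
    refine ge_of_tendsto' t fun k => ?_
    refine le_trans ?_ (main k)
    have p0 : 0 < (1/2:ℝ) ^ k := by positivity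
    have p1 : (1/2:ℝ) ^ k ≤ 1 := pow_le_one₀ (by norm_num) (by norm_num)
    have p2 : 0 < (1/2:ℝ) ^ (k+2) := by positivity
    have p3 : (1/2:ℝ) ^ (k+2) ≤ 1 := pow_le_one₀ (by norm_num) (by norm_num)
    exact h.YY_mono (by nlinarith) (by linarith) (by linarith)
  have z : YY w H (1/2) = 0 := le_antisymm lim (YY_nonneg _ _ _)
  have z2 := (setIntegral_eq_zero_iff_of_nonneg_ae (Filter.Eventually.of_forall fun x => sq_nonneg _)
    (h.intOn H (show (1/2:ℝ) ≤ 2 by norm_num))).1 z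
  have z3 := ae_restrict_of_ae_restrict_of_subset (ball_subset_closedBall (x := (0:E)) (ε := 1/2)) z2
  have cw : ContinuousOn (fun x => max (w x - H) 0 ^ 2) (ball (0:E) (1/2)) :=
    (maxsq_contDiff H).continuous.comp_continuousOn (h.cw.mono (ball_subset_closedBall.trans (closedBall_subset_closedBall (by norm_num))))
  have z4 := Measure.eqOn_open_of_ae_eq z3 isOpen_ball cw continuousOn_const
  intro x hx
  have := z4 hx
  simp only [Pi.zero_apply] at this
  have := pow_eq_zero_iff (two_ne_zero) |>.1 this
  have := le_max_left (w x - H) 0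
  linarith

end DG3Sec


section DG4Sec
variable {E : Type*} [NormedAddCommGroup E] [InnerProductSpace ℝ E] [FiniteDimensional ℝ E]
  [MeasurableSpace E] [BorelSpace E] {K : ℝ} {w : E → ℝ}

lemma LogSub.first (h : LogSub K w)
    (hz : volume.real (ball (0:E) 1) / 2 ≤ volume.real {x ∈ ball (0:E) 1 | w x ≤ 0}) :
    YY w 0 (3/4) ≤ 4 * (4 * 2 ^ Module.finrank ℝ E) ^ 2 * (K * (65 * volume.real (closedBall (0:E) 2))) := by
  set N : ℝ := 4 * 2 ^ Module.finrank ℝ E with hN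
  have N0 : 0 < N := by positivity
  have oK := h.oK
  obtain ⟨χ, c1, c2, c3, c4, c5, c6, c7⟩ := exists_cutoff (E := E) (r := 1) (ρ := 2) one_pos (by norm_num)
  set f : E → ℝ := fun x => χ x ^ 2 * max (w x - 0) 0 ^ 2 with hf
  have f1 : ContDiff ℝ 1 f := h.cd_f c1 c3 0
  have f2 : HasCompactSupport f := c2.mono' (subset_closure.trans tsupport_mul_sq)
  have f0 : ∀ x, 0 ≤ f x := fun x => mul_nonneg (sq_nonneg _) (sq_nonneg _)
  have P := poincare f1 f0 (by
    refine hz.trans ?_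
    apply measureReal_mono
    · rintro x ⟨hx, hw⟩
      refine ⟨hx, ?_⟩
      simp [hf, max_eq_right hw]
    · exact ne_top_of_le_ne_top measure_ball_lt_top.ne (measure_mono fun x hx => hx.1))
  set θ : ℝ → ℝ := fun t => prof (t + 1) with hθ
  have tD : ∀ t, HasDerivAt θ (4 * max (1 - max (t+1) 0 ^ 2) 0 * max (t+1) 0) t := fun t =>
    (prof_hasDerivAt (t+1)).comp_add_const t 1
  have tc : ContDiff ℝ 1 θ := by
    rw [contDiff_one_iff_deriv]
    refine ⟨fun t => (tD t).differentiableAt, ?_⟩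
    rw [show deriv θ = fun t => 4 * max (1 - max (t+1) 0 ^ 2) 0 * max (t+1) 0 from funext fun t => (tD t).deriv]
    fun_prop
  have cac := h.cac χ c1 c2 c3 θ tc (fun t => prof_nonneg _) (fun t => by rw [(tD t).deriv]; positivity)
    (fun t ht => prof_zero (by linarith))
  have cw : ContinuousOn w (tsupport χ) := h.cw.mono c3
  have ct : ContinuousOn (fun x => θ (w x)) (tsupport χ) := tc.continuous.comp_continuousOn cw
  have Icac : Integrable (fun x => (‖gradient χ x‖ ^ 2 + χ x ^ 2) * θ (w x)) := by
    refine integrable_of_tsupport c2 ?_ ?_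
    · exact (((((cont_grad c1).norm.pow 2)).add ((c1.continuous.pow 2))).continuousOn.mul ct)
    · intro x hx; simp [image_eq_zero_of_notMem_tsupport hx, grad_zero_of_notMem hx]
  have rhs : ∫ x, (‖gradient χ x‖ ^ 2 + χ x ^ 2) * θ (w x) ≤ 65 * volume.real (closedBall (0:E) 2) := by
    have e : ∫ x, (closedBall (0:E) 2).indicator (fun _ => (65:ℝ)) x = 65 * volume.real (closedBall (0:E) 2) := by
      rw [integral_indicator measurableSet_closedBall, setIntegral_const, smul_eq_mul, mul_comm]
    rw [← e]
    refine integral_mono Icac ((integrable_indicator_iff measurableSet_closedBall).2 (integrableOn_const measure_closedBall_lt_top.ne)) ?_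
    intro x
    by_cases hx : x ∈ closedBall (0:E) 2
    · simp only
      rw [indicator_of_mem hx]
      have a1 : ‖gradient χ x‖ ^ 2 ≤ 8 ^ 2 := by
        have := c7 x
        norm_num at this
        gcongr
      have a2 : χ x ^ 2 ≤ 1 := pow_le_one₀ (c4 x) (c5 x)
      have t0 : 0 ≤ θ (w x) := prof_nonneg _
      have t1 : θ (w x) ≤ 1 := prof_le_one _
      nlinarith [sq_nonneg ‖gradient χ x‖, sq_nonneg (χ x)]
    · simp only
      rw [indicator_of_notMem hx, grad_zero_of_notMem (fun hh => hx (c3 hh)),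
        image_eq_zero_of_notMem_tsupport (fun hh => hx (c3 hh))]
      simp
  have cgw : ContinuousOn (gradient w) (tsupport χ) := by
    intro x hx
    have h1 := (h.cd x (c3 hx)).continuousAt_fderiv one_ne_zero
    exact ((InnerProductSpace.toDual ℝ E).symm.continuous.continuousAt.comp h1).continuousWithinAt
  set g : E → ℝ := fun x => χ x ^ 2 * θ (w x) * ‖gradient w x‖ ^ 2 with hg
  have g0 : ∀ x, 0 ≤ g x := fun x => mul_nonneg (mul_nonneg (sq_nonneg _) (prof_nonneg _)) (sq_nonneg _)
  have Iw : Integrable g := by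
    refine integrable_of_tsupport c2 ?_ ?_
    · exact ((c1.continuous.pow 2).continuousOn.mul ct).mul (cgw.norm.pow 2)
    · intro x hx; simp [hg, image_eq_zero_of_notMem_tsupport hx]
  have If : Integrable f := f1.continuous.integrable_of_hasCompactSupport f2
  have pw : ∀ x ∈ ball (0:E) 1, ‖gradient f x‖ ≤ (1 / (2*N)) * f x + (2 * N) * g x := by
    intro x hx
    have χ1 : χ x = 1 := c6 x (ball_subset_closedBall hx)
    have hxs : x ∈ tsupport χ := subset_tsupport _ (by simp [Function.mem_support, χ1])
    have gχ : gradient χ x = 0 := by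
      have : χ =ᶠ[nhds x] fun _ => 1 := by
        filter_upwards [isOpen_ball.mem_nhds hx] with y hy using c6 y (ball_subset_closedBall hy)
      rw [gradient, this.fderiv_eq]; simp
    rw [h.grad_f c1 c3 0 hxs, gχ, smul_zero, zero_add, norm_smul, Real.norm_eq_abs, χ1]
    have q0 := le_max_right (w x - 0) 0
    rw [abs_of_nonneg (by positivity)]
    simp only [hf, hg, χ1]
    rcases le_or_gt (w x) 0 with hw | hw
    · have := g0 x
      simp only [hg, χ1] at this
      rw [max_eq_right (by linarith)]
      simp only [mul_zero, zero_mul, ne_eq, OfNat.ofNat_ne_zero, not_false_eq_true, zero_pow, zero_add]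
      positivity
    · have : θ (w x) = 1 := prof_one (by linarith)
      rw [this]
      set q := max (w x - 0) 0
      set G := ‖gradient w x‖
      have e : (1 / (2*N)) * (1 ^ 2 * q ^ 2) + 2 * N * (1 ^ 2 * 1 * G ^ 2) - 2 * 1 ^ 2 * q * G = (q - 2 * N * G) ^ 2 / (2 * N) := by
        field_simp; ring
      have : 0 ≤ (q - 2 * N * G) ^ 2 / (2 * N) := by positivity
      linarith
  have P2 : ∫ x in ball (0:E) 1, ‖gradient f x‖ ≤ (1 / (2*N)) * (∫ x in ball (0:E) 1, f x) + (2 * N) * ∫ x, g x := by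
    calc ∫ x in ball (0:E) 1, ‖gradient f x‖ ≤ ∫ x in ball (0:E) 1, ((1 / (2*N)) * f x + (2 * N) * g x) :=
          setIntegral_mono_on (integrable_grad f1 f2).integrableOn
            ((If.const_mul _).add (Iw.const_mul _)).integrableOn measurableSet_ball pw
      _ = (1 / (2*N)) * (∫ x in ball (0:E) 1, f x) + (2 * N) * ∫ x in ball (0:E) 1, g x := by
          rw [integral_add (If.const_mul _).integrableOn (Iw.const_mul _).integrableOn, integral_const_mul, integral_const_mul]
      _ ≤ _ := by
          have := setIntegral_le_integral (s := ball (0:E) 1) Iw (Filter.Eventually.of_forall g0)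
          have := mul_le_mul_of_nonneg_left this (show 0 ≤ 2 * N by positivity)
          linarith
  have low : YY w 0 (3/4) ≤ ∫ x in ball (0:E) 1, f x := by
    calc YY w 0 (3/4) = ∫ x in closedBall (0:E) (3/4), f x := by
          apply setIntegral_congr_fun measurableSet_closedBall
          intro x hx
          simp [hf, c6 x (closedBall_subset_closedBall (by norm_num) hx)]
      _ ≤ _ := setIntegral_mono_set If.integrableOn (Filter.Eventually.of_forall f0)
          (closedBall_subset_ball (by norm_num)).eventuallyLE
  have gle : ∫ x, g x ≤ K * (65 * volume.real (closedBall (0:E) 2)) := by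
    refine cac.trans ?_
    gcongr
  have P3 : N * ∫ x in ball (0:E) 1, ‖gradient f x‖ ≤ N * ((1 / (2*N)) * (∫ x in ball (0:E) 1, f x) + (2 * N) * ∫ x, g x) := by
    gcongr
  have e : N * ((1 / (2*N)) * (∫ x in ball (0:E) 1, f x) + (2 * N) * ∫ x, g x) = (1/2) * (∫ x in ball (0:E) 1, f x) + 2 * N ^ 2 * ∫ x, g x := by
    field_simp
  have : 4 * N ^ 2 * ∫ x, g x ≤ 4 * N ^ 2 * (K * (65 * volume.real (closedBall (0:E) 2))) := by gcongr
  linarith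

/-- uniform upper bound for log subsolutions. -/
lemma exists_logSub_bound (E : Type*) [NormedAddCommGroup E] [InnerProductSpace ℝ E] [FiniteDimensional ℝ E]
    [MeasurableSpace E] [BorelSpace E] (hn : 2 ≤ Module.finrank ℝ E) (K : ℝ) (hK : 1 ≤ K) :
    ∃ H : ℝ, 1 ≤ H ∧ ∀ w : E → ℝ, LogSub K w →
      volume.real (ball (0:E) 1) / 2 ≤ volume.real {x ∈ ball (0:E) 1 | w x ≤ 0} →
      ∀ x ∈ ball (0:E) (1/2), w x ≤ H := by
  obtain ⟨C, C1, sob⟩ := sob E hn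
  set n := Module.finrank ℝ E
  set q : ℝ := (20752 * C * K * 16 ^ n)⁻¹ with hq
  have q0 : 0 < q := by positivity
  set Ym : ℝ := 4 * (4 * 2 ^ n) ^ 2 * (K * (65 * volume.real (closedBall (0:E) 2))) with hY
  have Y0 : 0 ≤ Ym := by positivity
  have d0 : 0 ≤ Ym / q ^ n := by positivity
  refine ⟨1 + Ym / q ^ n, by linarith, ?_⟩
  intro w h hz
  refine h.iter C1 (by omega) sob (by linarith) ?_
  refine (h.first hz).trans ?_
  calc Ym = (Ym / q ^ n) * q ^ n := by field_simp
    _ ≤ _ := by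
      gcongr
      nlinarith

end DG4Sec


section OscSec

lemma exists_osc_unit (E : Type*) [NormedAddCommGroup E] [InnerProductSpace ℝ E] [FiniteDimensional ℝ E]
    [MeasurableSpace E] [BorelSpace E] (hn : 2 ≤ Module.finrank ℝ E) (L : ℝ) (hL : 1 ≤ L) :
    ∃ c : ℝ, 0 < c ∧ c ≤ 1/2 ∧ ∀ (Ω : Set E) (S : ℝ) (A : E → E →L[ℝ] E) (u G : E → ℝ), Sol Ω L S A u G →
      closedBall 0 2 ⊆ Ω → ∀ τ M : ℝ, 0 < τ → 24 * L * τ ≤ 1 → S ≤ c * τ →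
      (∀ x ∈ closedBall (0:E) 2, u x ≤ M) →
      volume.real (ball (0:E) 1) / 2 ≤ volume.real {x ∈ ball (0:E) 1 | u x ≤ M - τ} →
      ∀ x ∈ ball (0:E) (1/2), u x ≤ M - c * τ := by
  have oK : 1 ≤ 16 * L ^ 4 := by have := one_le_pow₀ (n := 4) hL; linarith
  obtain ⟨H, H1, hH⟩ := exists_logSub_bound E hn (16 * L ^ 4) oK
  have eH : 0 < Real.exp (-H) := Real.exp_pos _
  have eH1 : Real.exp (-H) ≤ 1 := Real.exp_le_one_iff.2 (by linarith)
  refine ⟨Real.exp (-H) / 2, by positivity, by linarith, ?_⟩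
  intro Ω S A u G h hΩ τ M τ0 hτ hS hu hz x hx
  set δ := Real.exp (-H) / 2 * τ with hδ
  have δ0 : 0 < δ := by positivity
  have δτ : δ ≤ τ := by nlinarith
  have ls := h.logSub hΩ (M := M) (δ := δ) (c := τ + δ) δ0 (by linarith) hS (by
    rw [le_div_iff₀ (by positivity)]
    nlinarith) hu
  have y0 : ∀ x ∈ closedBall (0:E) 2, 0 < M + δ - u x := fun x hx => by linarith [hu x hx]
  have key := hH _ ls (by
    refine hz.trans (measureReal_mono ?_ ?_)
    · rintro y ⟨hy, hw⟩
      refine ⟨hy, ?_⟩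
      unfold lw
      have : Real.log (τ + δ) ≤ Real.log (M + δ - u y) := Real.log_le_log (by linarith) (by linarith)
      linarith
    · exact ne_top_of_le_ne_top measure_ball_lt_top.ne (measure_mono fun x hx => hx.1)) x hx
  have hx2 : x ∈ closedBall (0:E) 2 := ball_subset_closedBall (ball_subset_ball (by norm_num) hx)
  unfold lw at key
  have : Real.log ((τ + δ) * Real.exp (-H)) ≤ Real.log (M + δ - u x) := by
    rw [Real.log_mul (by linarith) eH.ne', Real.log_exp]; linarith
  have := (Real.log_le_log_iff (by positivity) (y0 x hx2)).1 this
  nlinarith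

variable {E : Type*} [NormedAddCommGroup E] [InnerProductSpace ℝ E] [FiniteDimensional ℝ E]
    [MeasurableSpace E] [BorelSpace E]

lemma exists_osc_step (E : Type*) [NormedAddCommGroup E] [InnerProductSpace ℝ E] [FiniteDimensional ℝ E]
    [MeasurableSpace E] [BorelSpace E] (hn : 2 ≤ Module.finrank ℝ E) (L : ℝ) (hL : 1 ≤ L) :
    ∃ c : ℝ, 0 < c ∧ c ≤ 1/2 ∧ ∀ (Ω : Set E) (S : ℝ) (A : E → E →L[ℝ] E) (u G : E → ℝ), Sol Ω L S A u G →
      closedBall 0 2 ⊆ Ω → ∀ τ m M : ℝ, 0 < τ → 24 * L * τ ≤ 1 → S ≤ c * τ →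
      (∀ x ∈ closedBall (0:E) 2, m ≤ u x ∧ u x ≤ M) →
      ∃ m' M' : ℝ, M' - m' ≤ max (2 * τ) (M - m - c * τ) ∧ ∀ x ∈ ball (0:E) (1/2), m' ≤ u x ∧ u x ≤ M' := by
  obtain ⟨c, c0, c1, hc⟩ := exists_osc_unit E hn L hL
  refine ⟨c, c0, c1, ?_⟩
  intro Ω S A u G h hΩ τ m M τ0 hτ hS hu
  have sub : ∀ x ∈ ball (0:E) (1/2), x ∈ closedBall (0:E) 2 := fun x hx =>
    ball_subset_closedBall (ball_subset_ball (by norm_num) hx)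
  rcases le_or_gt (M - m) (2 * τ) with hM | hM
  · exact ⟨m, M, le_max_of_le_left hM, fun x hx => hu x (sub x hx)⟩
  by_cases hz : volume.real (ball (0:E) 1) / 2 ≤ volume.real {x ∈ ball (0:E) 1 | u x ≤ M - τ}
  · exact ⟨m, M - c * τ, le_max_of_le_right (by linarith), fun x hx =>
      ⟨(hu x (sub x hx)).1, hc Ω S A u G h hΩ τ M τ0 hτ hS (fun x hx => (hu x hx).2) hz x hx⟩⟩
  · refine ⟨m + c * τ, M, le_max_of_le_right (by linarith), fun x hx => ⟨?_, (hu x (sub x hx)).2⟩⟩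
    have := hc Ω S A _ _ h.neg hΩ τ (-m) τ0 hτ hS (fun x hx => by simpa using (hu x hx).1) (by
      push Not at hz
      have fin : ∀ P : E → Prop, volume {x ∈ ball (0:E) 1 | P x} ≠ ⊤ := fun P =>
        ne_top_of_le_ne_top measure_ball_lt_top.ne (measure_mono fun x hx => hx.1)
      have cov : ball (0:E) 1 ⊆ {x ∈ ball (0:E) 1 | u x ≤ M - τ} ∪ {x ∈ ball (0:E) 1 | (-u x) ≤ -m - τ} := by
        intro y hy
        rcases le_or_gt (u y) (M - τ) with h1 | h1
        · exact Or.inl ⟨hy, h1⟩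
        · refine Or.inr ⟨hy, by linarith⟩
      have a1 := measureReal_mono (μ := volume) cov (measure_union_ne_top (fin _) (fin _))
      have a2 := measureReal_union_le (μ := volume) {x ∈ ball (0:E) 1 | u x ≤ M - τ} {x ∈ ball (0:E) 1 | (-u x) ≤ -m - τ}
      have : volume.real (ball (0:E) 1) / 2 ≤ volume.real {x ∈ ball (0:E) 1 | (-u x) ≤ -m - τ} := by linarith
      exact this) x hx
    linarith

lemma exists_osc_decay (E : Type*) [NormedAddCommGroup E] [InnerProductSpace ℝ E] [FiniteDimensional ℝ E]
    [MeasurableSpace E] [BorelSpace E] (hn : 2 ≤ Module.finrank ℝ E) (L : ℝ) (hL : 1 ≤ L) :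
    ∃ c : ℝ, 0 < c ∧ c ≤ 1/2 ∧ ∀ (Ω : Set E) (S : ℝ) (A : E → E →L[ℝ] E) (u G : E → ℝ), Sol Ω L S A u G →
      ∀ x0 r, 0 < r → closedBall x0 r ⊆ Ω → ∀ τ m M : ℝ, 0 < τ → 24 * L * τ ≤ 1 → r ^ 2 * S ≤ c * τ →
      (∀ x ∈ closedBall x0 r, m ≤ u x ∧ u x ≤ M) → ∀ k : ℕ,
      ∃ m' M' : ℝ, M' - m' ≤ max (2 * τ) (M - m - k * (c * τ)) ∧ ∀ x ∈ closedBall x0 (r / 8 ^ k), m' ≤ u x ∧ u x ≤ M' := by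
  obtain ⟨c, c0, c1, hc⟩ := exists_osc_step E hn L hL
  refine ⟨c, c0, c1, ?_⟩
  intro Ω S A u G h x0 r r0 hΩ τ m M τ0 hτ hS hu k
  have S0 := h.S0
  induction k with
  | zero => exact ⟨m, M, le_max_of_le_right (by simp), by simpa using hu⟩
  | succ k ih =>
    obtain ⟨m1, M1, h1, h2⟩ := ih
    set s := r / 8 ^ k with hs
    have s0 : 0 < s := by positivity
    have sr : s ≤ r := div_le_self r0.le (one_le_pow₀ (by norm_num))
    have mem : ∀ z ∈ closedBall (0:E) 2, x0 + (s/2) • z ∈ closedBall x0 s := by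
      intro z hz
      rw [mem_closedBall_zero_iff] at hz
      rw [mem_closedBall_iff_norm, add_sub_cancel_left, norm_smul, Real.norm_eq_abs, abs_of_pos (by positivity)]
      nlinarith
    have hsc := h.scale (Ω' := closedBall (0:E) 2) x0 (σ := s/2) (by positivity)
      (fun z hz => hΩ (closedBall_subset_closedBall sr (mem z hz)))
    obtain ⟨m2, M2, h3, h4⟩ := hc _ _ _ _ _ hsc subset_rfl τ m1 M1 τ0 hτ (by
      refine le_trans ?_ hS
      gcongr
      linarith) (fun z hz => h2 _ (mem z hz))
    refine ⟨m2, M2, ?_, ?_⟩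
    · refine h3.trans (max_le (le_max_left _ _) ?_)
      rcases le_total (2 * τ) (M - m - k * (c * τ)) with hh | hh
      · rw [max_eq_right hh] at h1
        apply le_max_of_le_right
        push_cast; nlinarith
      · rw [max_eq_left hh] at h1
        apply le_max_of_le_left
        nlinarith
    · intro x hx
      have e : r / 8 ^ (k+1) = s / 8 := by rw [hs, pow_succ]; field_simp
      rw [e, mem_closedBall_iff_norm] at hx
      have := h4 ((s/2)⁻¹ • (x - x0)) (by
        rw [mem_ball_zero_iff, norm_smul, Real.norm_eq_abs, abs_of_pos (by positivity), inv_mul_lt_iff₀ (by positivity)]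
        linarith)
      rwa [smul_smul, mul_inv_cancel₀ (by positivity), one_smul, add_sub_cancel] at this

end OscSec


section GradSec
variable {E : Type*} [NormedAddCommGroup E] [InnerProductSpace ℝ E] [FiniteDimensional ℝ E]
  [MeasurableSpace E] [BorelSpace E]

lemma deriv_avg {u : E → ℝ} (hu : ContDiff ℝ 1 u) {k : E → ℝ} (hk : Continuous k) {R : ℝ} (hR : 0 ≤ R)
    (k0 : ∀ z, R < ‖z‖ → k z = 0) (s : ℝ) :
    HasDerivAt (fun s : ℝ => ∫ z, u (s • z) * k z) (∫ z, inner ℝ (gradient u (s • z)) z * k z) s := by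
  have cg := cont_grad hu
  obtain ⟨M, hM⟩ := (isCompact_closedBall (0:E) ((|s| + 1) * R)).exists_bound_of_continuousOn cg.continuousOn
  have off : ∀ z ∉ closedBall (0:E) R, k z = 0 := fun z hz => k0 z (by simpa using hz)
  have int : ∀ f : E → ℝ, Continuous f → Integrable (fun z => f z * k z) := fun f hf =>
    integrable_of_tsupport (isCompact_closedBall (0:E) R) (hf.mul hk).continuousOn
      (fun z hz => by simp [off z hz])
  have ik : Integrable k := integrable_of_tsupport (isCompact_closedBall (0:E) R) hk.continuousOn off
  refine (hasDerivAt_integral_of_dominated_loc_of_deriv_le (bound := fun z => M * R * |k z|)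
    (F := fun s z => u (s • z) * k z) (F' := fun s z => inner ℝ (gradient u (s • z)) z * k z)
    (s := ball s 1) (ball_mem_nhds s one_pos) ?_ ?_ ?_ ?_ ?_ ?_).2
  · exact Filter.Eventually.of_forall fun t =>
      (int (fun z => u (t • z)) (hu.continuous.comp (by fun_prop))).aestronglyMeasurable
  · exact int (fun z => u (s • z)) (hu.continuous.comp (by fun_prop))
  · exact (int (fun z => inner ℝ (gradient u (s • z)) z)
      ((cg.comp (by fun_prop)).inner continuous_id)).aestronglyMeasurable
  · refine Filter.Eventually.of_forall fun z t ht => ?_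
    rw [norm_mul, Real.norm_eq_abs, Real.norm_eq_abs]
    by_cases hz : z ∈ closedBall (0:E) R
    · have hz' : ‖z‖ ≤ R := by simpa using hz
      apply mul_le_mul_of_nonneg_right _ (abs_nonneg _)
      have m1 : t • z ∈ closedBall (0:E) ((|s| + 1) * R) := by
        rw [mem_closedBall_zero_iff, norm_smul, Real.norm_eq_abs]
        have : |t| ≤ |s| + 1 := by
          rw [mem_ball, Real.dist_eq] at ht
          have := abs_sub_abs_le_abs_sub t s
          linarith
        gcongr
      have := hM _ m1
      calc |inner ℝ (gradient u (t • z)) z| ≤ ‖gradient u (t • z)‖ * ‖z‖ := abs_real_inner_le_norm _ _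
        _ ≤ M * R := by
          apply mul_le_mul this hz' (norm_nonneg _) ((norm_nonneg _).trans this)
    · simp [off z hz]
  · exact ik.abs.const_mul _
  · refine Filter.Eventually.of_forall fun z t ht => ?_
    have h1 := (grad_hasFDerivAt (hu.differentiable one_ne_zero (t • z))).comp_hasDerivAt t
      ((hasDerivAt_id t).smul_const z)
    have h2 := h1.mul_const (k z)
    refine h2.congr_deriv ?_
    simp

lemma ibp {u η : E → ℝ} (hu : ContDiff ℝ 1 u) (hη : ContDiff ℝ 1 η) (hc : HasCompactSupport η) (e : E) :
    ∫ z, inner ℝ (gradient u z) e * η z = - ∫ z, u z * inner ℝ (gradient η z) e := by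
  have cu := cont_grad hu
  have cη := cont_grad hη
  have off : ∀ z ∉ tsupport η, η z = 0 := fun z hz => image_eq_zero_of_notMem_tsupport hz
  have off' : ∀ z ∉ tsupport η, gradient η z = 0 := fun z hz => grad_zero_of_notMem hz
  have := integral_mul_fderiv_eq_neg_fderiv_mul_of_integrable (f := u) (g := η) (v := e) (μ := volume)
    (by simp_rw [← inner_grad]
        exact integrable_of_tsupport hc ((cu.inner continuous_const).mul hη.continuous).continuousOn
          (fun z hz => by simp [off z hz]))
    (by simp_rw [← inner_grad]
        exact integrable_of_tsupport hc (hu.continuous.mul (cη.inner continuous_const)).continuousOn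
          (fun z hz => by simp [off' z hz]))
    (integrable_of_tsupport hc (hu.continuous.mul hη.continuous).continuousOn
          (fun z hz => by simp [off z hz]))
    (fun x _ => hu.differentiable one_ne_zero x) (fun x _ => hη.differentiable one_ne_zero x)
  simp_rw [← inner_grad] at this
  linarith

variable {L : ℝ} {A0 B : E →L[ℝ] E}

lemma Ker.keta_zero (h : Ker L A0 B) {z : E} (hz : L ^ 2 ≤ ‖z‖) : keta B z = 0 := by
  rw [keta, h.kp_zero hz]; norm_num

lemma Ker.kpsi_zero (h : Ker L A0 B) (e : E) {z : E} (hz : L ^ 2 ≤ ‖z‖) : kpsi B e z = 0 := by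
  rw [kpsi, h.keta_zero hz]; norm_num

lemma Ker.gpsi_zero (h : Ker L A0 B) (e : E) {z : E} (hz : L ^ 2 ≤ ‖z‖) : gpsi B e z = 0 := by
  rw [gpsi, h.keta_zero hz, h.kp_zero hz]; simp

lemma supp_of_zero {f : E → ℝ} {R : ℝ} (h : ∀ z, R ≤ ‖z‖ → f z = 0) :
    HasCompactSupport f ∧ tsupport f ⊆ closedBall 0 R := by
  have s : tsupport f ⊆ closedBall 0 R := by
    refine closure_minimal ?_ isClosed_closedBall
    intro z hz
    by_contra hh
    exact hz (h z (by simp at hh; exact hh.le))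
  exact ⟨(isCompact_closedBall (0:E) R).of_isClosed_subset (isClosed_tsupport _) s, s⟩

lemma Ker.kpsi_le (h : Ker L A0 B) (e z : E) : |kpsi B e z| ≤ L ^ 3 * ‖e‖ := by
  have hL := h.one_le
  rcases le_total (L^2) ‖z‖ with hz | hz
  · rw [h.kpsi_zero e hz]; simp; positivity
  · have k0 := kp_nonneg B z
    have k1 := h.kp_le z
    rw [kpsi, abs_neg, abs_mul, keta, abs_of_nonneg (by positivity)]
    have := h.nBz z
    calc kp B z ^ 2 * |inner ℝ (B z) e| ≤ 1 * (‖B z‖ * ‖e‖) := by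
          apply mul_le_mul (pow_le_one₀ k0 k1) (abs_real_inner_le_norm _ _) (abs_nonneg _) zero_le_one
      _ ≤ 1 * (L * L ^ 2 * ‖e‖) := by gcongr; exact this.trans (by gcongr)
      _ = _ := by ring

lemma Ker.gpsi_le (h : Ker L A0 B) (e z : E) : ‖gpsi B e z‖ ≤ 5 * L ^ 6 * ‖e‖ := by
  have hL := h.one_le
  rcases le_total (L^2) ‖z‖ with hz | hz
  · rw [h.gpsi_zero e hz]; simp; positivity
  · have k0 := kp_nonneg B z
    have k1 := h.kp_le z
    have b1 : ‖B z‖ ≤ L ^ 3 := (h.nBz z).trans (by rw [show L ^ 3 = L * L ^ 2 by ring]; gcongr)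
    have b2 := h.nBz e
    rw [gpsi]
    refine (norm_sub_le _ _).trans ?_
    rw [norm_smul, norm_smul, Real.norm_eq_abs, Real.norm_eq_abs, keta, abs_mul, abs_mul, abs_of_nonneg k0,
      abs_of_nonneg (by positivity : 0 ≤ kp B z ^ 2), abs_of_pos (by norm_num : (0:ℝ) < 4)]
    have a1 : 4 * kp B z * |inner ℝ (B z) e| * ‖B z‖ ≤ 4 * 1 * (L ^ 3 * ‖e‖) * L ^ 3 := by
      gcongr
      exact (abs_real_inner_le_norm _ _).trans (by gcongr)
    have a2 : kp B z ^ 2 * ‖B e‖ ≤ 1 * (L * ‖e‖) := by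
      apply mul_le_mul (pow_le_one₀ k0 k1) b2 (norm_nonneg _) zero_le_one
    have a3 : L * ‖e‖ ≤ L ^ 6 * ‖e‖ := by gcongr; exact le_self_pow₀ hL (by norm_num)
    nlinarith

lemma Ker.A_gpsi (h : Ker L A0 B) (e z : E) :
    A0 (gpsi B e z) = - (keta B z • e + (inner ℝ (gradient (keta B) z) e) • z) := by
  rw [gpsi, map_sub, map_smul, map_smul, h.inv, h.inv, h.grad_keta, inner_smul_left]
  simp only [RCLike.conj_to_real]
  module

/-- the constant in the gradient representation -/
noncomputable def gC (E : Type*) [NormedAddCommGroup E] [InnerProductSpace ℝ E] [FiniteDimensional ℝ E]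
  [MeasurableSpace E] [BorelSpace E] (L : ℝ) : ℝ := 5 * L ^ 8 * volume.real (closedBall (0:E) (L ^ 2))

lemma Sol.grad_rep {Ω : Set E} {S : ℝ} {A : E → E →L[ℝ] E} {u G : E → ℝ} (h : Sol Ω L S A u G)
    (hΩ : closedBall 0 (L ^ 2) ⊆ Ω) (K : Ker L (A 0) B) {P Λ : ℝ} (hΛ : 0 ≤ Λ)
    (hP : ∀ x ∈ closedBall (0:E) (L ^ 2), ‖gradient u x‖ ≤ P)
    (hA : ∀ x ∈ closedBall (0:E) (L ^ 2), ‖A x - A 0‖ ≤ Λ * ‖x‖) (e : E) :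
    |(∫ z, keta B z) * inner ℝ (gradient u 0) e + ∫ z, u z * inner ℝ (gradient (keta B) z) e| ≤
      gC E L * (Λ * P + P ^ 2 + S) * ‖e‖ := by
  have hL := h.oL
  have S0 := h.S0
  have L0 : 0 ≤ L ^ 2 := by positivity
  have P0 : 0 ≤ P := (norm_nonneg _).trans (hP 0 (by simpa using L0))
  have cu := cont_grad h.cd
  have cη := K.contDiff_keta
  have cgη := cont_grad cη
  have ckη := continuous_keta B
  obtain ⟨sη, tη⟩ := supp_of_zero (fun z hz => K.keta_zero hz)
  obtain ⟨sψ, tψ⟩ := supp_of_zero (fun z hz => K.kpsi_zero e hz)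
  set J : ℝ → ℝ := fun s => ∫ z, inner ℝ (gradient u (s • z)) e * keta B z with hJ
  set dη : E → ℝ := fun z => inner ℝ (gradient (keta B) z) e with hdη
  have cdη : Continuous dη := cgη.inner continuous_const
  have dη0 : ∀ z, L ^ 2 < ‖z‖ → dη z = 0 := by
    intro z hz
    rw [hdη]; simp only
    rw [grad_zero_of_notMem (fun hh => by have := tη hh; simp at this; linarith)]; simp
  set I : ℝ → ℝ := fun s => ∫ z, u (s • z) * dη z with hI
  have JI : ∀ s : ℝ, s * J s = - I s := by
    intro s
    have hus : ContDiff ℝ 1 (fun z => u (0 + s • z)) := h.cd.comp (by fun_prop)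
    have := ibp hus cη sη e
    simp only [grad_scale h.cd] at this
    simp only [zero_add] at this
    rw [hI, ← this, hJ]
    simp only [inner_smul_left, RCLike.conj_to_real, mul_assoc, integral_const_mul]
  have int : ∀ f : E → ℝ, Continuous f → (∀ z, L ^ 2 < ‖z‖ → f z = 0) → Integrable f := fun f hf h0 =>
    integrable_of_tsupport (isCompact_closedBall (0:E) (L ^ 2)) hf.continuousOn (fun z hz => h0 z (by simpa using hz))
  have ckpsi := (K.contDiff_kpsi e).continuous
  have cgpsi : Continuous (gpsi B e) := by
    have := cont_grad (K.contDiff_kpsi e)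
    rwa [show gradient (kpsi B e) = gpsi B e from funext (K.grad_kpsi e)] at this
  -- derivative of J
  have dJ : ∀ s : ℝ, 0 < s → HasDerivAt J (s⁻¹ * ∫ z, inner ℝ (A 0 (gradient u (s • z))) (gpsi B e z)) s := by
    intro s hs
    have d1 := deriv_avg h.cd cdη L0 dη0 s
    have d2 : HasDerivAt (fun s => - (s⁻¹ * I s)) (-(-(s^2)⁻¹ * I s + s⁻¹ * ∫ z, inner ℝ (gradient u (s • z)) z * dη z)) s :=
      ((hasDerivAt_inv hs.ne').mul d1).neg
    have ev : J =ᶠ[nhds s] fun s => - (s⁻¹ * I s) := by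
      filter_upwards [Ioi_mem_nhds hs] with t ht
      have := JI t
      have t0 : t ≠ 0 := (ne_of_gt ht)
      field_simp
      linarith
    refine (d2.congr_of_eventuallyEq ev).congr_deriv ?_
    have e1 : ∫ z, inner ℝ (A 0 (gradient u (s • z))) (gpsi B e z) =
        - J s - ∫ z, inner ℝ (gradient u (s • z)) z * dη z := by
      rw [hJ, ← integral_neg, ← integral_sub]
      · congr 1; ext z
        rw [K.symA, K.A_gpsi]
        simp only [inner_neg_right, inner_add_right, inner_smul_right, hdη]
        ring
      · refine (int _ (((cu.comp (by fun_prop : Continuous fun z : E => s • z)).inner continuous_const).mul ckη) ?_).neg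
        intro z hz; simp [K.keta_zero hz.le]
      · refine int _ (((cu.comp (by fun_prop : Continuous fun z : E => s • z)).inner continuous_id).mul cdη) ?_
        intro z hz; simp [dη0 z hz]
    rw [e1]
    have := JI s
    have e2 : I s = - (s * J s) := by linarith
    rw [e2]
    field_simp
    ring
  -- bound of the derivative
  set D : ℝ := gC E L * (Λ * P + P ^ 2 + S) * ‖e‖ with hD
  have bJ : ∀ s : ℝ, 0 < s → s ≤ 1 → |s⁻¹ * ∫ z, inner ℝ (A 0 (gradient u (s • z))) (gpsi B e z)| ≤ D := by
    intro s hs hs1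
    have mem : ∀ z ∈ closedBall (0:E) (L ^ 2), s • z ∈ closedBall (0:E) (L ^ 2) := by
      intro z hz
      rw [mem_closedBall_zero_iff] at hz ⊢
      rw [norm_smul, Real.norm_eq_abs, abs_of_pos hs]
      nlinarith [norm_nonneg z]
    have hsc := h.scale (Ω' := closedBall (0:E) (L^2)) 0 hs (fun z hz => by rw [zero_add]; exact hΩ (mem z hz))
    have wk := hsc.weak _ (K.contDiff_kpsi e) sψ tψ
    simp only [zero_add] at wk
    have gs : ∀ z, gradient (fun z => u (s • z)) z = s • gradient u (s • z) := by
      intro z; have := grad_scale h.cd 0 s z; simpa using this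
    simp only [gs, K.grad_kpsi, map_smul, inner_smul_left, RCLike.conj_to_real, integral_const_mul, mul_assoc] at wk
    have wk2 : ∫ z, inner ℝ (A (s • z) (gradient u (s • z))) (gpsi B e z) = ∫ z, s * (G (s • z) * kpsi B e z) := by
      rw [integral_const_mul]
      have : s * (∫ z, inner ℝ (A (s • z) (gradient u (s • z))) (gpsi B e z)) = s * (s * ∫ z, G (s • z) * kpsi B e z) := by
        rw [wk]; ring
      exact mul_left_cancel₀ hs.ne' this
    have cOA : ContinuousOn (fun z => A (s • z)) (closedBall (0:E) (L^2)) :=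
      h.cA.comp (by fun_prop) (fun z hz => hΩ (mem z hz))
    have cOG : ContinuousOn (fun z => G (s • z)) (closedBall (0:E) (L^2)) :=
      h.cG.comp (by fun_prop) (fun z hz => hΩ (mem z hz))
    have cus : Continuous fun z => gradient u (s • z) := cu.comp (by fun_prop)
    have i1 : Integrable (fun z => inner ℝ (A 0 (gradient u (s • z))) (gpsi B e z)) := by
      refine int _ (((A 0).continuous.comp cus).inner cgpsi) ?_
      intro z hz; simp [K.gpsi_zero e hz.le]
    have i2 : Integrable (fun z => inner ℝ (A (s • z) (gradient u (s • z))) (gpsi B e z)) := by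
      refine integrable_of_tsupport (isCompact_closedBall (0:E) (L ^ 2)) ?_ ?_
      · exact (cOA.clm_apply cus.continuousOn).inner cgpsi.continuousOn
      · intro z hz; simp at hz; simp [K.gpsi_zero e hz.le]
    have i3 : Integrable (fun z => s * (G (s • z) * kpsi B e z)) := by
      refine integrable_of_tsupport (isCompact_closedBall (0:E) (L ^ 2)) ?_ ?_
      · exact continuousOn_const.mul (cOG.mul ckpsi.continuousOn)
      · intro z hz; simp at hz; simp [K.kpsi_zero e hz.le]
    have eq : s⁻¹ * ∫ z, inner ℝ (A 0 (gradient u (s • z))) (gpsi B e z) =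
        ∫ z, (s⁻¹ * inner ℝ ((A 0 - A (s • z)) (gradient u (s • z))) (gpsi B e z) + G (s • z) * kpsi B e z) := by
      have : ∫ z, inner ℝ (A 0 (gradient u (s • z))) (gpsi B e z) =
        ∫ z, ((inner ℝ (A 0 (gradient u (s • z))) (gpsi B e z) - inner ℝ (A (s • z) (gradient u (s • z))) (gpsi B e z))
          + s * (G (s • z) * kpsi B e z)) := by
        rw [show (∫ z, ((inner ℝ (A 0 (gradient u (s • z))) (gpsi B e z) - inner ℝ (A (s • z) (gradient u (s • z))) (gpsi B e z))
          + s * (G (s • z) * kpsi B e z))) = _ from integral_add (i1.sub i2) i3, integral_sub i1 i2, wk2]; ring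
      rw [this, ← integral_const_mul]
      congr 1; ext z
      simp only [ContinuousLinearMap.sub_apply, inner_sub_left]
      field_simp
    rw [eq, ← setIntegral_eq_integral_of_forall_compl_eq_zero (s := closedBall (0:E) (L^2)) (by
      intro z hz; simp at hz; simp [K.kpsi_zero e hz.le, K.gpsi_zero e hz.le])]
    have := norm_setIntegral_le_of_norm_le_const (μ := volume) (s := closedBall (0:E) (L^2))
      (f := fun z => s⁻¹ * inner ℝ ((A 0 - A (s • z)) (gradient u (s • z))) (gpsi B e z) + G (s • z) * kpsi B e z)
      (C := 5 * L ^ 8 * (Λ * P + P ^ 2 + S) * ‖e‖) measure_closedBall_lt_top (by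
        intro z hz
        have hz' : ‖z‖ ≤ L ^ 2 := by simpa using hz
        have hg := hP _ (mem z hz)
        have hGz := h.G_le _ (hΩ (mem z hz))
        have hAz := hA _ (mem z hz)
        rw [norm_sub_rev, norm_smul, Real.norm_eq_abs, abs_of_pos hs] at hAz
        have hk := K.kpsi_le e z
        have hgp := K.gpsi_le e z
        rw [Real.norm_eq_abs]
        refine (abs_add_le _ _).trans ?_
        rw [abs_mul, abs_mul, abs_of_pos (by positivity : 0 < s⁻¹)]
        have a1 : s⁻¹ * |inner ℝ ((A 0 - A (s • z)) (gradient u (s • z))) (gpsi B e z)| ≤ 5 * L ^ 8 * (Λ * P) * ‖e‖ := by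
          calc s⁻¹ * |inner ℝ ((A 0 - A (s • z)) (gradient u (s • z))) (gpsi B e z)|
              ≤ s⁻¹ * (‖A 0 - A (s • z)‖ * ‖gradient u (s • z)‖ * ‖gpsi B e z‖) := by
                gcongr
                refine (abs_real_inner_le_norm _ _).trans ?_
                gcongr
                exact ContinuousLinearMap.le_opNorm _ _
            _ ≤ s⁻¹ * ((Λ * (s * L ^ 2)) * P * (5 * L ^ 6 * ‖e‖)) := by
                gcongr
                exact hAz.trans (by gcongr)
            _ = _ := by field_simp
        have a2 : |G (s • z)| * |kpsi B e z| ≤ (2 * P ^ 2 + S) * (L ^ 3 * ‖e‖) := by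
          gcongr
          refine hGz.trans (by gcongr)
        have a3 : (2 * P ^ 2 + S) * (L ^ 3 * ‖e‖) ≤ (5 * (P ^ 2 + S)) * (L ^ 8 * ‖e‖) := by
          have : L ^ 3 ≤ L ^ 8 := pow_le_pow_right₀ hL (by norm_num)
          gcongr
          nlinarith [sq_nonneg P]
        calc _ ≤ 5 * L ^ 8 * (Λ * P) * ‖e‖ + (5 * (P ^ 2 + S)) * (L ^ 8 * ‖e‖) := add_le_add a1 (a2.trans a3)
          _ = _ := by ring)
    rw [Real.norm_eq_abs] at this
    refine this.trans (le_of_eq ?_)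
    rw [hD, gC]; ring
  -- continuity of J
  have cJ : Continuous J := by
    have := continuous_parametric_integral_of_continuous (μ := (volume : Measure E)) (X := ℝ)
      (f := fun s z => inner ℝ (gradient u (s • z)) e * keta B z) (by
        have : Continuous fun p : ℝ × E => gradient u (p.1 • p.2) := cu.comp (by fun_prop)
        simp only [Function.uncurry_def]
        exact (this.inner continuous_const).mul (ckη.comp continuous_snd)) (isCompact_closedBall (0:E) (L ^ 2))
    refine this.congr ?_
    intro s
    apply setIntegral_eq_integral_of_forall_compl_eq_zero
    intro z hz; simp at hz; simp [K.keta_zero hz.le]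
  have J0 : J 0 = (∫ z, keta B z) * inner ℝ (gradient u 0) e := by
    simp only [hJ, zero_smul, integral_const_mul]; ring
  have J1 : J 1 = - ∫ z, u z * dη z := by
    have := JI 1
    simp only [hI, one_mul, one_smul] at this
    exact this
  have fin : |J 1 - J 0| ≤ D := by
    have D0 : 0 ≤ D := (abs_nonneg _).trans (bJ 1 one_pos le_rfl)
    have ev : ∀ ε ∈ Ioo (0:ℝ) 1, |J 1 - J ε| ≤ D := by
      intro ε hε
      have := Convex.norm_image_sub_le_of_norm_hasDerivWithin_le (s := Ioc (0:ℝ) 1) (C := D)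
        (fun s hs => (dJ s hs.1).hasDerivWithinAt) (fun s hs => bJ s hs.1 hs.2) (convex_Ioc 0 1)
        (x := ε) (y := 1) ⟨hε.1, hε.2.le⟩ ⟨one_pos, le_rfl⟩
      rw [Real.norm_eq_abs, Real.norm_eq_abs, abs_of_pos (by linarith [hε.2] : (0:ℝ) < 1 - ε)] at this
      refine this.trans ?_
      nlinarith [hε.1]
    have t : Filter.Tendsto (fun ε => |J 1 - J ε|) (nhdsWithin 0 (Ioi 0)) (nhds |J 1 - J 0|) :=
      ((continuous_const.sub cJ).abs.tendsto 0).mono_left nhdsWithin_le_nhds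
    refine le_of_tendsto t ?_
    filter_upwards [Ioo_mem_nhdsGT (zero_lt_one (α := ℝ))] with ε hε using ev ε hε
  rw [J0, J1] at fin
  rw [abs_sub_comm] at fin
  rwa [sub_neg_eq_add] at fin

end GradSec


section Grad2Sec
variable {E : Type*} [NormedAddCommGroup E] [InnerProductSpace ℝ E] [FiniteDimensional ℝ E]
  [MeasurableSpace E] [BorelSpace E] {L : ℝ} {A0 B : E →L[ℝ] E}

lemma lip_of_grad {u : E → ℝ} (hu : ContDiff ℝ 1 u) {s : Set E} (hs : Convex ℝ s) {P : ℝ}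
    (hP : ∀ x ∈ s, ‖gradient u x‖ ≤ P) {x y : E} (hx : x ∈ s) (hy : y ∈ s) : |u x - u y| ≤ P * ‖x - y‖ := by
  have := hs.norm_image_sub_le_of_norm_fderiv_le (𝕜 := ℝ) (f := u)
    (fun z _ => hu.differentiable one_ne_zero z) (fun z hz => by rw [← norm_grad]; exact hP z hz) hy hx
  simpa using this

lemma Sol.grad_rep_scaled {Ω : Set E} {S : ℝ} {A : E → E →L[ℝ] E} {u G : E → ℝ} (h : Sol Ω L S A u G)
    {Λ : ℝ} (hΛ : 0 ≤ Λ) (hlip : ∀ x ∈ Ω, ∀ y ∈ Ω, ‖A x - A y‖ ≤ Λ * (‖x - y‖ + |u x - u y|))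
    {x0 : E} {σ : ℝ} (hσ : 0 < σ)
    (hΩ : closedBall x0 (σ * L ^ 2) ⊆ Ω) (K : Ker L (A x0) B) {P : ℝ}
    (hP : ∀ x ∈ closedBall x0 (σ * L ^ 2), ‖gradient u x‖ ≤ P) (e : E) :
    |(∫ z, keta B z) * (σ * inner ℝ (gradient u x0) e) + ∫ z, u (x0 + σ • z) * inner ℝ (gradient (keta B) z) e| ≤
      gC E L * (σ ^ 2 * (Λ * (1 + P) * P + P ^ 2 + S)) * ‖e‖ := by
  have hL := h.oL
  have L0 : 0 ≤ σ * L ^ 2 := by positivity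
  have P0 : 0 ≤ P := (norm_nonneg _).trans (hP x0 (mem_closedBall_self L0))
  have mem : ∀ z ∈ closedBall (0:E) (L ^ 2), x0 + σ • z ∈ closedBall x0 (σ * L ^ 2) := by
    intro z hz
    rw [mem_closedBall_zero_iff] at hz
    rw [mem_closedBall_iff_norm, add_sub_cancel_left, norm_smul, Real.norm_eq_abs, abs_of_pos hσ]
    gcongr
  have hsc := h.scale (Ω' := closedBall (0:E) (L^2)) x0 hσ (fun z hz => hΩ (mem z hz))
  have key := hsc.grad_rep (B := B) subset_rfl (by simpa using K) (P := σ * P) (Λ := σ * (Λ * (1 + P)))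
    (by positivity) (by
      intro z hz
      rw [grad_scale h.cd, norm_smul, Real.norm_eq_abs, abs_of_pos hσ]
      have := hP _ (mem z hz)
      gcongr) (by
      intro z hz
      have m0 := mem_closedBall_self (x := x0) L0
      have h1 := hlip _ (hΩ (mem z hz)) x0 (hΩ m0)
      have h2 := lip_of_grad h.cd (convex_closedBall x0 (σ * L ^ 2)) hP (mem z hz) m0
      rw [add_sub_cancel_left, norm_smul, Real.norm_eq_abs, abs_of_pos hσ] at h1 h2
      simp only [smul_zero, add_zero]
      calc _ ≤ _ := h1
        _ ≤ Λ * (σ * ‖z‖ + P * (σ * ‖z‖)) := by gcongr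
        _ = _ := by ring) e
  rw [grad_scale h.cd] at key
  simp only [smul_zero, add_zero, inner_smul_left, RCLike.conj_to_real] at key
  refine key.trans (le_of_eq ?_)
  ring

/-- volume of the support -/
noncomputable def vC (E : Type*) [NormedAddCommGroup E] [InnerProductSpace ℝ E] [FiniteDimensional ℝ E]
  [MeasurableSpace E] [BorelSpace E] (L : ℝ) : ℝ := volume.real (closedBall (0:E) (L ^ 2))

/-- lower mass bound -/
noncomputable def cLo (E : Type*) [NormedAddCommGroup E] [InnerProductSpace ℝ E] [FiniteDimensional ℝ E]
  [MeasurableSpace E] [BorelSpace E] (L : ℝ) : ℝ := 9 / 16 * volume.real (closedBall (0:E) (1 / (2 * L)))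

lemma vC_nonneg (L : ℝ) : 0 ≤ vC E L := measureReal_nonneg
lemma gC_nonneg {L : ℝ} (hL : 1 ≤ L) : 0 ≤ gC E L := by
  have : 0 ≤ volume.real (closedBall (0:E) (L ^ 2)) := measureReal_nonneg
  unfold gC; positivity

lemma cLo_pos {L : ℝ} (hL : 1 ≤ L) : 0 < cLo E L := by
  have : 0 < volume (closedBall (0:E) (1 / (2 * L))) := measure_closedBall_pos _ _ (by positivity)
  have : 0 < volume.real (closedBall (0:E) (1 / (2 * L))) :=
    ENNReal.toReal_pos this.ne' measure_closedBall_lt_top.ne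
  unfold cLo; positivity

lemma Ker.int_keta (h : Ker L A0 B) : Integrable (keta B) :=
  (continuous_keta B).integrable_of_hasCompactSupport (supp_of_zero fun z hz => h.keta_zero hz).1

lemma keta_nonneg (B : E →L[ℝ] E) (z : E) : 0 ≤ keta B z := sq_nonneg _

lemma Ker.mass_low (h : Ker L A0 B) : cLo E L ≤ ∫ z, keta B z := by
  have hL := h.one_le
  calc cLo E L = ∫ z in closedBall (0:E) (1 / (2 * L)), (9/16 : ℝ) := by
        rw [setIntegral_const, smul_eq_mul, cLo, mul_comm]
    _ ≤ ∫ z in closedBall (0:E) (1 / (2 * L)), keta B z := by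
        refine setIntegral_mono_on (integrableOn_const measure_closedBall_lt_top.ne) h.int_keta.integrableOn
          measurableSet_closedBall ?_
        intro z hz
        have := h.kp_low (by simpa using hz)
        unfold keta; nlinarith
    _ ≤ _ := setIntegral_le_integral h.int_keta (Filter.Eventually.of_forall fun z => keta_nonneg B z)

lemma Ker.grad_keta_le (h : Ker L A0 B) (z : E) : ‖gradient (keta B) z‖ ≤ 4 * L ^ 3 := by
  have hL := h.one_le
  rw [h.grad_keta]
  rcases le_total (L^2) ‖z‖ with hz | hz
  · rw [h.kp_zero hz]; simp; positivity
  · have k0 := kp_nonneg B z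
    have k1 := h.kp_le z
    have b1 : ‖B z‖ ≤ L ^ 3 := (h.nBz z).trans (by rw [show L ^ 3 = L * L ^ 2 by ring]; gcongr)
    rw [norm_smul, Real.norm_eq_abs, abs_mul, abs_of_nonneg k0]
    norm_num
    calc 4 * kp B z * ‖B z‖ ≤ 4 * 1 * L ^ 3 := by gcongr
      _ = _ := by ring

lemma Ker.grad_keta_zero (h : Ker L A0 B) {z : E} (hz : L ^ 2 ≤ ‖z‖) : gradient (keta B) z = 0 := by
  rw [h.grad_keta, h.kp_zero hz]; simp

lemma Ker.int_gk (h : Ker L A0 B) {f : E → ℝ} (hf : Continuous f) (e : E) :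
    Integrable (fun z => f z * inner ℝ (gradient (keta B) z) e) := by
  refine integrable_of_tsupport (isCompact_closedBall (0:E) (L ^ 2))
    (hf.mul ((cont_grad h.contDiff_keta).inner continuous_const)).continuousOn ?_
  intro z hz; simp at hz; simp [h.grad_keta_zero hz.le]

/-- integrating against the derivative kernel sees only the oscillation -/
lemma Ker.osc_int (h : Ker L A0 B) {f : E → ℝ} (hf : Continuous f) {m ε : ℝ}
    (hm : ∀ z ∈ closedBall (0:E) (L ^ 2), |f z - m| ≤ ε) (e : E) :
    |∫ z, f z * inner ℝ (gradient (keta B) z) e| ≤ ε * (4 * L ^ 3) * ‖e‖ * vC E L := by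
  have hL := h.one_le
  have e0 : 0 ≤ ε := (abs_nonneg _).trans (hm 0 (by simp; positivity))
  have z0 : ∫ z, m * inner ℝ (gradient (keta B) z) e = 0 := by
    have := ibp (u := fun _ : E => m) contDiff_const h.contDiff_keta (supp_of_zero fun z hz => h.keta_zero hz).1 e
    have g0 : ∀ z : E, gradient (fun _ : E => m) z = 0 := by intro z; simp [gradient]
    simp only [g0, inner_zero_left, zero_mul, integral_zero] at this
    linarith
  have : ∫ z, f z * inner ℝ (gradient (keta B) z) e = ∫ z, (f z - m) * inner ℝ (gradient (keta B) z) e := by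
    simp_rw [sub_mul]
    rw [integral_sub (h.int_gk hf e) (h.int_gk continuous_const e), z0, sub_zero]
  rw [this, ← setIntegral_eq_integral_of_forall_compl_eq_zero (s := closedBall (0:E) (L^2)) (by
      intro z hz; simp at hz; simp [h.grad_keta_zero hz.le])]
  rw [← Real.norm_eq_abs, vC]
  refine norm_setIntegral_le_of_norm_le_const (μ := (volume : Measure E)) measure_closedBall_lt_top ?_
  intro z hz
  rw [norm_mul, Real.norm_eq_abs, Real.norm_eq_abs]
  have := hm z hz
  have h2 := h.grad_keta_le z
  calc |f z - m| * |inner ℝ (gradient (keta B) z) e| ≤ ε * (4 * L ^ 3 * ‖e‖) := by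
        gcongr
        exact (abs_real_inner_le_norm _ _).trans (by gcongr)
    _ = _ := by ring

/-- one-scale gradient estimate -/
lemma Sol.grad_est {Ω : Set E} {S : ℝ} {A : E → E →L[ℝ] E} {u G : E → ℝ} (h : Sol Ω L S A u G)
    {Λ : ℝ} (hΛ : 0 ≤ Λ) (hlip : ∀ x ∈ Ω, ∀ y ∈ Ω, ‖A x - A y‖ ≤ Λ * (‖x - y‖ + |u x - u y|))
    {x0 : E} {σ : ℝ} (hσ : 0 < σ)
    (hΩ : closedBall x0 (σ * L ^ 2) ⊆ Ω) {P : ℝ}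
    (hP : ∀ x ∈ closedBall x0 (σ * L ^ 2), ‖gradient u x‖ ≤ P) {m ε : ℝ}
    (hm : ∀ x ∈ closedBall x0 (σ * L ^ 2), |u x - m| ≤ ε) :
    ‖gradient u x0‖ ≤ (4 * L ^ 3 * vC E L + gC E L) / cLo E L * (ε / σ + σ * (Λ * (1 + P) * P + P ^ 2 + S)) := by
  have hL := h.oL
  have L0 : 0 ≤ σ * L ^ 2 := by positivity
  have m0 := hΩ (mem_closedBall_self (x := x0) L0)
  obtain ⟨B, K⟩ := exists_ker L hL (A x0) (h.sym x0 m0) (h.coer x0 m0) (h.nA x0 m0)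
  have P0 : 0 ≤ P := (norm_nonneg _).trans (hP x0 (mem_closedBall_self L0))
  have e0 : 0 ≤ ε := (abs_nonneg _).trans (hm x0 (mem_closedBall_self L0))
  have S0 := h.S0
  have c0 : 0 < cLo E L := cLo_pos hL
  have cB := K.mass_low
  have v0 := vC_nonneg (E := E) L
  have g0 := gC_nonneg (E := E) hL
  set X := ‖gradient u x0‖ with hX
  have X0 : 0 ≤ X := norm_nonneg _
  have r1 := h.grad_rep_scaled hΛ hlip hσ hΩ K hP (gradient u x0)
  have r2 := K.osc_int (f := fun z => u (x0 + σ • z)) (h.cd.continuous.comp (by fun_prop)) (m := m) (ε := ε) (by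
    intro z hz
    apply hm
    rw [mem_closedBall_zero_iff] at hz
    rw [mem_closedBall_iff_norm, add_sub_cancel_left, norm_smul, Real.norm_eq_abs, abs_of_pos hσ]
    gcongr) (gradient u x0)
  rw [real_inner_self_eq_norm_sq, ← hX] at r1
  rw [← hX] at r2
  set Q := Λ * (1 + P) * P + P ^ 2 + S with hQ
  have Q0 : 0 ≤ Q := by positivity
  have r3 : (∫ z, keta B z) * (σ * X ^ 2) ≤ gC E L * (σ ^ 2 * Q) * X + ε * (4 * L ^ 3) * X * vC E L := by
    have := abs_le.1 r1
    have := abs_le.1 r2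
    linarith [this.1, this.2]
  have r4 : cLo E L * (σ * X ^ 2) ≤ (∫ z, keta B z) * (σ * X ^ 2) := by gcongr
  rcases X0.eq_or_lt with hx | hx
  · rw [← hx]; positivity
  have r5 : cLo E L * (σ * X) ≤ gC E L * (σ ^ 2 * Q) + ε * (4 * L ^ 3) * vC E L := by
    have : X * (cLo E L * (σ * X)) ≤ X * (gC E L * (σ ^ 2 * Q) + ε * (4 * L ^ 3) * vC E L) := by nlinarith
    exact le_of_mul_le_mul_left this hx
  have r6 : gC E L * (σ ^ 2 * Q) + ε * (4 * L ^ 3) * vC E L ≤ (4 * L ^ 3 * vC E L + gC E L) * (ε + σ ^ 2 * Q) := by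
    have a : 0 ≤ gC E L * ε := by positivity
    have b : 0 ≤ 4 * L ^ 3 * vC E L * (σ ^ 2 * Q) := by positivity
    nlinarith
  have r7 : X * (cLo E L * σ) ≤ (4 * L ^ 3 * vC E L + gC E L) * (ε + σ ^ 2 * Q) := by linarith
  have r8 := (le_div_iff₀ (by positivity)).2 r7
  refine r8.trans (le_of_eq ?_)
  field_simp

/-- gradient bound from small oscillation -/
lemma exists_grad_bound (E : Type*) [NormedAddCommGroup E] [InnerProductSpace ℝ E] [FiniteDimensional ℝ E]
    [MeasurableSpace E] [BorelSpace E] (L : ℝ) (hL : 1 ≤ L) (Λ : ℝ) (hΛ : 0 ≤ Λ) :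
    ∃ ε C : ℝ, 0 < ε ∧ 0 ≤ C ∧ ∀ (Ω : Set E) (S : ℝ) (A : E → E →L[ℝ] E) (u G : E → ℝ), Sol Ω L S A u G →
      (∀ x ∈ Ω, ∀ y ∈ Ω, ‖A x - A y‖ ≤ Λ * (‖x - y‖ + |u x - u y|)) →
      ∀ x0 r, 0 < r → closedBall x0 r ⊆ Ω → ∀ m, (∀ x ∈ closedBall x0 r, |u x - m| ≤ ε) →
      ‖gradient u x0‖ ≤ 1 + S + C / r := by
  set C1 : ℝ := (4 * L ^ 3 * vC E L + gC E L) / cLo E L + 1 with hC1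
  have v0 := vC_nonneg (E := E) L
  have g0 := gC_nonneg (E := E) hL
  have c0 : 0 < cLo E L := cLo_pos hL
  have C1p : 1 ≤ C1 := by
    have : 0 ≤ (4 * L ^ 3 * vC E L + gC E L) / cLo E L := by positivity
    linarith
  set C3 : ℝ := 6 * Λ + 5 with hC3
  have C3p : 0 < C3 := by positivity
  set ε : ℝ := 1 / (8 * C1 ^ 2 * C3) with hε
  have ε0 : 0 < ε := by positivity
  refine ⟨ε, 3 * C1 * ε * L ^ 2, ε0, by positivity, ?_⟩
  intro Ω S A u G h hlip x0 r r0 hΩ m hm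
  have S0 := h.S0
  have cg := cont_grad h.cd
  obtain ⟨x1, hx1, hmax⟩ := (isCompact_closedBall x0 r).exists_isMaxOn ⟨x0, mem_closedBall_self r0.le⟩
    (f := fun x => (r - ‖x - x0‖) * ‖gradient u x‖) (by fun_prop)
  set d := r - ‖x1 - x0‖ with hd
  set X := ‖gradient u x1‖ with hX
  have X0 : 0 ≤ X := norm_nonneg _
  have dr : d ≤ r := by have := norm_nonneg (x1 - x0); linarith
  have d0' : 0 ≤ d := by rw [mem_closedBall_iff_norm] at hx1; linarith
  have main0 : r * ‖gradient u x0‖ ≤ d * X := by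
    have := hmax (mem_closedBall_self (x := x0) r0.le)
    simpa using this
  suffices hs : d * X ≤ r * (1 + S) + 3 * C1 * ε * L ^ 2 by
    have : r * ‖gradient u x0‖ ≤ r * (1 + S + 3 * C1 * ε * L ^ 2 / r) := by
      refine main0.trans (hs.trans (le_of_eq ?_))
      field_simp
    exact le_of_mul_le_mul_left this r0
  have C0 : 0 ≤ 3 * C1 * ε * L ^ 2 := by positivity
  rcases d0'.eq_or_lt with hd0 | hd0
  · rw [← hd0]; rw [zero_mul]; positivity
  rcases le_or_gt X (1 + S) with hXs | hXs
  · have : d * X ≤ r * (1 + S) := by gcongr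
    linarith
  have X1 : 1 ≤ X := by linarith
  have hP : ∀ x ∈ closedBall x1 (d/2), x ∈ closedBall x0 r ∧ ‖gradient u x‖ ≤ 2 * X := by
    intro x hx
    rw [mem_closedBall_iff_norm] at hx
    have t : ‖x - x0‖ ≤ ‖x - x1‖ + ‖x1 - x0‖ := norm_sub_le_norm_sub_add_norm_sub _ _ _
    have mx : x ∈ closedBall x0 r := by rw [mem_closedBall_iff_norm]; linarith
    refine ⟨mx, ?_⟩
    have h1 : (r - ‖x - x0‖) * ‖gradient u x‖ ≤ d * X := hmax mx
    have h2 : d / 2 * ‖gradient u x‖ ≤ d / 2 * (2 * X) := by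
      have : d / 2 * ‖gradient u x‖ ≤ (r - ‖x - x0‖) * ‖gradient u x‖ := by
        gcongr; linarith
      linarith
    exact le_of_mul_le_mul_left h2 (by positivity)
  have est : ∀ σ : ℝ, 0 < σ → σ * L ^ 2 ≤ d / 2 → X ≤ C1 * (ε / σ + σ * (C3 * X ^ 2)) := by
    intro σ hσ hs
    have sub : closedBall x1 (σ * L ^ 2) ⊆ closedBall x1 (d/2) := closedBall_subset_closedBall hs
    have := h.grad_est hΛ hlip (x0 := x1) hσ (fun x hx => hΩ (hP x (sub hx)).1) (P := 2 * X)
      (fun x hx => (hP x (sub hx)).2) (m := m) (ε := ε) (fun x hx => hm x (hP x (sub hx)).1)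
    have q : Λ * (1 + 2 * X) * (2 * X) + (2 * X) ^ 2 + S ≤ C3 * X ^ 2 := by
      have a : X ≤ X ^ 2 := by nlinarith
      have b : Λ * X ≤ Λ * X ^ 2 := by gcongr
      have c : S ≤ X ^ 2 := by nlinarith
      rw [hC3]; nlinarith
    have q0 : 0 ≤ Λ * (1 + 2 * X) * (2 * X) + (2 * X) ^ 2 + S := by positivity
    calc X ≤ _ := this
      _ ≤ C1 * (ε / σ + σ * (C3 * X ^ 2)) := by
        gcongr
        linarith
  set mm : ℝ := 1 / (4 * C1 * C3) with hmm
  have mm0 : 0 < mm := by positivity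
  have Xp : 0 < X := by linarith
  rcases le_total (mm / X * L ^ 2) (d / 2) with hc | hc
  · exfalso
    have := est (mm / X) (by positivity) hc
    have e1 : C1 * (ε / (mm / X) + mm / X * (C3 * X ^ 2)) = (3/4) * X := by
      rw [hε, hmm]; field_simp; norm_num
    linarith
  · have := est (d / (2 * L ^ 2)) (by positivity) (le_of_eq (by field_simp))
    have e1 : d / (2 * L ^ 2) ≤ mm / X := by
      rw [div_le_iff₀ (by positivity)]; linarith
    have e2 : C1 * (d / (2 * L ^ 2) * (C3 * X ^ 2)) ≤ X / 4 := by
      calc C1 * (d / (2 * L ^ 2) * (C3 * X ^ 2)) ≤ C1 * (mm / X * (C3 * X ^ 2)) := by gcongr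
        _ = X / 4 := by rw [hmm]; field_simp
    have e3 : C1 * (ε / (d / (2 * L ^ 2))) = 2 * C1 * ε * L ^ 2 / d := by field_simp
    have e4 : X * (3/4) ≤ 2 * C1 * ε * L ^ 2 / d := by linarith
    rw [le_div_iff₀ hd0] at e4
    have : 0 ≤ r * (1 + S) := by positivity
    nlinarith

end Grad2Sec


section HolSec
variable {E : Type*} [NormedAddCommGroup E] [InnerProductSpace ℝ E] [FiniteDimensional ℝ E]
  [MeasurableSpace E] [BorelSpace E] {L : ℝ} {A0 B A0' B' : E →L[ℝ] E}

lemma Ker.keta_sub (h : Ker L A0 B) (h' : Ker L A0' B') (z : E) :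
    |keta B z - keta B' z| ≤ 2 * L ^ 6 * ‖A0 - A0'‖ := by
  have hL := h.one_le
  rcases le_total (L^2) ‖z‖ with hz | hz
  · rw [h.keta_zero hz, h'.keta_zero hz]; simp; positivity
  have k0 := kp_nonneg B z
  have k1 := h.kp_le z
  have k0' := kp_nonneg B' z
  have k1' := h'.kp_le z
  have e1 : B z - B' z = B ((A0' - A0) (B' z)) := by
    simp only [ContinuousLinearMap.sub_apply, map_sub, h'.inv, h.inv']
  have n1 : ‖B z - B' z‖ ≤ L * (‖A0 - A0'‖ * (L * L ^ 2)) := by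
    rw [e1]
    refine (h.nBz _).trans ?_
    gcongr
    refine (ContinuousLinearMap.le_opNorm _ _).trans ?_
    rw [norm_sub_rev]
    gcongr
    exact (h'.nBz z).trans (by gcongr)
  have n2 : |qf B z - qf B' z| ≤ L ^ 6 * ‖A0 - A0'‖ := by
    have : qf B z - qf B' z = inner ℝ (B z - B' z) z := by simp [qf, inner_sub_left]
    rw [this]
    refine (abs_real_inner_le_norm _ _).trans ?_
    calc ‖B z - B' z‖ * ‖z‖ ≤ L * (‖A0 - A0'‖ * (L * L ^ 2)) * L ^ 2 := by gcongr
      _ = L ^ 6 * ‖A0 - A0'‖ := by ring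
  have n3 : |kp B z - kp B' z| ≤ L ^ 6 * ‖A0 - A0'‖ := by
    refine le_trans ?_ n2
    unfold kp
    refine (abs_max_sub_max_le_max _ _ _ _).trans ?_
    simp only [sub_self, abs_zero]
    rw [max_eq_left (abs_nonneg _), show 1 - qf B z - (1 - qf B' z) = -(qf B z - qf B' z) by ring, abs_neg]
  have : keta B z - keta B' z = (kp B z + kp B' z) * (kp B z - kp B' z) := by unfold keta; ring
  rw [this, abs_mul, abs_of_nonneg (by positivity)]
  calc (kp B z + kp B' z) * |kp B z - kp B' z| ≤ (1 + 1) * (L ^ 6 * ‖A0 - A0'‖) := by gcongr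
    _ = _ := by ring

lemma Ker.int_sub_le (h : Ker L A0 B) (h' : Ker L A0' B') {f : E → ℝ} (hf : Continuous f) {M : ℝ}
    (hM : ∀ z ∈ closedBall (0:E) (L ^ 2), |f z| ≤ M) :
    |(∫ z, f z * keta B z) - ∫ z, f z * keta B' z| ≤ M * (2 * L ^ 6 * ‖A0 - A0'‖) * vC E L := by
  have hL := h.one_le
  have int : ∀ {A0 B : E →L[ℝ] E}, Ker L A0 B → Integrable (fun z => f z * keta B z) := fun {A0 B} hh =>
    integrable_of_tsupport (isCompact_closedBall (0:E) (L ^ 2)) (hf.mul (continuous_keta B)).continuousOn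
    (fun z hz => by simp at hz; simp [hh.keta_zero hz.le])
  rw [← integral_sub (int h) (int h'), ← setIntegral_eq_integral_of_forall_compl_eq_zero (s := closedBall (0:E) (L^2)) (by
      intro z hz; simp at hz; simp [h.keta_zero hz.le, h'.keta_zero hz.le])]
  rw [← Real.norm_eq_abs, vC]
  refine norm_setIntegral_le_of_norm_le_const (μ := (volume : Measure E)) measure_closedBall_lt_top ?_
  intro z hz
  rw [← mul_sub, norm_mul, Real.norm_eq_abs, Real.norm_eq_abs]
  have := hM z hz
  have h2 := h.keta_sub h' z
  have : 0 ≤ M := (abs_nonneg _).trans this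
  gcongr

lemma Sol.holder {Ω : Set E} {S : ℝ} {A : E → E →L[ℝ] E} {u G : E → ℝ} (h : Sol Ω L S A u G)
    {Λ : ℝ} (hΛ : 0 ≤ Λ) (hlip : ∀ x ∈ Ω, ∀ y ∈ Ω, ‖A x - A y‖ ≤ Λ * (‖x - y‖ + |u x - u y|))
    (hcv : Convex ℝ Ω) {P : ℝ} (hP : ∀ x ∈ Ω, ‖gradient u x‖ ≤ P)
    {x y : E} {σ : ℝ} (hσ : 0 < σ) (hx : closedBall x (σ * L ^ 2) ⊆ Ω) (hy : closedBall y (σ * L ^ 2) ⊆ Ω) :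
    cLo E L * σ * ‖gradient u x - gradient u y‖ ≤
      2 * gC E L * (σ ^ 2 * (Λ * (1 + P) * P + P ^ 2 + S)) + P * ‖x - y‖ * (4 * L ^ 3) * vC E L +
      4 * σ * P * L ^ 6 * (Λ * (1 + P) * ‖x - y‖) * vC E L := by
  have hL := h.oL
  have L0 : 0 ≤ σ * L ^ 2 := by positivity
  have mx := hx (mem_closedBall_self (x := x) L0)
  have my := hy (mem_closedBall_self (x := y) L0)
  obtain ⟨B, K⟩ := exists_ker L hL (A x) (h.sym x mx) (h.coer x mx) (h.nA x mx)
  obtain ⟨B', K'⟩ := exists_ker L hL (A y) (h.sym y my) (h.coer y my) (h.nA y my)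
  have P0 : 0 ≤ P := (norm_nonneg _).trans (hP x mx)
  have S0 := h.S0
  have c0 : 0 < cLo E L := cLo_pos hL
  have v0 := vC_nonneg (E := E) L
  have g0 := gC_nonneg (E := E) hL
  set e := gradient u x - gradient u y with he
  set t := ‖x - y‖ with ht
  have AA : ‖A x - A y‖ ≤ Λ * (1 + P) * t := by
    refine (hlip x mx y my).trans ?_
    have := lip_of_grad h.cd hcv hP mx my
    calc Λ * (‖x - y‖ + |u x - u y|) ≤ Λ * (t + P * t) := by gcongr
      _ = _ := by ring
  have memx : ∀ (x : E), ∀ z ∈ closedBall (0:E) (L ^ 2), x + σ • z ∈ closedBall x (σ * L ^ 2) := by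
    intro x z hz
    rw [mem_closedBall_zero_iff] at hz
    rw [mem_closedBall_iff_norm, add_sub_cancel_left, norm_smul, Real.norm_eq_abs, abs_of_pos hσ]
    gcongr
  have rx := h.grad_rep_scaled hΛ hlip hσ hx K (fun z hz => hP z (hx hz)) e
  have ry := h.grad_rep_scaled hΛ hlip hσ hy K' (fun z hz => hP z (hy hz)) e
  have cx : Continuous fun z => u (x + σ • z) := h.cd.continuous.comp (by fun_prop)
  have cy : Continuous fun z => u (y + σ • z) := h.cd.continuous.comp (by fun_prop)
  have cgy : Continuous fun z => inner ℝ (gradient u (y + σ • z)) e :=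
    ((cont_grad h.cd).comp (by fun_prop : Continuous fun z : E => y + σ • z)).inner continuous_const
  have d1 := K.osc_int (f := fun z => u (x + σ • z) - u (y + σ • z)) (cx.sub cy) (m := 0) (ε := P * t) (by
    intro z hz
    have := lip_of_grad h.cd hcv hP (hx (memx x z hz)) (hy (memx y z hz))
    simpa using this) e
  simp_rw [sub_mul] at d1
  rw [integral_sub (K.int_gk cx e) (K.int_gk cy e)] at d1
  have parts : ∀ {A0 B : E →L[ℝ] E}, Ker L A0 B → ∫ z, u (y + σ • z) * inner ℝ (gradient (keta B) z) e =
      - (σ * ∫ z, inner ℝ (gradient u (y + σ • z)) e * keta B z) := by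
    intro A0 B KK
    have hus : ContDiff ℝ 1 (fun z => u (y + σ • z)) := h.cd.comp (by fun_prop)
    have := ibp hus KK.contDiff_keta (supp_of_zero fun z hz => KK.keta_zero hz).1 e
    simp only [grad_scale h.cd, inner_smul_left, RCLike.conj_to_real, mul_assoc, integral_const_mul] at this
    linarith
  have d2 := K.int_sub_le K' cgy (M := P * ‖e‖) (by
    intro z hz
    exact (abs_real_inner_le_norm _ _).trans (by
      gcongr
      exact hP _ (hy (memx y z hz))))
  have d3 := K.int_sub_le K' (f := fun _ => 1) continuous_const (M := 1) (by simp)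
  simp only [one_mul] at d3
  rw [parts K] at d1
  rw [parts K'] at ry
  set Ix := ∫ z, u (x + σ • z) * inner ℝ (gradient (keta B) z) e
  set J := ∫ z, inner ℝ (gradient u (y + σ • z)) e * keta B z
  set J' := ∫ z, inner ℝ (gradient u (y + σ • z)) e * keta B' z
  set c := ∫ z, keta B z
  set c' := ∫ z, keta B' z
  set gx := inner ℝ (gradient u x) e
  set gy := inner ℝ (gradient u y) e with hgy
  have gxy : gx - gy = ‖e‖ ^ 2 := by
    rw [← real_inner_self_eq_norm_sq]
    conv_rhs => rw [he, inner_sub_left]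
  have gyb : |gy| ≤ P * ‖e‖ := (abs_real_inner_le_norm _ _).trans (by
      gcongr
      exact hP _ my)
  set Q := Λ * (1 + P) * P + P ^ 2 + S with hQ
  set V := vC E L
  set W := 2 * L ^ 6 * ‖A x - A y‖ * V with hW
  have W0 : 0 ≤ W := by positivity
  have hWle : W ≤ 2 * L ^ 6 * (Λ * (1 + P) * t) * V := by rw [hW]; gcongr
  have eq : c * σ * ‖e‖ ^ 2 = (c * (σ * gx) + Ix) - (c' * (σ * gy) + -(σ * J')) - (Ix - -(σ * J)) + σ * (J - J') - (c - c') * (σ * gy) := by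
    rw [← gxy]; ring
  have b4 : |σ * (J - J')| ≤ σ * (P * ‖e‖ * W) := by
    rw [abs_mul, abs_of_pos hσ]
    apply mul_le_mul_of_nonneg_left _ hσ.le
    refine d2.trans (le_of_eq ?_)
    rw [hW]; ring
  have b5 : |(c - c') * (σ * gy)| ≤ W * (σ * (P * ‖e‖)) := by
    rw [abs_mul, abs_mul, abs_of_pos hσ]
    gcongr
  have tot : c * σ * ‖e‖ ^ 2 ≤ 2 * (gC E L * (σ ^ 2 * Q) * ‖e‖) + P * t * (4 * L ^ 3) * ‖e‖ * V + 2 * (σ * (P * ‖e‖ * W)) := by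
    rw [eq]
    have a1 := (abs_le.1 rx).2
    have a2 := (abs_le.1 ry).1
    have a3 := (abs_le.1 d1).1
    have a4 := (abs_le.1 b4).2
    have a5 := (abs_le.1 b5).1
    linarith
  have e0 : 0 ≤ ‖e‖ := norm_nonneg _
  have Q0 : 0 ≤ Q := by positivity
  rcases e0.eq_or_lt with hz | hz
  · rw [← hz, mul_zero]; positivity
  have cc : cLo E L * σ * ‖e‖ ^ 2 ≤ c * σ * ‖e‖ ^ 2 := by
    have := K.mass_low
    gcongr
  have w2 : 2 * (σ * (P * ‖e‖ * W)) ≤ 2 * (σ * (P * ‖e‖ * (2 * L ^ 6 * (Λ * (1 + P) * t) * V))) := by gcongr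
  have fin : ‖e‖ * (cLo E L * σ * ‖e‖) ≤ ‖e‖ * (2 * gC E L * (σ ^ 2 * Q) + P * t * (4 * L ^ 3) * V +
      4 * σ * P * L ^ 6 * (Λ * (1 + P) * t) * V) := by
    calc ‖e‖ * (cLo E L * σ * ‖e‖) = cLo E L * σ * ‖e‖ ^ 2 := by ring
      _ ≤ _ := cc.trans tot
      _ ≤ 2 * (gC E L * (σ ^ 2 * Q) * ‖e‖) + P * t * (4 * L ^ 3) * ‖e‖ * V + 2 * (σ * (P * ‖e‖ * (2 * L ^ 6 * (Λ * (1 + P) * t) * V))) := by linarith [w2]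
      _ = _ := by ring
  exact le_of_mul_le_mul_left fin hz

end HolSec


section CombSec

set_option maxHeartbeats 1600000 in
lemma exists_interior_est (E : Type*) [NormedAddCommGroup E] [InnerProductSpace ℝ E] [FiniteDimensional ℝ E]
    [MeasurableSpace E] [BorelSpace E] (hn : 2 ≤ Module.finrank ℝ E) (L : ℝ) (hL : 1 ≤ L)
    (Λ : ℝ) (hΛ : 0 ≤ Λ) :
    ∃ K, 1 ≤ K ∧ ∀ κ : ℝ, 1 ≤ κ → ∀ (A : E → E →L[ℝ] E) (u G : E → ℝ),
      Sol (ball 0 (9/10)) L (5 * exp κ) A u G →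
      (∀ x ∈ ball (0:E) (9/10), ∀ y ∈ ball (0:E) (9/10), ‖A x - A y‖ ≤ Λ * (‖x - y‖ + |u x - u y|)) →
      (∀ x ∈ ball (0:E) (9/10), 0 ≤ u x ∧ u x ≤ κ) →
      (∀ x ∈ ball (0:E) (3/4), ‖gradient u x‖ ≤ exp (K * κ)) ∧
      ∀ x ∈ ball (0:E) (1/2), ∀ y ∈ ball (0:E) (1/2),
        ‖gradient u x - gradient u y‖ ≤ exp (K * κ) * ‖x - y‖ ^ ((1:ℝ)/3) := by
  obtain ⟨c, c0, c1, hosc⟩ := exists_osc_decay E hn L hL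
  obtain ⟨ε, Cg, ε0, Cg0, hgr⟩ := exists_grad_bound E L hL Λ hΛ
  set τ := min (ε / 2) (1 / (24 * L)) with hτ
  have L0 : 0 < L := by linarith
  have τ0 : 0 < τ := by apply lt_min <;> positivity
  have τ1 : 2 * τ ≤ ε := by have : τ ≤ ε / 2 := min_le_left _ _; linarith
  have τ2 : 24 * L * τ ≤ 1 := by
    have : τ ≤ 1 / (24 * L) := min_le_right _ _
    calc 24 * L * τ ≤ 24 * L * (1 / (24 * L)) := by gcongr
      _ = 1 := by field_simp
  set s := min (1 / 10) (c * τ / 5) with hs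
  have s0 : 0 < s := by apply lt_min <;> positivity
  have s1 : s ≤ 1 / 10 := min_le_left _ _
  have s2 : s ≤ c * τ / 5 := min_le_right _ _
  set D := 3 / (c * τ) with hD
  have D0 : 0 < D := by positivity
  set K1 := 6 + Cg / s with hK1
  have K10 : 0 < K1 := by positivity
  set K2 := K1 + D + 4 with hK2
  set q1 := 1 / (8 * L ^ 2) with hq1
  have q10 : 0 < q1 := by positivity
  have hc := cLo_pos (E := E) hL
  have hg := gC_nonneg (E := E) hL
  have hv := vC_nonneg (E := E) L
  set M := 2 * gC E L * q1 ^ 2 * (2 * Λ + 6) + 4 * L ^ 3 * vC E L + 8 * q1 * L ^ 6 * Λ * vC E L with hM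
  have M0 : 0 ≤ M := by positivity
  set M' := M / (cLo E L * q1) with hM'
  have M'0 : 0 ≤ M' := by positivity
  refine ⟨2 * K2 + M', by linarith, ?_⟩
  intro κ hκ A u G h hlip hu
  have grad : ∀ x ∈ ball (0:E) (3/4), ‖gradient u x‖ ≤ exp (K2 * κ) := by
    intro x0 hx0
    rw [mem_ball_zero_iff] at hx0
    set ρ0 := s * exp (-κ) with hρ
    have ρ00 : 0 < ρ0 := by positivity
    have em : exp (-κ) ≤ 1 := by rw [exp_le_one_iff]; linarith
    have ρ1 : ρ0 ≤ 1 / 10 := by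
      calc ρ0 ≤ s * 1 := by rw [hρ]; gcongr
        _ ≤ _ := by linarith
    have hsub : closedBall x0 ρ0 ⊆ ball (0:E) (9/10) := by
      intro y hy
      rw [mem_closedBall, dist_eq_norm] at hy
      rw [mem_ball_zero_iff]
      have := norm_add_le (y - x0) x0
      rw [sub_add_cancel] at this
      linarith
    have hρS : ρ0 ^ 2 * (5 * exp κ) ≤ c * τ := by
      have e : exp (-κ) * exp κ = 1 := by rw [← exp_add]; simp
      calc ρ0 ^ 2 * (5 * exp κ) = 5 * s ^ 2 * exp (-κ) * (exp (-κ) * exp κ) := by rw [hρ]; ring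
        _ ≤ 5 * s ^ 2 * 1 * 1 := by rw [e]; gcongr
        _ ≤ 5 * s := by nlinarith
        _ ≤ _ := by linarith
    obtain ⟨m', M1, h1, h2⟩ := hosc _ _ _ _ _ h x0 ρ0 ρ00 hsub τ 0 κ τ0 τ2 hρS
      (fun x hx => hu x (hsub hx)) ⌈κ / (c * τ)⌉₊
    set k := ⌈κ / (c * τ)⌉₊ with hk
    have k1 : κ / (c * τ) ≤ k := Nat.le_ceil _
    have k2 : (k:ℝ) < κ / (c * τ) + 1 := Nat.ceil_lt_add_one (by positivity)
    have k3 : κ ≤ k * (c * τ) := by rwa [div_le_iff₀ (by positivity)] at k1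
    have h3 : M1 - m' ≤ ε := by
      refine h1.trans (max_le τ1 ?_)
      linarith
    have p8 : (1:ℝ) ≤ 8 ^ k := one_le_pow₀ (by norm_num)
    have rk : ρ0 / 8 ^ k ≤ ρ0 := div_le_self ρ00.le p8
    have gb := hgr _ _ _ _ _ h hlip x0 (ρ0 / 8 ^ k) (by positivity)
      ((closedBall_subset_closedBall rk).trans hsub) m' (by
        intro x hx
        have := h2 x hx
        rw [abs_le]; constructor <;> linarith)
    have e8 : (8:ℝ) ^ k ≤ exp (D * κ + 3) := by
      have : (8:ℝ) ≤ exp 3 := by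
        have h2e : (2:ℝ) ≤ exp 1 := by have := add_one_le_exp (1:ℝ); linarith
        have : exp 3 = exp 1 ^ 3 := by rw [← exp_nat_mul]; norm_num
        rw [this]
        calc (8:ℝ) = 2 ^ 3 := by norm_num
          _ ≤ _ := by gcongr
      calc (8:ℝ) ^ k ≤ exp 3 ^ k := by gcongr
        _ = exp (k * 3) := by rw [← exp_nat_mul]
        _ ≤ _ := by
          apply exp_le_exp.2
          have : D * κ = 3 * (κ / (c * τ)) := by rw [hD]; ring
          rw [this]; linarith
    refine gb.trans ?_
    have t1 : Cg / (ρ0 / 8 ^ k) ≤ Cg / s * exp ((D + 4) * κ) := by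
      have : Cg / (ρ0 / 8 ^ k) = Cg / s * (exp κ * 8 ^ k) := by
        have X0 : exp κ ≠ 0 := (exp_pos κ).ne'
        rw [hρ, exp_neg]
        generalize exp κ = X at X0 ⊢
        generalize (8:ℝ) ^ k = Y
        rw [div_div_eq_mul_div, mul_comm s, ← div_div, div_inv_eq_mul]
        ring
      rw [this]
      gcongr
      calc exp κ * 8 ^ k ≤ exp κ * exp (D * κ + 3) := by gcongr
        _ = exp (κ + (D * κ + 3)) := (exp_add κ _).symm
        _ ≤ _ := by apply exp_le_exp.2; linarith [add_mul D 4 κ]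
    have t2 : exp κ ≤ exp ((D + 4) * κ) := by apply exp_le_exp.2; nlinarith
    have t3 : 1 ≤ exp ((D + 4) * κ) := by apply one_le_exp; positivity
    calc _ ≤ K1 * exp ((D + 4) * κ) := by rw [hK1, add_mul]; linarith
      _ ≤ exp (K1 * κ) * exp ((D + 4) * κ) := by
        gcongr
        have := add_one_le_exp (K1 * κ)
        nlinarith
      _ = _ := by rw [← exp_add]; congr 1; rw [hK2]; ring
  set P := exp (K2 * κ) with hP
  have K21 : 4 ≤ K2 := by rw [hK2]; linarith
  have P1 : 1 ≤ P := by apply one_le_exp; positivity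
  have eP : exp κ ≤ P := by apply exp_le_exp.2; nlinarith
  refine ⟨fun x hx => (grad x hx).trans (exp_le_exp.2 ?_), ?_⟩
  · have : 0 ≤ (K2 + M') * κ := by positivity
    nlinarith
  intro x hx y hy
  rcases eq_or_ne x y with rfl | hxy
  · simp only [sub_self, norm_zero]; positivity
  rw [mem_ball_zero_iff] at hx hy
  set t := ‖x - y‖ with ht
  have t0 : 0 < t := norm_pos_iff.2 (sub_ne_zero.2 hxy)
  have t1 : t ≤ 1 := by have := norm_sub_le x y; linarith
  set q := √t with hq
  have q0 : 0 < q := sqrt_pos.2 t0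
  have q1' : q ≤ 1 := by rw [hq]; exact sqrt_le_one.2 t1
  have qq : t = q ^ 2 := by rw [hq, sq_sqrt t0.le]
  have hsub : ∀ z : E, ‖z‖ < 1 / 2 → closedBall z (q1 * q * L ^ 2) ⊆ ball (0:E) (3/4) := by
    intro z hz y hy
    rw [mem_closedBall, dist_eq_norm] at hy
    rw [mem_ball_zero_iff]
    have := norm_add_le (y - z) z
    rw [sub_add_cancel] at this
    have e : q1 * q * L ^ 2 = q / 8 := by rw [hq1]; field_simp
    linarith
  have hss : ball (0:E) (3/4) ⊆ ball (0:E) (9/10) := ball_subset_ball (by norm_num)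
  have key := (h.mono hss).holder hΛ (fun x hx y hy => hlip x (hss hx) y (hss hy)) (convex_ball _ _)
    grad (x := x) (y := y) (σ := q1 * q) (by positivity) (hsub x hx) (hsub y hy)
  rw [← ht] at key
  have kr : 2 * gC E L * ((q1 * q) ^ 2 * (Λ * (1 + P) * P + P ^ 2 + 5 * exp κ)) + P * t * (4 * L ^ 3) * vC E L +
      4 * (q1 * q) * P * L ^ 6 * (Λ * (1 + P) * t) * vC E L ≤ q ^ 2 * P ^ 2 * M := by
    have a1 : Λ * (1 + P) * P + P ^ 2 + 5 * exp κ ≤ (2 * Λ + 6) * P ^ 2 := by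
      have : Λ * (1 + P) * P ≤ Λ * (P + P) * P := by gcongr
      nlinarith
    have a2 : P * t * (4 * L ^ 3) * vC E L ≤ P ^ 2 * q ^ 2 * (4 * L ^ 3) * vC E L := by
      rw [qq]; gcongr; nlinarith
    have a3 : 4 * (q1 * q) * P * L ^ 6 * (Λ * (1 + P) * t) * vC E L ≤ 4 * (q1 * 1) * P * L ^ 6 * (Λ * (P + P) * q ^ 2) * vC E L := by
      rw [qq]; gcongr
    have a4 : 2 * gC E L * ((q1 * q) ^ 2 * (Λ * (1 + P) * P + P ^ 2 + 5 * exp κ)) ≤ 2 * gC E L * ((q1 * q) ^ 2 * ((2 * Λ + 6) * P ^ 2)) := by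
      gcongr
    have e : q ^ 2 * P ^ 2 * M = 2 * gC E L * ((q1 * q) ^ 2 * ((2 * Λ + 6) * P ^ 2)) + P ^ 2 * q ^ 2 * (4 * L ^ 3) * vC E L + 4 * (q1 * 1) * P * L ^ 6 * (Λ * (P + P) * q ^ 2) * vC E L := by
      rw [hM]; ring
    rw [e]; linarith
  have k2 := key.trans kr
  have k3 : ‖gradient u x - gradient u y‖ ≤ P ^ 2 * M' * q := by
    have : cLo E L * (q1 * q) * ‖gradient u x - gradient u y‖ ≤ cLo E L * (q1 * q) * (P ^ 2 * M' * q) := by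
      refine k2.trans (le_of_eq ?_)
      rw [hM']; field_simp
    exact le_of_mul_le_mul_left this (by positivity)
  have qt : q ≤ t ^ ((1:ℝ)/3) := by
    rw [hq, sqrt_eq_rpow]
    exact rpow_le_rpow_of_exponent_ge t0 t1 (by norm_num)
  calc _ ≤ P ^ 2 * M' * q := k3
    _ ≤ P ^ 2 * exp (M' * κ) * t ^ ((1:ℝ)/3) := by
      gcongr
      have := add_one_le_exp (M' * κ)
      nlinarith
    _ = _ := by
      congr 1
      rw [hP, ← exp_nat_mul, ← exp_add]; congr 1; push_cast; ring

end CombSec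


section MollSec
variable {E : Type*} [NormedAddCommGroup E] [InnerProductSpace ℝ E] [FiniteDimensional ℝ E]
  [MeasurableSpace E] [BorelSpace E]

lemma exists_smooth_approx {ψ : E → ℝ} (hψ : ContDiff ℝ 1 ψ) (hc : HasCompactSupport ψ)
    {δ η : ℝ} (hδ : 0 < δ) (hη : 0 < η) :
    ∃ ψ' : E → ℝ, ContDiff ℝ (⊤ : ℕ∞) ψ' ∧ tsupport ψ' ⊆ cthickening δ (tsupport ψ) ∧
      (∀ x, |ψ' x - ψ x| ≤ η) ∧ ∀ x, ‖gradient ψ' x - gradient ψ x‖ ≤ η := by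
  have u1 : UniformContinuous ψ := hc.uniformContinuous_of_continuous hψ.continuous
  have cf : Continuous (fderiv ℝ ψ) := hψ.continuous_fderiv one_ne_zero
  have u2 : UniformContinuous (fderiv ℝ ψ) := (hc.fderiv ℝ).uniformContinuous_of_continuous cf
  obtain ⟨d1, d10, h1⟩ := Metric.uniformContinuous_iff.1 u1 η hη
  obtain ⟨d2, d20, h2⟩ := Metric.uniformContinuous_iff.1 u2 η hη
  set R := min δ (min d1 d2) with hR
  have R0 : 0 < R := lt_min hδ (lt_min d10 d20)
  have Rδ : R ≤ δ := min_le_left _ _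
  have R1 : R ≤ d1 := (min_le_right _ _).trans (min_le_left _ _)
  have R2 : R ≤ d2 := (min_le_right _ _).trans (min_le_right _ _)
  let b : ContDiffBump (0:E) := ⟨R / 2, R, by positivity, by linarith⟩
  have hb : b.rOut = R := rfl
  let ψ' : E → ℝ := convolution (b.normed volume) ψ (ContinuousLinearMap.lsmul ℝ ℝ) volume
  have m1 : AEStronglyMeasurable ψ (volume : Measure E) := hψ.continuous.aestronglyMeasurable
  have m2 : AEStronglyMeasurable (fderiv ℝ ψ) (volume : Measure E) := cf.aestronglyMeasurable
  have li : LocallyIntegrable (b.normed volume) (volume : Measure E) :=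
    (b.contDiff_normed (n := 0)).continuous.locallyIntegrable
  have hd : ∀ x, HasFDerivAt ψ' (convolution (b.normed volume) (fderiv ℝ ψ) (ContinuousLinearMap.lsmul ℝ ℝ) volume x) x := by
    intro x
    have := hc.hasFDerivAt_convolution_right (μ := volume) (ContinuousLinearMap.lsmul ℝ ℝ) li hψ x
    have e : ContinuousLinearMap.precompR E (ContinuousLinearMap.lsmul ℝ ℝ : ℝ →L[ℝ] ℝ →L[ℝ] ℝ) =
        (ContinuousLinearMap.lsmul ℝ ℝ : ℝ →L[ℝ] (E →L[ℝ] ℝ) →L[ℝ] (E →L[ℝ] ℝ)) := by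
      ext; simp [ContinuousLinearMap.precompR]
    rw [e] at this
    exact this
  refine ⟨ψ', ?_, ?_, ?_, ?_⟩
  · exact b.hasCompactSupport_normed.contDiff_convolution_left _ b.contDiff_normed
      hψ.continuous.locallyIntegrable
  · apply closure_minimal _ isClosed_cthickening
    intro x hx
    by_contra hn
    apply hx
    have z : ∀ y ∈ ball x R, ψ y = 0 := by
      intro y hy
      by_contra hy0
      apply hn
      have : y ∈ tsupport ψ := subset_tsupport _ hy0
      rw [mem_ball, dist_comm] at hy
      exact mem_cthickening_of_dist_le x y δ _ this (by linarith)
    have := b.dist_normed_convolution_le (μ := volume) (x₀ := x) (ε := 0) m1 (by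
      intro y hy
      rw [z y hy, z x (mem_ball_self R0)]; simp)
    rw [z x (mem_ball_self R0)] at this
    exact dist_le_zero.1 this
  · intro x
    have := b.dist_normed_convolution_le (μ := volume) (x₀ := x) (ε := η) m1 (by
      intro y hy
      rw [mem_ball, hb] at hy
      exact (h1 (by linarith)).le)
    rwa [Real.dist_eq] at this
  · intro x
    have := b.dist_normed_convolution_le (μ := volume) (x₀ := x) (ε := η) m2 (by
      intro y hy
      rw [mem_ball, hb] at hy
      exact (h2 (by linarith)).le)
    rw [dist_eq_norm] at this
    unfold gradient
    rw [← map_sub, LinearIsometryEquiv.norm_map, (hd x).fderiv]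
    exact this

lemma weak_ext {U : Set E} (hU : IsOpen U) {V : E → E} {G : E → ℝ} (hV : ContinuousOn V U) (hG : ContinuousOn G U)
    (hw : ∀ ψ : E → ℝ, ContDiff ℝ (⊤ : ℕ∞) ψ → HasCompactSupport ψ → tsupport ψ ⊆ U →
      ∫ x, inner ℝ (V x) (gradient ψ x) = ∫ x, G x * ψ x)
    {ψ : E → ℝ} (h1 : ContDiff ℝ 1 ψ) (h2 : HasCompactSupport ψ) (h3 : tsupport ψ ⊆ U) :
    ∫ x, inner ℝ (V x) (gradient ψ x) = ∫ x, G x * ψ x := by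
  obtain ⟨δ, δ0, hδ⟩ := IsCompact.exists_cthickening_subset_open h2.isCompact hU h3
  set K := cthickening δ (tsupport ψ) with hK
  have cK : IsCompact K := h2.isCompact.cthickening
  have sK : tsupport ψ ⊆ K := self_subset_cthickening _
  have int1 : ∀ θ : E → ℝ, ContDiff ℝ 1 θ → tsupport θ ⊆ K →
      Integrable (fun x => inner ℝ (V x) (gradient θ x)) ∧ Integrable (fun x => G x * θ x) := by
    intro θ a1 a2
    constructor
    · apply integrable_of_tsupport cK
      · exact (hV.mono hδ).inner (cont_grad a1).continuousOn
      · intro x hx; rw [grad_zero_of_notMem (fun h => hx (a2 h)), inner_zero_right]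
    · apply integrable_of_tsupport cK
      · exact (hG.mono hδ).mul a1.continuous.continuousOn
      · intro x hx; rw [image_eq_zero_of_notMem_tsupport (fun h => hx (a2 h)), mul_zero]
  have iN : Integrable (K.indicator (fun x => ‖V x‖ + |G x|)) := by
    rw [integrable_indicator_iff cK.measurableSet]
    exact ((hV.mono hδ).norm.add (hG.mono hδ).abs).integrableOn_compact cK
  set I := ∫ x, K.indicator (fun x => ‖V x‖ + |G x|) x with hI
  have I0 : 0 ≤ I := integral_nonneg (fun x => indicator_nonneg (fun x _ => by positivity) x)
  have bd : ∀ η > 0, |(∫ x, inner ℝ (V x) (gradient ψ x)) - ∫ x, G x * ψ x| ≤ η * I := by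
    intro η hη
    obtain ⟨ψ', b1, b2, b3, b4⟩ := exists_smooth_approx h1 h2 δ0 hη
    have b1' : ContDiff ℝ 1 ψ' := b1.of_le (by exact_mod_cast le_top)
    have cs : HasCompactSupport ψ' := HasCompactSupport.of_support_subset_isCompact cK ((subset_tsupport _).trans b2)
    have hh := hw ψ' b1 cs (b2.trans hδ)
    obtain ⟨j1, j2⟩ := int1 ψ h1 sK
    obtain ⟨j3, j4⟩ := int1 ψ' b1' b2
    have e : (∫ x, inner ℝ (V x) (gradient ψ x)) - ∫ x, G x * ψ x =
        ∫ x, ((inner ℝ (V x) (gradient ψ x) - inner ℝ (V x) (gradient ψ' x)) - (G x * ψ x - G x * ψ' x)) := by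
      have k := integral_sub (j1.sub j3) (j2.sub j4)
      simp only [Pi.sub_apply] at k
      rw [k, integral_sub j1 j3, integral_sub j2 j4, hh]; ring
    rw [e, ← Real.norm_eq_abs, hI, ← integral_const_mul]
    apply norm_integral_le_of_norm_le (iN.const_mul η)
    apply Filter.Eventually.of_forall
    intro x
    by_cases hx : x ∈ K
    · rw [indicator_of_mem hx, ← inner_sub_right, ← mul_sub]
      calc _ ≤ ‖inner ℝ (V x) (gradient ψ x - gradient ψ' x)‖ + ‖G x * (ψ x - ψ' x)‖ := norm_sub_le _ _
        _ ≤ ‖V x‖ * η + |G x| * η := by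
          rw [norm_mul]
          have c1 := b4 x
          have c2 := b3 x
          rw [norm_sub_rev] at c1
          rw [abs_sub_comm] at c2
          have := norm_inner_le_norm (𝕜 := ℝ) (V x) (gradient ψ x - gradient ψ' x)
          simp only [Real.norm_eq_abs] at *
          gcongr
          exact this.trans (by gcongr)
        _ = _ := by ring
    · rw [indicator_of_notMem hx]
      have z1 : x ∉ tsupport ψ := fun h => hx (sK h)
      have z2 : x ∉ tsupport ψ' := fun h => hx (b2 h)
      rw [grad_zero_of_notMem z1, grad_zero_of_notMem z2, image_eq_zero_of_notMem_tsupport z1, image_eq_zero_of_notMem_tsupport z2]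
      simp
  have : |(∫ x, inner ℝ (V x) (gradient ψ x)) - ∫ x, G x * ψ x| ≤ 0 := by
    apply le_of_forall_pos_le_add
    intro e he
    rw [zero_add]
    refine (bd (e / (I + 1)) (by positivity)).trans ?_
    rw [div_mul_eq_mul_div, div_le_iff₀ (by positivity)]
    nlinarith
  exact sub_eq_zero.1 (abs_nonpos_iff.1 this)

end MollSec


section CoeffSec
variable {n : ℕ}

/-- the linear operator with matrix `c`. -/
noncomputable def matOp (c : Fin n → Fin n → ℝ) : EuclideanSpace ℝ (Fin n) →L[ℝ] EuclideanSpace ℝ (Fin n) :=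
  ∑ i, ∑ j, c i j • ((EuclideanSpace.proj i : EuclideanSpace ℝ (Fin n) →L[ℝ] ℝ).smulRight (EuclideanSpace.single j (1:ℝ)))

lemma matOp_inner (c : Fin n → Fin n → ℝ) (p q : EuclideanSpace ℝ (Fin n)) :
    inner ℝ (matOp c p) q = ∑ i, ∑ j, c i j * p i * q j := by
  simp only [matOp, ContinuousLinearMap.sum_apply, sum_inner, ContinuousLinearMap.smul_apply,
    ContinuousLinearMap.smulRight_apply, inner_smul_left, EuclideanSpace.inner_single_left]
  simp [mul_assoc]

lemma matOp_sub_norm (c d : Fin n → Fin n → ℝ) {M : ℝ} (h : ∀ i j, |c i j - d i j| ≤ M) :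
    ‖matOp c - matOp d‖ ≤ (n:ℝ) ^ 2 * M := by
  have e : matOp c - matOp d = ∑ i, ∑ j, (c i j - d i j) • ((EuclideanSpace.proj i : EuclideanSpace ℝ (Fin n) →L[ℝ] ℝ).smulRight (EuclideanSpace.single j (1:ℝ))) := by
    simp only [matOp, ← Finset.sum_sub_distrib]
    refine Finset.sum_congr rfl fun i _ => Finset.sum_congr rfl fun j _ => ?_
    exact (sub_smul _ _ _).symm
  rw [e]
  have : ∀ i j, ‖(c i j - d i j) • ((EuclideanSpace.proj i : EuclideanSpace ℝ (Fin n) →L[ℝ] ℝ).smulRight (EuclideanSpace.single j (1:ℝ)))‖ ≤ M := by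
    intro i j
    rw [norm_smul, ContinuousLinearMap.norm_smulRight_apply]
    have p1 : ‖(EuclideanSpace.proj i : EuclideanSpace ℝ (Fin n) →L[ℝ] ℝ)‖ ≤ 1 := by
      apply ContinuousLinearMap.opNorm_le_bound _ zero_le_one
      intro x
      rw [one_mul]
      exact PiLp.norm_apply_le x i
    have p2 : ‖EuclideanSpace.single j (1:ℝ)‖ = 1 := by simp
    have p3 := h i j
    have M0 : 0 ≤ M := (abs_nonneg _).trans p3
    rw [p2, mul_one, Real.norm_eq_abs]
    calc _ ≤ M * 1 := by gcongr
      _ = M := mul_one _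
  calc _ ≤ ∑ i : Fin n, ∑ j : Fin n, M := by
        refine (norm_sum_le _ _).trans (Finset.sum_le_sum fun i _ => (norm_sum_le _ _).trans (Finset.sum_le_sum fun j _ => this i j))
    _ = _ := by simp; ring

lemma matOp_sym {c : Fin n → Fin n → ℝ} (h : ∀ i j, c i j = c j i) (p q : EuclideanSpace ℝ (Fin n)) :
    inner ℝ (matOp c p) q = inner ℝ p (matOp c q) := by
  rw [real_inner_comm (matOp c q) p, matOp_inner, matOp_inner, Finset.sum_comm]
  refine Finset.sum_congr rfl fun i _ => Finset.sum_congr rfl fun j _ => ?_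
  rw [h j i]; ring

lemma sym_norm_le {E : Type*} [NormedAddCommGroup E] [InnerProductSpace ℝ E] (T : E →L[ℝ] E)
    (hs : ∀ p q, inner ℝ (T p) q = inner ℝ p (T q)) {Λ : ℝ} (hΛ : 0 ≤ Λ) (h0 : ∀ p, 0 ≤ inner ℝ (T p) p)
    (h1 : ∀ p, inner ℝ (T p) p ≤ Λ * ‖p‖ ^ 2) : ‖T‖ ≤ Λ := by
  apply ContinuousLinearMap.opNorm_le_bound _ hΛ
  intro p
  rcases eq_or_ne (T p) 0 with h | h
  · rw [h, norm_zero]; positivity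
  have hn : 0 < ‖T p‖ := norm_pos_iff.2 h
  rcases eq_or_ne p 0 with hp | hp
  · rw [hp]; simp
  have hpn : 0 < ‖p‖ := norm_pos_iff.2 hp
  set q := (‖p‖ / ‖T p‖) • T p with hq
  have nq : ‖q‖ = ‖p‖ := by
    rw [hq, norm_smul, Real.norm_eq_abs, abs_of_pos (by positivity)]; field_simp
  have pq : inner ℝ (T p) q = ‖p‖ * ‖T p‖ := by
    rw [hq, inner_smul_right, real_inner_self_eq_norm_sq]; field_simp
  have qp : inner ℝ (T q) p = ‖p‖ * ‖T p‖ := by rw [hs, real_inner_comm, pq]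
  have a1 := h1 (p + q)
  have a2 := h0 (p - q)
  rw [map_add, inner_add_left, inner_add_right, inner_add_right, pq, qp] at a1
  rw [map_sub, inner_sub_left, inner_sub_right, inner_sub_right, pq, qp] at a2
  have a3 : ‖p + q‖ ≤ 2 * ‖p‖ := by have := norm_add_le p q; linarith
  have a4 : Λ * ‖p + q‖ ^ 2 ≤ Λ * (2 * ‖p‖) ^ 2 := by gcongr
  have : ‖p‖ * ‖T p‖ ≤ ‖p‖ * (Λ * ‖p‖) := by nlinarith
  exact le_of_mul_le_mul_left this hpn

lemma grad_apply (f : EuclideanSpace ℝ (Fin n) → ℝ) (x : EuclideanSpace ℝ (Fin n)) (i : Fin n) :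
    gradient f x i = fderiv ℝ f x (EuclideanSpace.single i 1) := by
  rw [← inner_grad, EuclideanSpace.inner_single_right]; simp

end CoeffSec


section BuildSec
variable {n : ℕ}

lemma lip_coeff {Λ₁ : ℝ} {a : Fin n → Fin n → EuclideanSpace ℝ (Fin n) → ℝ → ℝ} (h : C1Bound n Λ₁ a)
    (i j : Fin n) {x y : EuclideanSpace ℝ (Fin n)} (hx : x ∈ ball (0 : EuclideanSpace ℝ (Fin n)) 1)
    (hy : y ∈ ball (0 : EuclideanSpace ℝ (Fin n)) 1) (z w : ℝ) :
    |a i j x z - a i j y w| ≤ Λ₁ * (‖x - y‖ + |z - w|) := by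
  obtain ⟨h1, h2⟩ := h
  have hd : ∀ x ∈ ball (0 : EuclideanSpace ℝ (Fin n)) 1, ∀ z : ℝ,
      DifferentiableAt ℝ (fun p : EuclideanSpace ℝ (Fin n) × ℝ => a i j p.1 p.2) (x, z) := by
    intro x hx z
    have : ContDiffAt ℝ 1 (fun p : EuclideanSpace ℝ (Fin n) × ℝ => a i j p.1 p.2) (x, z) :=
      (h1 i j).contDiffAt ((isOpen_ball.prod isOpen_univ).mem_nhds ⟨hx, mem_univ _⟩)
    exact this.differentiableAt one_ne_zero
  have e1 : |a i j x z - a i j y z| ≤ Λ₁ * ‖x - y‖ := by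
    refine Convex.norm_image_sub_le_of_norm_fderiv_le (𝕜 := ℝ) (f := fun y => a i j y z) (s := ball 0 1) ?_ ?_ (convex_ball _ _) hy hx
    · intro v hv
      exact (hd v hv z).comp v (f := fun v => (v, z)) (by fun_prop)
    · intro v hv
      have := h2 i j v hv z
      have := abs_nonneg (deriv (fun w => a i j v w) z)
      linarith
  have e2 : |a i j y z - a i j y w| ≤ Λ₁ * |z - w| := by
    refine Convex.norm_image_sub_le_of_norm_deriv_le (f := fun z => a i j y z) (s := univ) ?_ ?_ convex_univ (mem_univ _) (mem_univ _)
    · intro v hv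
      exact (hd y hy v).comp v (f := fun v => (y, v)) (by fun_prop)
    · intro v hv
      have := h2 i j y hy v
      have := norm_nonneg (fderiv ℝ (fun y => a i j y v) y)
      rw [Real.norm_eq_abs]
      linarith
  calc _ = |(a i j x z - a i j y z) + (a i j y z - a i j y w)| := by congr 1; ring
    _ ≤ _ := abs_add_le _ _
    _ ≤ _ := by linarith

lemma exists_sol {Λ Λ₁ κ : ℝ} (hΛ : 1 ≤ Λ) (hκ : 1 ≤ κ)
    {a : Fin n → Fin n → EuclideanSpace ℝ (Fin n) → ℝ → ℝ}
    {ρ : EuclideanSpace ℝ (Fin n) → ℝ → ℝ}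
    {f : EuclideanSpace ℝ (Fin n) → ℝ}
    {F : EuclideanSpace ℝ (Fin n) → ℝ → EuclideanSpace ℝ (Fin n) → ℝ}
    (hg : GoodCoeffs n Λ a ρ f F) (hc : C1Bound n Λ₁ a)
    {φ : EuclideanSpace ℝ (Fin n) → ℝ} (hs : IsSolution n κ a ρ f F φ) :
    ∃ A u G, Sol (ball (0 : EuclideanSpace ℝ (Fin n)) (9/10)) Λ (5 * exp κ) A u G ∧
      (∀ x ∈ ball (0 : EuclideanSpace ℝ (Fin n)) (9/10), ∀ y ∈ ball (0 : EuclideanSpace ℝ (Fin n)) (9/10),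
        ‖A x - A y‖ ≤ ((n:ℝ) ^ 2 * Λ₁) * (‖x - y‖ + |u x - u y|)) ∧
      ∀ x ∈ ball (0 : EuclideanSpace ℝ (Fin n)) (9/10), u x = φ x ∧ gradient u x = gradient φ x := by
  obtain ⟨ca, sa, ea, cρ, bρ, cf, bf, cF, bF⟩ := hg
  obtain ⟨cφ, bφ, weak⟩ := hs
  set U := ball (0 : EuclideanSpace ℝ (Fin n)) 1 with hU
  set O := ball (0 : EuclideanSpace ℝ (Fin n)) (9/10) with hO
  have oU : IsOpen U := isOpen_ball
  have OU : O ⊆ U := ball_subset_ball (by norm_num)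
  have Λ0 : 0 < Λ := by linarith
  obtain ⟨χ, χ1, χ2, χ3, -, -, χ4, -⟩ := exists_cutoff (E := EuclideanSpace ℝ (Fin n)) (r := 9/10) (ρ := 19/20) (by norm_num) (by norm_num)
  have χU : tsupport χ ⊆ U := χ3.trans (closedBall_subset_ball (by norm_num))
  let u : EuclideanSpace ℝ (Fin n) → ℝ := fun x => χ x * φ x
  let A : EuclideanSpace ℝ (Fin n) → EuclideanSpace ℝ (Fin n) →L[ℝ] EuclideanSpace ℝ (Fin n) :=
    fun x => matOp (fun i j => a i j x (φ x))
  let G : EuclideanSpace ℝ (Fin n) → ℝ :=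
    fun x => ρ x (φ x) * (1 - (1/2) * f x * Real.exp (φ x) + F x (φ x) (gradient φ x))
  have contφ : ContinuousOn φ U := cφ.continuousOn
  have contg : ContinuousOn (gradient φ) U := by
    have : ContinuousOn (fderiv ℝ φ) U := cφ.continuousOn_fderiv_of_isOpen oU le_rfl
    unfold gradient
    exact (InnerProductSpace.toDual ℝ (EuclideanSpace ℝ (Fin n))).symm.continuous.comp_continuousOn this
  have contp : ContinuousOn (fun x => (x, φ x)) U := continuousOn_id.prodMk contφ
  have contA : ContinuousOn A U := by
    apply continuousOn_finset_sum; intro i _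
    apply continuousOn_finset_sum; intro j _
    have : ContinuousOn (fun x => a i j x (φ x)) U :=
      (ca i j).comp contp (fun x hx => ⟨hx, mem_univ _⟩)
    exact this.smul continuousOn_const
  have contG : ContinuousOn G U := by
    have h1 : ContinuousOn (fun x => ρ x (φ x)) U := cρ.comp contp (fun x hx => ⟨hx, mem_univ _⟩)
    have h2 : ContinuousOn (fun x => F x (φ x) (gradient φ x)) U :=
      cF.comp (continuousOn_id.prodMk (contφ.prodMk contg)) (fun x hx => ⟨hx, mem_univ _⟩)
    exact h1.mul ((continuousOn_const.sub ((continuousOn_const.mul cf).mul contφ.rexp)).add h2)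
  have hu : ∀ x ∈ O, u x = φ x := by
    intro x hx
    simp only [u]
    rw [χ4 x (ball_subset_closedBall hx), one_mul]
  have hgu : ∀ x ∈ O, gradient u x = gradient φ x := by
    intro x hx
    have : u =ᶠ[nhds x] φ := by
      filter_upwards [isOpen_ball.mem_nhds hx] with y hy using hu y hy
    unfold gradient
    rw [this.fderiv_eq]
  have cu : ContDiff ℝ 1 u := by
    rw [contDiff_iff_contDiffAt]
    intro x
    by_cases hx : x ∈ tsupport χ
    · exact χ1.contDiffAt.mul (cφ.contDiffAt (oU.mem_nhds (χU hx)))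
    · have : u =ᶠ[nhds x] fun _ => 0 := by
        filter_upwards [(isClosed_tsupport χ).isOpen_compl.mem_nhds hx] with y hy
        simp only [u]
        rw [image_eq_zero_of_notMem_tsupport hy, zero_mul]
      exact contDiffAt_const.congr_of_eventuallyEq this
  have symA : ∀ x ∈ U, ∀ p q, inner ℝ (A x p) q = inner ℝ p (A x q) :=
    fun x hx p q => matOp_sym (fun i j => sa i j x (φ x)) p q
  have coerA : ∀ x ∈ U, ∀ p, Λ⁻¹ * ‖p‖ ^ 2 ≤ inner ℝ (A x p) p := by
    intro x hx p
    simp only [A]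
    rw [matOp_inner]; exact (ea x hx (φ x) p).1
  have nA : ∀ x ∈ U, ‖A x‖ ≤ Λ := by
    intro x hx
    apply sym_norm_le (A x) (symA x hx) Λ0.le
    · intro p
      exact le_trans (by positivity) (coerA x hx p)
    · intro p
      simp only [A]
      rw [matOp_inner]; exact (ea x hx (φ x) p).2
  have G_le : ∀ x ∈ U, |G x| ≤ 2 * ‖gradient φ x‖ ^ 2 + 5 * exp κ := by
    intro x hx
    have b1 := bρ x hx (φ x)
    have b2 := bf x hx
    have b3 := bφ x hx
    have b4 := bF x hx (φ x) (gradient φ x)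
    have b5 : exp (φ x) ≤ exp κ := exp_le_exp.2 b3.2
    have b6 := exp_pos (φ x)
    have b7 : 1 + 1 ≤ exp κ := by have := add_one_le_exp κ; linarith
    have b8 : f x * exp (φ x) ≤ exp κ := by nlinarith
    have b9 : 0 ≤ f x * exp (φ x) := mul_nonneg b2.1 b6.le
    have i1 : |1 - (1/2) * f x * Real.exp (φ x) + F x (φ x) (gradient φ x)| ≤ 1 + 1/2 * exp κ + (‖gradient φ x‖ ^ 2 + 1) := by
      rw [abs_le] at b4 ⊢
      constructor <;> nlinarith
    simp only [G]
    rw [abs_mul, abs_of_nonneg (by linarith)]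
    calc _ ≤ 2 * (1 + 1/2 * exp κ + (‖gradient φ x‖ ^ 2 + 1)) := by
          gcongr; exact b1.2
      _ ≤ _ := by linarith
  have wk : ∀ ψ : EuclideanSpace ℝ (Fin n) → ℝ, ContDiff ℝ (⊤ : ℕ∞) ψ → HasCompactSupport ψ → tsupport ψ ⊆ U →
      ∫ x, inner ℝ (A x (gradient φ x)) (gradient ψ x) = ∫ x, G x * ψ x := by
    intro ψ h1 h2 h3
    have := weak ψ h1 h2 h3
    rw [setIntegral_eq_integral_of_forall_compl_eq_zero, setIntegral_eq_integral_of_forall_compl_eq_zero] at this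
    · rw [← this]
      congr 1
      ext x
      simp only [A]
      rw [matOp_inner]
      simp only [grad_apply]
    · intro x hx
      rw [image_eq_zero_of_notMem_tsupport (fun h => hx (h3 h)), mul_zero]
    · intro x hx
      have : fderiv ℝ ψ x = 0 := fderiv_of_notMem_tsupport (𝕜 := ℝ) (fun h => hx (h3 h))
      simp [this]
  have contV : ContinuousOn (fun x => A x (gradient φ x)) U := contA.clm_apply contg
  refine ⟨A, u, G, ?_, ?_, fun x hx => ⟨hu x hx, hgu x hx⟩⟩
  · exact {
      oL := hΛ
      S0 := by positivity
      cd := cu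
      cA := contA.mono OU
      sym := fun x hx => symA x (OU hx)
      coer := fun x hx => coerA x (OU hx)
      nA := fun x hx => nA x (OU hx)
      cG := contG.mono OU
      G_le := fun x hx => by rw [hgu x hx]; exact G_le x (OU hx)
      weak := fun ψ h1 h2 h3 => by
        rw [← weak_ext oU contV contG wk h1 h2 (h3.trans OU)]
        congr 1
        ext x
        by_cases hx : x ∈ tsupport ψ
        · rw [hgu x (h3 hx)]
        · rw [grad_zero_of_notMem hx]; simp }
  · intro x hx y hy
    rw [hu x hx, hu y hy, mul_assoc]
    exact matOp_sub_norm _ _ (fun i j => lip_coeff hc i j (OU hx) (OU hy) _ _)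

end BuildSec

theorem interior_gradient_Holder (n : ℕ) (hn : 2 ≤ n) (Λ Λ₁ : ℝ)
    (hΛ : 1 ≤ Λ) (hΛ₁ : 0 < Λ₁) :
    ∃ C > (0:ℝ),
      ∀ κ : ℝ, 1 ≤ κ →
      ∀ (a : Fin n → Fin n → EuclideanSpace ℝ (Fin n) → ℝ → ℝ)
        (ρ : EuclideanSpace ℝ (Fin n) → ℝ → ℝ)
        (f : EuclideanSpace ℝ (Fin n) → ℝ)
        (F : EuclideanSpace ℝ (Fin n) → ℝ → EuclideanSpace ℝ (Fin n) → ℝ),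
        GoodCoeffs n Λ a ρ f F → C1Bound n Λ₁ a →
        ∀ φ : EuclideanSpace ℝ (Fin n) → ℝ, IsSolution n κ a ρ f F φ →
          (∀ x ∈ ball (0 : EuclideanSpace ℝ (Fin n)) (1/2),
            |φ x| + ‖gradient φ x‖ ≤
              (C * Real.exp κ) ^ (C * Real.exp (4 * Λ * κ))) ∧
          (∀ x ∈ ball (0 : EuclideanSpace ℝ (Fin n)) (1/2),
           ∀ y ∈ ball (0 : EuclideanSpace ℝ (Fin n)) (1/2),
            ‖gradient φ x - gradient φ y‖ ≤
              (C * Real.exp κ) ^ (C * Real.exp (4 * Λ * κ)) *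
                ‖x - y‖ ^ ((1:ℝ)/3)) := by
  obtain ⟨K, K1, hK⟩ := exists_interior_est (EuclideanSpace ℝ (Fin n)) (by simpa using hn) Λ hΛ ((n:ℝ) ^ 2 * Λ₁) (by positivity)
  refine ⟨2 * K, by linarith, ?_⟩
  intro κ hκ a ρ f F hg hc φ hs
  obtain ⟨A, u, G, hS, hlip, hu⟩ := exists_sol hΛ hκ hg hc hs
  have h34 : ball (0 : EuclideanSpace ℝ (Fin n)) (1/2) ⊆ ball 0 (3/4) := ball_subset_ball (by norm_num)
  have h9 : ball (0 : EuclideanSpace ℝ (Fin n)) (1/2) ⊆ ball 0 (9/10) := ball_subset_ball (by norm_num)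
  have h91 : ball (0 : EuclideanSpace ℝ (Fin n)) (9/10) ⊆ ball 0 1 := ball_subset_ball (by norm_num)
  obtain ⟨e1, e2⟩ := hK κ hκ A u G hS hlip (fun x hx => by rw [(hu x hx).1]; exact hs.2.1 x (h91 hx))
  have big : exp (2 * K * κ) ≤ (2 * K * Real.exp κ) ^ (2 * K * Real.exp (4 * Λ * κ)) := by
    have b1 : exp κ ≤ 2 * K * exp κ := by have := exp_pos κ; nlinarith
    have b2 : 2 * K ≤ 2 * K * exp (4 * Λ * κ) := by
      have : 1 ≤ exp (4 * Λ * κ) := one_le_exp (by positivity)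
      nlinarith
    have b3 : 1 ≤ exp κ := one_le_exp (by linarith)
    calc exp (2 * K * κ) = exp κ ^ (2 * K) := by rw [← exp_mul, mul_comm κ]
      _ ≤ (2 * K * exp κ) ^ (2 * K) := by gcongr
      _ ≤ _ := rpow_le_rpow_of_exponent_le (by linarith) b2
  have half : exp (K * κ) ≤ exp (2 * K * κ) := by apply exp_le_exp.2; nlinarith
  constructor
  · intro x hx
    refine le_trans ?_ big
    have g := e1 x (h34 hx)
    rw [(hu x (h9 hx)).2] at g
    have b := hs.2.1 x (h91 (h9 hx))
    rw [abs_of_nonneg b.1]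
    have c1 := add_one_le_exp (K * κ)
    have c2 : κ ≤ exp (K * κ) := by nlinarith
    have c3 : (2:ℝ) ≤ exp (K * κ) := by nlinarith
    have c4 : exp (2 * K * κ) = exp (K * κ) * exp (K * κ) := by rw [← exp_add]; congr 1; ring
    rw [c4]
    nlinarith
  · intro x hx y hy
    have g := e2 x hx y hy
    rw [(hu x (h9 hx)).2, (hu y (h9 hy)).2] at g
    refine g.trans ?_
    gcongr
    exact half.trans big
end

section
/- Let μ = (√89 − 3)/8 and β = 2(2 + μ)/(1 + μ). Then μ ∈ (0.1, 0.9), μβ = 5/2, and there exists ε₀ ∈ (0,1) such that for every ε ∈ (0, ε₀), setting δ = ε^β, for every d ∈ [0, ε]: 2μ(2 + δ) δ^{1+μ} / (1 + δ − cos d)^{2+μ} > 1. -/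
open Real

/-- **The single-valley lower bound** (from the proof of Theorem 7.1 /
`prop-anisotropic-phi-one`): with `μ = (√89 - 3)/8` and `β = 2(2 + μ)/(1 + μ)`, one has
`μ ∈ (0.1, 0.9)`, `μβ = 5/2`, and there is an `ε₀ ∈ (0,1)` such that for all
`ε ∈ (0, ε₀)`, setting `δ = ε^β`, for every `d ∈ [0, ε]`,
`2μ(2 + δ) δ^{1+μ} / (1 + δ - cos d)^{2+μ} > 1`. -/
theorem single_valley_lower_bound (μ β : ℝ)
    (hμ : μ = (Real.sqrt 89 - 3) / 8) (hβ : β = 2 * (2 + μ) / (1 + μ)) :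
    μ ∈ Set.Ioo (0.1 : ℝ) 0.9 ∧ μ * β = 5/2 ∧
    ∃ ε₀ ∈ Set.Ioo (0:ℝ) 1, ∀ ε ∈ Set.Ioo (0:ℝ) ε₀, ∀ δ : ℝ, δ = ε ^ β →
      ∀ d ∈ Set.Icc (0:ℝ) ε,
        1 < 2 * μ * (2 + δ) * δ ^ (1 + μ) / (1 + δ - Real.cos d) ^ (2 + μ) := by
  have h89 : Real.sqrt 89 ^ 2 = 89 := Real.sq_sqrt (by norm_num)
  have hs0 : 0 ≤ Real.sqrt 89 := Real.sqrt_nonneg 89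
  have hs1 : 9 < Real.sqrt 89 := by nlinarith
  have hs2 : Real.sqrt 89 < 10 := by nlinarith
  have hm1 : 3 / 4 < μ := by linarith
  have hm2 : μ < 0.9 := by rw [hμ]; norm_num; nlinarith
  have hq : 4 * μ ^ 2 + 3 * μ - 5 = 0 := by rw [hμ]; nlinarith
  have hpos : 0 < 1 + μ := by linarith
  have hb : β * (1 + μ) = 2 * (2 + μ) := by rw [hβ]; field_simp
  refine ⟨⟨by norm_num; linarith, hm2⟩, ?_, 1 / 2, by norm_num, ?_⟩
  · rw [hβ]; field_simp; nlinarith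
  rintro ε ⟨he0, he1⟩ δ hδ d ⟨hd0, hd1⟩
  have hb3 : 3 ≤ β := by
    rw [hβ, le_div_iff₀ hpos]; norm_num at hm2; linarith
  have hδ0 : 0 < δ := by rw [hδ]; exact Real.rpow_pos_of_pos he0 _
  have hδ3 : δ ≤ ε ^ 3 := by
    rw [hδ, ← Real.rpow_natCast ε 3]
    exact Real.rpow_le_rpow_of_exponent_ge he0 (by linarith) (by push_cast; exact hb3)
  have hpow : δ ^ (1 + μ) = (ε ^ 2) ^ (2 + μ) := by
    rw [hδ, ← Real.rpow_mul he0.le, hb, ← Real.rpow_natCast ε 2, ← Real.rpow_mul he0.le]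
    norm_num
  have hc := Real.one_sub_sq_div_two_le_cos (x := d)
  have hc1 := Real.cos_le_one d
  have hB0 : 0 < 1 + δ - Real.cos d := by linarith
  have hd2 : d ^ 2 ≤ ε ^ 2 := by gcongr
  have he3 : ε ^ 3 ≤ ε ^ 2 / 2 := by nlinarith [sq_nonneg ε]
  have hB : 1 + δ - Real.cos d ≤ ε ^ 2 := by linarith
  have hBp : (1 + δ - Real.cos d) ^ (2 + μ) ≤ δ ^ (1 + μ) := by
    rw [hpow]; exact Real.rpow_le_rpow hB0.le hB (by linarith)
  have hP := Real.rpow_pos_of_pos hB0 (2 + μ)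
  have hD : 0 < δ ^ (1 + μ) := lt_of_lt_of_le hP hBp
  rw [lt_div_iff₀ hP, one_mul]
  have hK : 1 < 2 * μ * (2 + δ) := by nlinarith
  nlinarith
end
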